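/- There exists a constant δ > 0 such that a uniformly random Steiner triple system S on vertex set {1,…,n} asymptotically almost surely satisfies α*_3(S) ≤ n^{1−δ}; precisely: there exists δ > 0 such that for every ε > 0 there is N with the property that for every n ≥ N with n ≡ 1 or 3 (mod 6), the number of Steiner triple systems S on {1,…,n} with α*_3(S) ≤ n^{1−δ} is at least (1−ε) times the total number of Steiner triple systems on {1,…,n}. -/

import Mathlib

universe u

/-- There is a `k`-partite hole of size `a`: pairwise disjoint sets `X 0, …, X (k-1)`,
each of size `a`, such that no edge intersects all of them. -/
def HasHole {V : Type u} (k : ℕ) (E : Finset (Finset V)) (a : ℕ) : Prop :=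
  ∃ X : Fin k → Finset V,
    (∀ i, (X i).card = a) ∧
    (∀ i j, i ≠ j → Disjoint (X i) (X j)) ∧
    ∀ e ∈ E, ∃ i, ∀ v ∈ e, v ∉ X i

/-- The `k`-partite-hole number `α*_k`: the largest size of a `k`-partite hole. -/
noncomputable def holeNumber {V : Type u} (k : ℕ) (E : Finset (Finset V)) : ℕ :=
  sSup {a | HasHole k E a}

/-- `E` is the edge set of a Steiner triple system on `V`: every edge has three vertices and
every pair of distinct vertices is contained in exactly one edge. -/
def IsSTS {V : Type u} (E : Finset (Finset V)) : Prop :=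
  (∀ e ∈ E, e.card = 3) ∧
  ∀ x y : V, x ≠ y → ∃! e, e ∈ E ∧ x ∈ e ∧ y ∈ e

namespace STSHole

open Finset

section WeightedTripleSystem

variable {ι E : Type*} [DecidableEq ι] [DecidableEq E]

/-- A linear system of triples `B T`, `T ∈ 𝒯`, with nonnegative weights bounded by `ω`. -/
structure LinearSystem (𝒯 : Finset ι) (B : ι → Finset E) (w : ι → ℝ) (ω : ℝ) : Prop where
  card_eq : ∀ T ∈ 𝒯, (B T).card = 3
  inter_le : ∀ T ∈ 𝒯, ∀ T' ∈ 𝒯, T ≠ T' → (B T ∩ B T').card ≤ 1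
  nonneg : ∀ T ∈ 𝒯, 0 ≤ w T
  le : ∀ T ∈ 𝒯, w T ≤ ω

/-- The triples contained in `A`. -/
def avail (𝒯 : Finset ι) (B : ι → Finset E) (A : Finset E) : Finset ι :=
  𝒯.filter fun T => B T ⊆ A

/-- The weighted degree of `e` among the triples contained in `A`. -/
def wdeg (𝒯 : Finset ι) (B : ι → Finset E) (w : ι → ℝ) (A : Finset E) (e : E) : ℝ :=
  ∑ T ∈ avail 𝒯 B A with e ∈ B T, w T

/-- The loss of weighted degree at `e` caused by the removal of the triple `T`. -/
def loss (𝒯 : Finset ι) (B : ι → Finset E) (w : ι → ℝ) (A : Finset E) (e : E) (T : ι) : ℝ :=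
  ∑ T' ∈ avail 𝒯 B A with e ∈ B T' ∧ ¬ Disjoint (B T') (B T), w T'

variable {𝒯 : Finset ι} {B : ι → Finset E} {w : ι → ℝ} {ω : ℝ}

lemma mem_avail {A : Finset E} {T : ι} : T ∈ avail 𝒯 B A ↔ T ∈ 𝒯 ∧ B T ⊆ A := by
  simp [avail]

lemma LinearSystem.eq_of_mem (h : LinearSystem 𝒯 B w ω) {T T' : ι} (hT : T ∈ 𝒯) (hT' : T' ∈ 𝒯)
    {e f : E} (hef : e ≠ f) (h1 : e ∈ B T) (h2 : f ∈ B T) (h3 : e ∈ B T') (h4 : f ∈ B T') :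
    T = T' := by
  by_contra hne
  have := h.inter_le T hT T' hT' hne
  have h5 : ({e, f} : Finset E) ⊆ B T ∩ B T' := by
    intro x hx
    simp only [mem_insert, mem_singleton] at hx
    rcases hx with rfl | rfl <;> simp [*]
  have := card_le_card h5
  rw [card_pair hef] at this
  omega

lemma LinearSystem.sum_wdeg (h : LinearSystem 𝒯 B w ω) (A : Finset E) :
    ∑ e ∈ A, wdeg 𝒯 B w A e = 3 * ∑ T ∈ avail 𝒯 B A, w T := by
  simp only [wdeg, sum_filter]
  rw [sum_comm, mul_sum]
  refine sum_congr rfl fun T hT => ?_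
  rw [mem_avail] at hT
  rw [← sum_filter, sum_const, filter_mem_eq_inter, inter_eq_right.mpr hT.2, h.card_eq T hT.1]
  simp

lemma wdeg_sdiff (A : Finset E) (e : E) (T : ι) :
    wdeg 𝒯 B w (A \ B T) e = wdeg 𝒯 B w A e - loss 𝒯 B w A e T := by
  rw [eq_sub_iff_add_eq, wdeg, wdeg, loss, ← sum_filter_add_sum_filter_not
    ((avail 𝒯 B A).filter fun T' => e ∈ B T') (fun T' => Disjoint (B T') (B T))]
  congr 1
  · refine sum_congr ?_ fun _ _ => rfl
    ext T'
    simp only [mem_filter, mem_avail, subset_sdiff]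
    tauto
  · refine sum_congr ?_ fun _ _ => rfl
    ext T'
    simp only [mem_filter]
    tauto

lemma loss_nonneg (h : LinearSystem 𝒯 B w ω) (A : Finset E) (e : E) (T : ι) :
    0 ≤ loss 𝒯 B w A e T := by
  refine sum_nonneg fun T' hT' => h.nonneg T' ?_
  simp only [mem_filter, mem_avail] at hT'
  exact hT'.1.1

lemma loss_le (h : LinearSystem 𝒯 B w ω) (hω : 0 ≤ ω) (A : Finset E) (e : E) {T : ι} (hT : T ∈ 𝒯)
    (he : e ∉ B T) : loss 𝒯 B w A e T ≤ 3 * ω := by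
  have h1 : loss 𝒯 B w A e T ≤
      ∑ f ∈ B T, ∑ T' ∈ avail 𝒯 B A with e ∈ B T' ∧ f ∈ B T', w T' := by
    simp only [loss, sum_filter]
    rw [sum_comm]
    refine sum_le_sum fun T' hT' => ?_
    rw [mem_avail] at hT'
    have h0 := h.nonneg T' hT'.1
    split_ifs with hc
    · obtain ⟨f, hf1, hf2⟩ := not_disjoint_iff.mp hc.2
      calc w T' = if e ∈ B T' ∧ f ∈ B T' then w T' else 0 := by simp [hc.1, hf1]
        _ ≤ _ := single_le_sum (f := fun f => if e ∈ B T' ∧ f ∈ B T' then w T' else 0)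
          (fun i _ => by split_ifs <;> simp [h0]) hf2
    · exact sum_nonneg fun i _ => by split_ifs <;> simp [h0]
  refine h1.trans ?_
  have h3 : (3 : ℝ) = ((B T).card : ℝ) := by rw [h.card_eq T hT]; norm_num
  rw [h3, ← nsmul_eq_mul]
  refine sum_le_card_nsmul _ _ _ fun f hf => ?_
  have hne : e ≠ f := fun hh => he (hh ▸ hf)
  have hc : ((avail 𝒯 B A).filter fun T' => e ∈ B T' ∧ f ∈ B T').card ≤ 1 := by
    rw [card_le_one]
    intro a ha b hb
    simp only [mem_filter, mem_avail] at ha hb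
    exact h.eq_of_mem ha.1.1 hb.1.1 hne ha.2.1 ha.2.2 hb.2.1 hb.2.2
  calc _ ≤ ((avail 𝒯 B A).filter fun T' => e ∈ B T' ∧ f ∈ B T').card • ω :=
        sum_le_card_nsmul _ _ _ fun T' hT' => by
          simp only [mem_filter, mem_avail] at hT'
          exact h.le T' hT'.1.1
    _ ≤ 1 • ω := by gcongr
    _ = ω := one_nsmul ω

lemma sum_loss_eq (A : Finset E) (e : E) :
    ∑ T ∈ avail 𝒯 B A with e ∉ B T, w T * loss 𝒯 B w A e T =
      ∑ T' ∈ avail 𝒯 B A with e ∈ B T', w T' *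
        ∑ T ∈ avail 𝒯 B A with e ∉ B T ∧ ¬ Disjoint (B T') (B T), w T := by
  simp only [loss, mul_sum]
  rw [sum_sigma', sum_sigma']
  refine sum_bij' (fun x _ => ⟨x.2, x.1⟩) (fun x _ => ⟨x.2, x.1⟩) ?_ ?_ ?_ ?_ ?_
  · rintro ⟨a, b⟩ hx; simp only [mem_sigma, mem_filter] at hx ⊢; tauto
  · rintro ⟨a, b⟩ hx; simp only [mem_sigma, mem_filter] at hx ⊢; tauto
  · intros; rfl
  · intros; rfl
  · rintro ⟨a, b⟩ hx; exact mul_comm _ _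

lemma sum_loss_le (h : LinearSystem 𝒯 B w ω) (A : Finset E) (e : E) (c : ℝ)
    (hc : ∀ f ∈ A, wdeg 𝒯 B w A f ≤ c) :
    ∑ T ∈ avail 𝒯 B A with e ∉ B T, w T * loss 𝒯 B w A e T ≤ wdeg 𝒯 B w A e * (2 * c) := by
  rw [sum_loss_eq, wdeg, sum_mul]
  refine sum_le_sum fun T' hT' => ?_
  simp only [mem_filter, mem_avail] at hT'
  refine mul_le_mul_of_nonneg_left ?_ (h.nonneg _ hT'.1.1)
  have h1 : ∑ T ∈ avail 𝒯 B A with e ∉ B T ∧ ¬ Disjoint (B T') (B T), w T ≤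
      ∑ f ∈ (B T').erase e, wdeg 𝒯 B w A f := by
    simp only [wdeg, sum_filter]
    rw [sum_comm]
    refine sum_le_sum fun T hT => ?_
    rw [mem_avail] at hT
    have h0 := h.nonneg T hT.1
    split_ifs with hc
    · obtain ⟨f, hf1, hf2⟩ := not_disjoint_iff.mp hc.2
      have hf : f ∈ (B T').erase e := mem_erase.mpr ⟨fun hh => hc.1 (hh ▸ hf2), hf1⟩
      calc w T = if f ∈ B T then w T else 0 := by simp [hf2]
        _ ≤ _ := single_le_sum (f := fun f => if f ∈ B T then w T else 0)
          (fun i _ => by split_ifs <;> simp [h0]) hf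
    · exact sum_nonneg fun i _ => by split_ifs <;> simp [h0]
  refine h1.trans ((sum_le_card_nsmul _ _ c fun f hf => hc f
    (hT'.1.2 (mem_of_mem_erase hf))).trans ?_)
  rw [card_erase_of_mem hT'.2, h.card_eq _ hT'.1.1]
  simp

lemma le_sum_loss (h : LinearSystem 𝒯 B w ω) (A : Finset E) (e : E) (c : ℝ)
    (hc : ∀ f ∈ A, c ≤ wdeg 𝒯 B w A f) :
    wdeg 𝒯 B w A e * (2 * (c - ω)) ≤
      ∑ T ∈ avail 𝒯 B A with e ∉ B T, w T * loss 𝒯 B w A e T := by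
  rw [sum_loss_eq, wdeg, sum_mul]
  refine sum_le_sum fun T' hT' => ?_
  simp only [mem_filter, mem_avail] at hT'
  refine mul_le_mul_of_nonneg_left ?_ (h.nonneg _ hT'.1.1)
  have h1 : ∑ f ∈ (B T').erase e, (wdeg 𝒯 B w A f - w T') ≤
      ∑ T ∈ avail 𝒯 B A with e ∉ B T ∧ ¬ Disjoint (B T') (B T), w T := by
    have h2 : ∀ f ∈ (B T').erase e, wdeg 𝒯 B w A f - w T' =
        ∑ T ∈ (avail 𝒯 B A).erase T', if f ∈ B T then w T else 0 := by
      intro f hf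
      have hT'm : T' ∈ avail 𝒯 B A := mem_avail.mpr hT'.1
      rw [wdeg, sum_filter, ← add_sum_erase _ _ hT'm, if_pos (mem_of_mem_erase hf)]
      ring
    rw [sum_congr rfl h2, sum_comm, sum_filter, ← add_sum_erase _ _ (mem_avail.mpr hT'.1)]
    rw [if_neg (by tauto), zero_add]
    refine sum_le_sum fun T hT => ?_
    rw [mem_erase, mem_avail] at hT
    have h0 := h.nonneg T hT.2.1
    rw [← sum_filter, sum_const, nsmul_eq_mul]
    have hle := h.inter_le T' hT'.1.1 T hT.2.1 hT.1.symm
    have hsub : ((B T').erase e).filter (fun f => f ∈ B T) ⊆ B T' ∩ B T := by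
      intro f hf; simp only [mem_filter, mem_erase, mem_inter] at hf ⊢; tauto
    split_ifs with hh
    · have : (((B T').erase e).filter (fun f => f ∈ B T)).card ≤ 1 :=
        (card_le_card hsub).trans hle
      have h3 : ((((B T').erase e).filter (fun f => f ∈ B T)).card : ℝ) ≤ 1 := by
        exact_mod_cast this
      nlinarith
    · have : ((B T').erase e).filter (fun f => f ∈ B T) = ∅ := by
        rw [filter_eq_empty_iff]
        intro f hf hfT
        rw [mem_erase] at hf
        have hnd : ¬ Disjoint (B T') (B T) := not_disjoint_iff.mpr ⟨f, hf.2, hfT⟩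
        have heT : e ∈ B T := by by_contra h4; exact hh ⟨h4, hnd⟩
        exact hT.1 (h.eq_of_mem hT.2.1 hT'.1.1 hf.1 hfT heT hf.2 hT'.2)
      rw [this]; simp
  refine le_trans ?_ h1
  have h5 : ((B T').erase e).card • (c - ω) ≤ ∑ f ∈ (B T').erase e, (wdeg 𝒯 B w A f - w T') :=
    card_nsmul_le_sum _ _ _ fun f hf => by
      have := hc f (hT'.1.2 (mem_of_mem_erase hf))
      have := h.le _ hT'.1.1
      linarith
  rw [card_erase_of_mem hT'.2, h.card_eq _ hT'.1.1] at h5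
  simpa using h5

end WeightedTripleSystem

section Potential

variable {ι E V : Type*} [DecidableEq ι] [DecidableEq E]

/-- The potential controlling weighted degrees (which should be close to `p ^ 2`, with error `δ`)
and the sizes of the sets `Ex x ∩ A` (which should be at most `3 * s / ω`). -/
noncomputable def potential (𝒯 : Finset ι) (B : ι → Finset E) (w : ι → ℝ) (ω l : ℝ)
    (Ex : V → Finset E) (S : Finset V) (p δ s : ℝ) (A : Finset E) : ℝ :=
  ∑ e ∈ A, (Real.exp (l * (wdeg 𝒯 B w A e - p ^ 2 - δ)) +
    Real.exp (l * (p ^ 2 - wdeg 𝒯 B w A e - δ))) +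
    ∑ x ∈ S, Real.exp (l * (ω * ((Ex x ∩ A).card : ℝ) / s - 3))

variable {𝒯 : Finset ι} {B : ι → Finset E} {w : ι → ℝ} {ω l : ℝ}
  {Ex : V → Finset E} {S : Finset V} {p δ s : ℝ}

lemma potential_nonneg (A : Finset E) : 0 ≤ potential 𝒯 B w ω l Ex S p δ s A := by
  unfold potential
  positivity

lemma abs_wdeg_sub_le_of_potential_lt_one (hl : 0 < l) {A : Finset E}
    (h : potential 𝒯 B w ω l Ex S p δ s A < 1) {e : E} (he : e ∈ A) :
    p ^ 2 - δ ≤ wdeg 𝒯 B w A e ∧ wdeg 𝒯 B w A e ≤ p ^ 2 + δ := by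
  have h1 : Real.exp (l * (wdeg 𝒯 B w A e - p ^ 2 - δ)) +
    Real.exp (l * (p ^ 2 - wdeg 𝒯 B w A e - δ)) < 1 := by
    refine lt_of_le_of_lt ?_ h
    unfold potential
    refine le_trans (single_le_sum (f := fun e => Real.exp (l * (wdeg 𝒯 B w A e - p ^ 2 - δ)) +
      Real.exp (l * (p ^ 2 - wdeg 𝒯 B w A e - δ))) (fun i _ => by positivity) he) ?_
    exact le_add_of_nonneg_right (by positivity)
  have h2 := Real.exp_pos (l * (wdeg 𝒯 B w A e - p ^ 2 - δ))
  have h3 := Real.exp_pos (l * (p ^ 2 - wdeg 𝒯 B w A e - δ))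
  have h4 : l * (wdeg 𝒯 B w A e - p ^ 2 - δ) < 0 := Real.exp_lt_one_iff.mp (by linarith)
  have h5 : l * (p ^ 2 - wdeg 𝒯 B w A e - δ) < 0 := Real.exp_lt_one_iff.mp (by linarith)
  constructor <;> nlinarith

lemma card_inter_le_of_potential_lt_one (hl : 0 < l) (hs : 0 < s) {A : Finset E}
    (h : potential 𝒯 B w ω l Ex S p δ s A < 1) {x : V} (hx : x ∈ S) :
    ω * ((Ex x ∩ A).card : ℝ) ≤ 3 * s := by
  have h1 : Real.exp (l * (ω * ((Ex x ∩ A).card : ℝ) / s - 3)) < 1 := by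
    refine lt_of_le_of_lt ?_ h
    unfold potential
    refine le_trans (single_le_sum
      (f := fun x => Real.exp (l * (ω * ((Ex x ∩ A).card : ℝ) / s - 3)))
      (fun i _ => by positivity) hx) ?_
    exact le_add_of_nonneg_left (by positivity)
  have h4 : l * (ω * ((Ex x ∩ A).card : ℝ) / s - 3) < 0 := Real.exp_lt_one_iff.mp h1
  have h5 : ω * ((Ex x ∩ A).card : ℝ) / s < 3 := by nlinarith
  rw [div_lt_iff₀ hs] at h5
  exact h5.le

lemma exp_neg_le_one_sub {u c : ℝ} (hu : 0 ≤ u) (huc : u ≤ c) (hc : c ≤ 1) :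
    Real.exp (-u) ≤ 1 - u * (1 - c) := by
  have h := Real.abs_exp_sub_one_sub_id_le (x := -u) (by rw [abs_neg, abs_of_nonneg hu]; linarith)
  have h2 := (abs_le.mp h).2
  nlinarith

lemma exp_le_one_add {u c : ℝ} (hu : 0 ≤ u) (huc : u ≤ c) (hc : c ≤ 1) :
    Real.exp u ≤ 1 + u * (1 + c) := by
  have h := Real.abs_exp_sub_one_sub_id_le (x := u) (by rw [abs_of_nonneg hu]; linarith)
  have h2 := (abs_le.mp h).2
  nlinarith

lemma sum_mul_card_inter (A F : Finset E) :
    ∑ T ∈ avail 𝒯 B A, w T * ((F ∩ B T).card : ℝ) = ∑ e ∈ F ∩ A, wdeg 𝒯 B w A e := by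
  simp only [wdeg, sum_filter]
  rw [sum_comm]
  refine sum_congr rfl fun T hT => ?_
  rw [mem_avail] at hT
  rw [← sum_filter, sum_const, filter_mem_eq_inter, inter_assoc, inter_eq_right.mpr hT.2,
    nsmul_eq_mul, mul_comm]

lemma upper_drift {P δ ω x L Q G M : ℝ} (hP : 0 < P) (hP1 : P ≤ 1) (hδ : 0 < δ)
    (hωδ : ω ≤ δ / 100) (hx : x ≤ δ / 60) (hδP : δ ≤ P / 100)
    (hL : 2 * (P - δ) * (P - δ - ω) ≤ L) (hQ0 : 0 ≤ Q) (hQu : 3 * Q ≤ M * (P + δ))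
    (hG : M * G ≤ 6 * P - 36 * δ) : Q * G ≤ (1 - 3 * x) * L := by
  have h0 : 0 ≤ P - δ - ω := by linarith
  have h1 : 0 ≤ 2 * (P - δ) := by linarith
  have hx1 : 0 ≤ 1 - 3 * x := by linarith
  have hL0 : 0 ≤ L := (mul_nonneg h1 h0).trans hL
  rcases le_or_gt G 0 with hG0 | hG0
  · linarith [mul_nonneg_of_nonpos_of_nonpos (neg_nonpos.mpr hQ0) hG0, mul_nonneg hx1 hL0]
  · have e1 : 3 * Q * G ≤ M * (P + δ) * G := mul_le_mul_of_nonneg_right hQu hG0.le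
    have e4 : (P + δ) * (M * G) ≤ (P + δ) * (6 * P - 36 * δ) :=
      mul_le_mul_of_nonneg_left hG (by linarith)
    have e5 : (1 - 3 * x) * (2 * (P - δ) * (P - δ - ω)) ≤ (1 - 3 * x) * L :=
      mul_le_mul_of_nonneg_left hL hx1
    have e6 : (1 - δ / 20) * (2 * (P - δ) * (P - δ - δ / 100)) ≤
        (1 - 3 * x) * (2 * (P - δ) * (P - δ - ω)) := by
      refine mul_le_mul (by linarith) ?_ (mul_nonneg h1 (by linarith)) hx1
      exact mul_le_mul_of_nonneg_left (by linarith) h1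
    have : (P + δ) * (6 * P - 36 * δ) ≤
        3 * ((1 - δ / 20) * (2 * (P - δ) * (P - δ - δ / 100))) := by
      have t : (P - δ) * (P - δ - δ / 100) ≤ P := by
        refine (mul_le_mul (by linarith) (by linarith) (by linarith) hP.le : _ ≤ P * 1).trans ?_
        linarith
      nlinarith only [mul_nonneg hδ.le hP.le, mul_le_mul_of_nonneg_left t hδ.le, mul_self_nonneg δ]
    linarith

lemma lower_drift {P δ x L Q G M : ℝ} (hP : 0 < P) (hP1 : P ≤ 1) (hδ : 0 < δ)
    (hx : x ≤ δ / 60) (hδP : δ ≤ P / 100) (hM : 0 < M) (hL0 : 0 ≤ L)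
    (hL : L ≤ 2 * (P + δ) ^ 2) (hQl : M * (P - δ) ≤ 3 * Q)
    (hG : 6 * P + 35 * δ ≤ M * G) : (1 + 3 * x) * L ≤ Q * G := by
  have hG0 : 0 ≤ G := nonneg_of_mul_nonneg_right (a := M) (by linarith) hM
  have e1 : M * (P - δ) * G ≤ 3 * Q * G := mul_le_mul_of_nonneg_right hQl hG0
  have e4 : (P - δ) * (6 * P + 35 * δ) ≤ (P - δ) * (M * G) :=
    mul_le_mul_of_nonneg_left hG (by linarith)
  have e5 : (1 + 3 * x) * L ≤ (1 + δ / 20) * (2 * (P + δ) ^ 2) :=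
    mul_le_mul (by linarith) hL hL0 (by positivity)
  have : 3 * ((1 + δ / 20) * (2 * (P + δ) ^ 2)) ≤ (P - δ) * (6 * P + 35 * δ) := by
    have t : (P + δ) ^ 2 ≤ 2 * P := by nlinarith only [hP, hP1, hδ, hδP]
    nlinarith only [mul_nonneg hδ.le hP.le, mul_le_mul_of_nonneg_left t hδ.le,
      mul_le_mul_of_nonneg_left hδP hδ.le]
  linarith

set_option maxHeartbeats 1000000 in
/-- One step of the random greedy process does not increase the potential on average. -/
lemma sum_mul_potential_le (h : LinearSystem 𝒯 B w ω) {N p' δ' s' : ℝ} {A : Finset E}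
    (hcard : (A.card : ℝ) = p * N) (hp' : p' = p - 3 / N) (hp : 0 < p) (hp1 : p ≤ 1) (hN : 0 < N)
    (hω : 0 < ω) (hl : 0 < l) (hδ : 0 < δ)
    (hlω : l * ω ≤ δ / 60) (hωδ : ω ≤ δ / 100) (hδp : δ ≤ p ^ 2 / 100) (hδN : 9 * p ≤ δ * N)
    (hδ' : 36 * δ ≤ p * N * (δ' - δ)) (hs' : 0 < s') (hs's : s' ≤ s) (hlωs : 30 * (l * ω) ≤ s')
    (hss : (s - s') * (p * N) ≤ 2 * s)
    (hΦ : potential 𝒯 B w ω l Ex S p δ s A < 1) :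
    ∑ T ∈ avail 𝒯 B A, w T * potential 𝒯 B w ω l Ex S p' δ' s' (A \ B T) ≤
      (∑ T ∈ avail 𝒯 B A, w T) * potential 𝒯 B w ω l Ex S p δ s A := by
  set Q := ∑ T ∈ avail 𝒯 B A, w T with hQ
  have hY : ∀ e ∈ A, p ^ 2 - δ ≤ wdeg 𝒯 B w A e ∧ wdeg 𝒯 B w A e ≤ p ^ 2 + δ :=
    fun e he => abs_wdeg_sub_le_of_potential_lt_one hl hΦ he
  have hsum := h.sum_wdeg A
  rw [← hQ] at hsum
  have hQl : p * N * (p ^ 2 - δ) ≤ 3 * Q := by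
    rw [← hsum, ← hcard, ← nsmul_eq_mul]
    exact card_nsmul_le_sum _ _ _ fun e he => (hY e he).1
  have hQu : 3 * Q ≤ p * N * (p ^ 2 + δ) := by
    rw [← hsum, ← hcard, ← nsmul_eq_mul]
    exact sum_le_card_nsmul _ _ _ fun e he => (hY e he).2
  have hpN : 0 < p * N := by positivity
  have hp2 : 0 < p ^ 2 := by positivity
  have hp21 : p ^ 2 ≤ 1 := pow_le_one₀ hp.le hp1
  have hQ0 : 0 ≤ Q := by
    have := mul_nonneg hpN.le (by linarith : 0 ≤ p ^ 2 - δ)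
    linarith
  have hwnn : ∀ T ∈ avail 𝒯 B A, 0 ≤ w T := fun T hT => h.nonneg T (mem_avail.mp hT).1
  have hlω0 : 0 < l * ω := by positivity
  set D := δ' - δ with hD
  have hpp : p ^ 2 - p' ^ 2 = (3 / N) * (2 * p - 3 / N) := by rw [hp']; ring
  have hN3 : 3 / N * N = 3 := div_mul_cancel₀ 3 hN.ne'
  set r := 3 / N with hr
  have hr0 : 0 < r := by positivity
  -- upper tail
  have hplus : ∀ e ∈ A, ∑ T ∈ avail 𝒯 B A with e ∉ B T,
      w T * Real.exp (l * (wdeg 𝒯 B w (A \ B T) e - p' ^ 2 - δ')) ≤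
      Q * Real.exp (l * (wdeg 𝒯 B w A e - p ^ 2 - δ)) := by
    intro e he
    have hL := le_sum_loss h A e (p ^ 2 - δ) fun f hf => (hY f hf).1
    have hL2 : 2 * (p ^ 2 - δ) * (p ^ 2 - δ - ω) ≤
        ∑ T ∈ avail 𝒯 B A with e ∉ B T, w T * loss 𝒯 B w A e T := by
      refine le_trans ?_ hL
      have := (hY e he).1
      have h0 : 0 ≤ p ^ 2 - δ - ω := by linarith
      have := mul_le_mul_of_nonneg_right this h0
      linarith
    set L := ∑ T ∈ avail 𝒯 B A with e ∉ B T, w T * loss 𝒯 B w A e T with hLdef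
    have h1 : ∑ T ∈ avail 𝒯 B A with e ∉ B T,
        w T * Real.exp (l * (wdeg 𝒯 B w (A \ B T) e - p' ^ 2 - δ')) ≤
        Real.exp (l * (wdeg 𝒯 B w A e - p ^ 2 - δ)) * (Real.exp (l * (p ^ 2 - p' ^ 2 - D)) *
          (Q - l * (1 - 3 * (l * ω)) * L)) := by
      have h2 : Q - l * (1 - 3 * (l * ω)) * L ≥ ∑ T ∈ avail 𝒯 B A with e ∉ B T,
          w T * Real.exp (-(l * loss 𝒯 B w A e T)) := by
        have h3 : ∑ T ∈ avail 𝒯 B A with e ∉ B T, w T ≤ Q :=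
          sum_le_sum_of_subset_of_nonneg (filter_subset _ _) fun T hT _ => hwnn T hT
        have h4 : ∑ T ∈ avail 𝒯 B A with e ∉ B T, w T * Real.exp (-(l * loss 𝒯 B w A e T)) ≤
            ∑ T ∈ avail 𝒯 B A with e ∉ B T, (w T - l * (1 - 3 * (l * ω)) *
              (w T * loss 𝒯 B w A e T)) := by
          refine sum_le_sum fun T hT => ?_
          rw [mem_filter, mem_avail] at hT
          have h5 := loss_le h hω.le A e hT.1.1 hT.2
          have h6 := loss_nonneg h A e T
          have h7 := exp_neg_le_one_sub (u := l * loss 𝒯 B w A e T) (c := 3 * (l * ω))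
            (by positivity)
            (by linarith [mul_le_mul_of_nonneg_left h5 hl.le]) (by linarith)
          have h8 := mul_le_mul_of_nonneg_left h7 (h.nonneg T hT.1.1)
          linarith
        rw [sum_sub_distrib, ← mul_sum] at h4
        linarith
      refine le_trans (le_of_eq ?_) (mul_le_mul_of_nonneg_left (mul_le_mul_of_nonneg_left h2
        (Real.exp_pos _).le) (Real.exp_pos _).le)
      rw [mul_sum, mul_sum]
      refine sum_congr rfl fun T hT => ?_
      rw [wdeg_sdiff, mul_left_comm (Real.exp _) (w T), mul_left_comm (Real.exp _) (w T),
        ← Real.exp_add, ← Real.exp_add]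
      congr 2
      rw [hD]; ring
    refine h1.trans ?_
    rw [mul_comm]
    refine mul_le_mul_of_nonneg_right ?_ (Real.exp_pos _).le
    set G := p ^ 2 - p' ^ 2 - D with hG
    have hkey : Q * G ≤ (1 - 3 * (l * ω)) * L := by
      refine upper_drift (M := p * N) hp2 hp21 hδ hωδ hlω hδp hL2 hQ0 hQu ?_
      have : p * N * G = p * N * (r * (2 * p - r)) - p * N * D := by rw [hG, hpp]; ring
      have e3 : p * N * (r * (2 * p - r)) = 6 * p ^ 2 - 3 * (p * r) := by
        linear_combination (p * (2 * p - r)) * hN3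
      have := mul_pos hp hr0
      linarith
    have hexp : Real.exp (l * G) * Real.exp (-(l * G)) = 1 := by
      rw [← Real.exp_add]; simp
    have hlow : 1 - l * G ≤ Real.exp (-(l * G)) := by
      have := Real.add_one_le_exp (-(l * G)); linarith
    have : Q - l * (1 - 3 * (l * ω)) * L ≤ Q * Real.exp (-(l * G)) := by
      have a1 := mul_le_mul_of_nonneg_left hlow hQ0
      have a2 := mul_le_mul_of_nonneg_left hkey hl.le
      linarith
    calc _ ≤ Real.exp (l * G) * (Q * Real.exp (-(l * G))) :=
          mul_le_mul_of_nonneg_left this (Real.exp_pos _).le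
      _ = Q := by rw [mul_left_comm, hexp, mul_one]
  -- lower tail
  have hminus : ∀ e ∈ A, ∑ T ∈ avail 𝒯 B A with e ∉ B T,
      w T * Real.exp (l * (p' ^ 2 - wdeg 𝒯 B w (A \ B T) e - δ')) ≤
      Q * Real.exp (l * (p ^ 2 - wdeg 𝒯 B w A e - δ)) := by
    intro e he
    have hL := sum_loss_le h A e (p ^ 2 + δ) fun f hf => (hY f hf).2
    have hL2 : ∑ T ∈ avail 𝒯 B A with e ∉ B T, w T * loss 𝒯 B w A e T ≤
        2 * (p ^ 2 + δ) ^ 2 := by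
      refine hL.trans ?_
      have := mul_le_mul_of_nonneg_right (hY e he).2 (by positivity : 0 ≤ 2 * (p ^ 2 + δ))
      linarith
    set L := ∑ T ∈ avail 𝒯 B A with e ∉ B T, w T * loss 𝒯 B w A e T with hLdef
    have h1 : ∑ T ∈ avail 𝒯 B A with e ∉ B T,
        w T * Real.exp (l * (p' ^ 2 - wdeg 𝒯 B w (A \ B T) e - δ')) ≤
        Real.exp (l * (p ^ 2 - wdeg 𝒯 B w A e - δ)) * (Real.exp (-(l * (p ^ 2 - p' ^ 2 + D))) *
          (Q + l * (1 + 3 * (l * ω)) * L)) := by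
      have h2 : ∑ T ∈ avail 𝒯 B A with e ∉ B T,
          w T * Real.exp (l * loss 𝒯 B w A e T) ≤ Q + l * (1 + 3 * (l * ω)) * L := by
        have h3 : ∑ T ∈ avail 𝒯 B A with e ∉ B T, w T ≤ Q :=
          sum_le_sum_of_subset_of_nonneg (filter_subset _ _) fun T hT _ => hwnn T hT
        have h4 : ∑ T ∈ avail 𝒯 B A with e ∉ B T, w T * Real.exp (l * loss 𝒯 B w A e T) ≤
            ∑ T ∈ avail 𝒯 B A with e ∉ B T, (w T + l * (1 + 3 * (l * ω)) *
              (w T * loss 𝒯 B w A e T)) := by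
          refine sum_le_sum fun T hT => ?_
          rw [mem_filter, mem_avail] at hT
          have h5 := loss_le h hω.le A e hT.1.1 hT.2
          have h6 := loss_nonneg h A e T
          have h7 := exp_le_one_add (u := l * loss 𝒯 B w A e T) (c := 3 * (l * ω))
            (by positivity)
            (by linarith [mul_le_mul_of_nonneg_left h5 hl.le]) (by linarith)
          have h8 := mul_le_mul_of_nonneg_left h7 (h.nonneg T hT.1.1)
          linarith
        rw [sum_add_distrib, ← mul_sum] at h4
        linarith
      refine le_trans (le_of_eq ?_) (mul_le_mul_of_nonneg_left (mul_le_mul_of_nonneg_left h2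
        (Real.exp_pos _).le) (Real.exp_pos _).le)
      rw [mul_sum, mul_sum]
      refine sum_congr rfl fun T hT => ?_
      rw [wdeg_sdiff, mul_left_comm (Real.exp _) (w T), mul_left_comm (Real.exp _) (w T),
        ← Real.exp_add, ← Real.exp_add]
      congr 2
      rw [hD]; ring
    refine h1.trans ?_
    rw [mul_comm]
    refine mul_le_mul_of_nonneg_right ?_ (Real.exp_pos _).le
    set G := p ^ 2 - p' ^ 2 + D with hG
    have hkey : (1 + 3 * (l * ω)) * L ≤ Q * G := by
      refine lower_drift (M := p * N) hp2 hp21 hδ hlω hδp hpN (sum_nonneg fun T hT => mul_nonneg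
          (hwnn T (mem_filter.mp hT).1) (loss_nonneg h A e T)) hL2 hQl ?_
      have : p * N * G = p * N * (r * (2 * p - r)) + p * N * D := by rw [hG, hpp]; ring
      have e3 : p * N * (r * (2 * p - r)) = 6 * p ^ 2 - 3 * (p * r) := by
        linear_combination (p * (2 * p - r)) * hN3
      have e4 : 3 * (p * r) ≤ δ := by
        have a1 : 9 * p * r ≤ δ * N * r := mul_le_mul_of_nonneg_right hδN hr0.le
        have a2 : δ * N * r = 3 * δ := by linear_combination δ * hN3
        linarith
      linarith
    have hexp : Real.exp (l * G) * Real.exp (-(l * G)) = 1 := by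
      rw [← Real.exp_add]; simp
    have hlow : 1 + l * G ≤ Real.exp (l * G) := by
      have := Real.add_one_le_exp (l * G); linarith
    have : Q + l * (1 + 3 * (l * ω)) * L ≤ Q * Real.exp (l * G) := by
      have a1 := mul_le_mul_of_nonneg_left hlow hQ0
      have a2 := mul_le_mul_of_nonneg_left hkey hl.le
      linarith
    calc _ ≤ Real.exp (-(l * G)) * (Q * Real.exp (l * G)) :=
          mul_le_mul_of_nonneg_left this (Real.exp_pos _).le
      _ = Q := by rw [mul_left_comm, mul_comm (Real.exp _), hexp, mul_one]
  -- degrees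
  have hs : 0 < s := hs'.trans_le hs's
  have hdeg : ∀ x ∈ S, ∑ T ∈ avail 𝒯 B A,
      w T * Real.exp (l * (ω * ((Ex x ∩ (A \ B T)).card : ℝ) / s' - 3)) ≤
      Q * Real.exp (l * (ω * ((Ex x ∩ A).card : ℝ) / s - 3)) := by
    intro x hx
    set d := ((Ex x ∩ A).card : ℝ) with hd
    have hd0 : 0 ≤ d := by positivity
    have hc := sum_mul_card_inter (𝒯 := 𝒯) (B := B) (w := w) A (Ex x)
    have hL2 : d * (p ^ 2 - δ) ≤ ∑ T ∈ avail 𝒯 B A, w T * ((Ex x ∩ B T).card : ℝ) := by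
      rw [hc, hd, ← nsmul_eq_mul]
      exact card_nsmul_le_sum _ _ _ fun e he => (hY e (mem_inter.mp he).2).1
    set L := ∑ T ∈ avail 𝒯 B A, w T * ((Ex x ∩ B T).card : ℝ) with hLdef
    set μ := l * ω / s' with hμ
    have hμ0 : 0 < μ := by positivity
    have hμ1 : 3 * μ ≤ 1 / 10 := by
      have : μ * s' = l * ω := div_mul_cancel₀ _ hs'.ne'
      refine le_of_mul_le_mul_right (a := s') ?_ hs'
      linarith
    have h1 : ∀ T ∈ avail 𝒯 B A,
        w T * Real.exp (l * (ω * ((Ex x ∩ (A \ B T)).card : ℝ) / s' - 3)) ≤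
        Real.exp (μ * d - 3 * l) * (w T - 9 / 10 * μ * (w T * ((Ex x ∩ B T).card : ℝ))) := by
      intro T hT
      have hw := hwnn T hT
      rw [mem_avail] at hT
      have c1 : ((Ex x ∩ (A \ B T)).card : ℝ) = d - ((Ex x ∩ B T).card : ℝ) := by
        have : Ex x ∩ (A \ B T) = (Ex x ∩ A) \ (Ex x ∩ B T) := by
          ext; simp only [mem_inter, mem_sdiff]; tauto
        rw [this, cast_card_sdiff (inter_subset_inter_left hT.2)]
      have c2 : ((Ex x ∩ B T).card : ℝ) ≤ 3 := by
        have := card_le_card (inter_subset_right (s₁ := Ex x) (s₂ := B T))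
        rw [h.card_eq T hT.1] at this
        exact_mod_cast this
      have c3 : (0 : ℝ) ≤ ((Ex x ∩ B T).card : ℝ) := by positivity
      set c := ((Ex x ∩ B T).card : ℝ)
      have h7 := exp_neg_le_one_sub (u := μ * c) (c := 1 / 10) (by positivity)
        (by linarith [mul_le_mul_of_nonneg_left c2 hμ0.le]) (by norm_num)
      rw [c1]
      have : l * (ω * (d - c) / s' - 3) = (μ * d - 3 * l) + -(μ * c) := by
        rw [hμ]; field_simp; ring
      rw [this, Real.exp_add]
      have h8 : Real.exp (μ * d - 3 * l) * (w T * Real.exp (-(μ * c))) ≤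
          Real.exp (μ * d - 3 * l) * (w T * (1 - μ * c * (1 - 1 / 10))) := by gcongr
      calc _ = Real.exp (μ * d - 3 * l) * (w T * Real.exp (-(μ * c))) := by ring
        _ ≤ _ := h8
        _ = _ := by ring
    refine (sum_le_sum h1).trans ?_
    rw [← mul_sum, sum_sub_distrib, ← mul_sum, ← hQ, ← hLdef]
    set ν := l * ω / s with hν
    have hν0 : 0 < ν := by positivity
    have e0 : l * (ω * d / s - 3) = (μ * d - 3 * l) + -((μ - ν) * d) := by
      rw [hμ, hν]; field_simp; ring
    rw [e0, Real.exp_add, mul_left_comm]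
    refine mul_le_mul_of_nonneg_left ?_ (Real.exp_pos _).le
    have hlow : 1 - (μ - ν) * d ≤ Real.exp (-((μ - ν) * d)) := by
      have := Real.add_one_le_exp (-((μ - ν) * d)); linarith
    refine le_trans ?_ (mul_le_mul_of_nonneg_left hlow hQ0)
    have hkey : Q * (μ - ν) ≤ 9 / 10 * μ * (p ^ 2 - δ) := by
      have f1 : (μ - ν) * s = μ * (s - s') := by rw [hμ, hν]; field_simp
      have hss0 : 0 ≤ s - s' := by linarith
      have f2 : 3 * (Q * (μ - ν)) * s ≤ 2 * s * (μ * (p ^ 2 + δ)) := by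
        calc 3 * (Q * (μ - ν)) * s = 3 * Q * (μ * (s - s')) := by rw [← f1]; ring
          _ ≤ p * N * (p ^ 2 + δ) * (μ * (s - s')) := by gcongr
          _ = (s - s') * (p * N) * (μ * (p ^ 2 + δ)) := by ring
          _ ≤ _ := by gcongr
      have f3 : 3 * (Q * (μ - ν)) ≤ 2 * (μ * (p ^ 2 + δ)) := by
        refine le_of_mul_le_mul_right (f2.trans (le_of_eq (by ring))) hs
      have : 2 * (p ^ 2 + δ) ≤ 27 / 10 * (p ^ 2 - δ) := by linarith
      have := mul_le_mul_of_nonneg_left this hμ0.le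
      linarith
    have a2 := mul_le_mul_of_nonneg_right hkey hd0
    have a3 := mul_le_mul_of_nonneg_left hL2 (by positivity : 0 ≤ 9 / 10 * μ)
    linarith
  -- conclusion
  have hexpand : ∑ T ∈ avail 𝒯 B A, w T * potential 𝒯 B w ω l Ex S p' δ' s' (A \ B T) =
      ∑ e ∈ A, (∑ T ∈ avail 𝒯 B A with e ∉ B T,
        w T * Real.exp (l * (wdeg 𝒯 B w (A \ B T) e - p' ^ 2 - δ')) +
        ∑ T ∈ avail 𝒯 B A with e ∉ B T,
        w T * Real.exp (l * (p' ^ 2 - wdeg 𝒯 B w (A \ B T) e - δ'))) +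
      ∑ x ∈ S, ∑ T ∈ avail 𝒯 B A,
        w T * Real.exp (l * (ω * ((Ex x ∩ (A \ B T)).card : ℝ) / s' - 3)) := by
    rw [sum_comm (s := S)]
    simp only [potential, mul_add, sum_add_distrib, mul_sum]
    congr 1
    congr 1
    all_goals
      simp only [sum_filter]
      rw [sum_comm]
      refine sum_congr rfl fun T _ => ?_
      rw [← sum_filter, sdiff_eq_filter]
  rw [hexpand, potential, mul_add, mul_sum, mul_sum]
  refine add_le_add (sum_le_sum fun e he => ?_) (sum_le_sum hdeg)
  rw [mul_add]
  exact add_le_add (hplus e he) (hminus e he)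

end Potential

section GreedyCount

variable {ι E V : Type*} [DecidableEq ι] [DecidableEq E]

open Classical in
/-- The number of sequences of `j` successively removed triples ending in a set with `good`. -/
noncomputable def greedyCount (𝒯 : Finset ι) (B : ι → Finset E) (good : Finset E → Prop) :
    ℕ → Finset E → ℕ
  | 0, A => if good A then 1 else 0
  | j + 1, A => ∑ T ∈ avail 𝒯 B A, greedyCount 𝒯 B good j (A \ B T)

open Classical in
/-- The packings with `j` triples in `A` whose leave satisfies `good`. -/
noncomputable def packings (𝒯 : Finset ι) (B : ι → Finset E) (good : Finset E → Prop)
    (j : ℕ) (A : Finset E) : Finset (Finset ι) :=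
  (𝒯.powersetCard j).filter fun P => (∀ T ∈ P, ∀ T' ∈ P, T ≠ T' → Disjoint (B T) (B T')) ∧
    (∀ T ∈ P, B T ⊆ A) ∧ good (A \ P.biUnion B)

variable {𝒯 : Finset ι} {B : ι → Finset E} {w : ι → ℝ} {ω l : ℝ}
  {Ex : V → Finset E} {S : Finset V}

lemma sum_card_packings_le (hB : ∀ T ∈ 𝒯, (B T).Nonempty) (good : Finset E → Prop) (j : ℕ)
    (A : Finset E) : ∑ T ∈ avail 𝒯 B A, (packings 𝒯 B good j (A \ B T)).card ≤
      (j + 1) * (packings 𝒯 B good (j + 1) A).card := by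
  have h1 : (j + 1) * (packings 𝒯 B good (j + 1) A).card =
      ((packings 𝒯 B good (j + 1) A).sigma fun P => P).card := by
    rw [card_sigma, sum_const_nat (m := j + 1), mul_comm]
    intro P hP
    simp only [packings, mem_filter, mem_powersetCard] at hP
    exact hP.1.2
  rw [h1, ← card_sigma]
  have key : ∀ x ∈ (avail 𝒯 B A).sigma fun T => packings 𝒯 B good j (A \ B T), x.1 ∉ x.2 := by
    rintro ⟨T, P⟩ hx hT
    simp only [mem_sigma, packings, mem_filter, mem_powersetCard, mem_avail] at hx
    have h2 := hx.2.2.2.1 T hT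
    obtain ⟨e, he⟩ := hB T hx.1.1
    exact (mem_sdiff.mp (h2 he)).2 he
  refine card_le_card_of_injOn (fun x => ⟨insert x.1 x.2, x.1⟩) ?_ ?_
  · rintro ⟨T, P⟩ hx
    have hTP := key _ hx
    simp only [coe_sigma, Set.mem_sigma_iff, mem_coe, packings, mem_filter, mem_powersetCard,
      mem_avail] at hx ⊢
    obtain ⟨⟨hT, hTA⟩, ⟨hPs, hPc⟩, hd, hsub, hg⟩ := hx
    refine ⟨⟨⟨insert_subset hT hPs, by rw [card_insert_of_notMem hTP, hPc]⟩, ?_, ?_, ?_⟩,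
      mem_insert_self _ _⟩
    · have hdT : ∀ T' ∈ P, Disjoint (B T) (B T') := fun T' hT' =>
        (disjoint_of_subset_left (hsub T' hT') sdiff_disjoint).symm
      intro T1 k1 T2 k2 hne
      rcases mem_insert.mp k1 with rfl | h1 <;> rcases mem_insert.mp k2 with rfl | h2
      · exact absurd rfl hne
      · exact hdT _ h2
      · exact (hdT _ h1).symm
      · exact hd _ h1 _ h2 hne
    · intro T1 h1
      rcases mem_insert.mp h1 with rfl | h1
      · exact hTA
      · exact (hsub _ h1).trans sdiff_subset
    · convert hg using 1
      ext; simp only [biUnion_insert, mem_union, mem_sdiff]; tauto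
  · rintro ⟨T, P⟩ hx ⟨T', P'⟩ hx' heq
    have h1 := key _ hx
    have h2 := key _ hx'
    simp only [Sigma.mk.injEq, heq_eq_eq] at heq h1 h2
    obtain ⟨h3, rfl⟩ := heq
    have : P = P' := by rw [← erase_insert h1, ← erase_insert h2, h3]
    rw [this]

lemma greedyCount_le (hB : ∀ T ∈ 𝒯, (B T).Nonempty) (good : Finset E → Prop) (j : ℕ) :
    ∀ A : Finset E, greedyCount 𝒯 B good j A ≤ j.factorial * (packings 𝒯 B good j A).card := by
  induction j with
  | zero =>
    intro A
    unfold greedyCount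
    split_ifs with hA
    · have : (∅ : Finset ι) ∈ packings 𝒯 B good 0 A := by simp [packings, hA]
      simpa using ⟨_, this⟩
    · simp
  | succ j ih =>
    intro A
    unfold greedyCount
    calc _ ≤ ∑ T ∈ avail 𝒯 B A, j.factorial * (packings 𝒯 B good j (A \ B T)).card :=
          sum_le_sum fun T _ => ih _
      _ = j.factorial * ∑ T ∈ avail 𝒯 B A, (packings 𝒯 B good j (A \ B T)).card := by
          rw [mul_sum]
      _ ≤ j.factorial * ((j + 1) * (packings 𝒯 B good (j + 1) A).card) :=
          Nat.mul_le_mul_left _ (sum_card_packings_le hB good j A)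
      _ = _ := by rw [Nat.factorial_succ]; ring

lemma le_greedyCount (h : LinearSystem 𝒯 B w ω) (hω : 0 < ω) (hl : 0 < l) {N : ℝ}
    (hN : 0 < N) (p δ s : ℕ → ℝ) (m : ℕ) (good : Finset E → Prop)
    (hp0 : ∀ i ≤ m, 0 < p i) (hp : ∀ i < m, p (i + 1) = p i - 3 / N)
    (hδp : ∀ i ≤ m, δ i ≤ p i ^ 2)
    (hstep : ∀ i < m, ∀ A : Finset E, (A.card : ℝ) = p i * N →
      potential 𝒯 B w ω l Ex S (p i) (δ i) (s i) A < 1 →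
      ∑ T ∈ avail 𝒯 B A, w T * potential 𝒯 B w ω l Ex S (p (i + 1)) (δ (i + 1)) (s (i + 1))
        (A \ B T) ≤
      (∑ T ∈ avail 𝒯 B A, w T) * potential 𝒯 B w ω l Ex S (p i) (δ i) (s i) A)
    (hgood : ∀ A, potential 𝒯 B w ω l Ex S (p m) (δ m) (s m) A < 1 → good A) (j : ℕ) :
    ∀ i, i + j = m → ∀ A : Finset E, (A.card : ℝ) = p i * N →
      (∏ k ∈ range j, (N * p (i + k) * (p (i + k) ^ 2 - δ (i + k)) / (3 * ω))) *
        (1 - potential 𝒯 B w ω l Ex S (p i) (δ i) (s i) A) ≤ greedyCount 𝒯 B good j A := by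
  induction j with
  | zero =>
    intro i hi A hA
    have hi' : i = m := by omega
    subst hi'
    have hnn := potential_nonneg (𝒯 := 𝒯) (B := B) (w := w) (ω := ω) (l := l) (Ex := Ex) (S := S)
      (p := p i) (δ := δ i) (s := s i) A
    simp only [range_zero, prod_empty, one_mul, greedyCount]
    split_ifs with hg
    · push_cast; linarith
    · have : 1 ≤ potential 𝒯 B w ω l Ex S (p i) (δ i) (s i) A := by
        by_contra hc; exact hg (hgood A (not_le.mp hc))
      push_cast; linarith
  | succ j ih =>
    intro i hi A hA
    have hqnn : ∀ k ≤ m, 0 ≤ N * p k * (p k ^ 2 - δ k) / (3 * ω) := fun k hk => by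
      have := hp0 k hk
      have := hδp k hk
      have : 0 ≤ p k ^ 2 - δ k := by linarith
      positivity
    rcases le_or_gt 1 (potential 𝒯 B w ω l Ex S (p i) (δ i) (s i) A) with hΦ | hΦ
    · refine le_trans (mul_nonpos_of_nonneg_of_nonpos (prod_nonneg fun k hk => ?_) (by linarith))
        (Nat.cast_nonneg _)
      rw [mem_range] at hk
      exact hqnn _ (by omega)
    set Φ := potential 𝒯 B w ω l Ex S (p i) (δ i) (s i) A with hΦdef
    set R := ∏ k ∈ range j, (N * p (i + 1 + k) * (p (i + 1 + k) ^ 2 - δ (i + 1 + k)) / (3 * ω))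
      with hR
    have hR0 : 0 ≤ R := prod_nonneg fun k hk => by
      rw [mem_range] at hk
      exact hqnn _ (by omega)
    have hprod : ∏ k ∈ range (j + 1), (N * p (i + k) * (p (i + k) ^ 2 - δ (i + k)) / (3 * ω)) =
        R * (N * p i * (p i ^ 2 - δ i) / (3 * ω)) := by
      rw [prod_range_succ', hR]
      simp only [add_zero]
      congr 1
      refine prod_congr rfl fun k _ => ?_
      rw [show i + (k + 1) = i + 1 + k by ring]
    rw [hprod]
    set Q := ∑ T ∈ avail 𝒯 B A, w T with hQ
    have hQl : N * p i * (p i ^ 2 - δ i) ≤ 3 * Q := by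
      rw [hQ, ← h.sum_wdeg A, mul_comm N, ← hA, ← nsmul_eq_mul]
      exact card_nsmul_le_sum _ _ _ fun e he =>
        (abs_wdeg_sub_le_of_potential_lt_one hl hΦ he).1
    have hstep' := hstep i (by omega) A hA hΦ
    rw [← hQ, ← hΦdef] at hstep'
    have hcnt : ∀ T ∈ avail 𝒯 B A, w T * (R * (1 - potential 𝒯 B w ω l Ex S (p (i + 1))
        (δ (i + 1)) (s (i + 1)) (A \ B T))) ≤ ω * (greedyCount 𝒯 B good j (A \ B T) : ℝ) := by
      intro T hT
      rw [mem_avail] at hT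
      have hc : (((A \ B T).card : ℕ) : ℝ) = p (i + 1) * N := by
        rw [cast_card_sdiff hT.2, hA, h.card_eq T hT.1, hp i (by omega)]
        field_simp
        norm_num
      have h1 := mul_le_mul_of_nonneg_left (ih (i + 1) (by omega) _ hc) (h.nonneg T hT.1)
      exact h1.trans (mul_le_mul_of_nonneg_right (h.le T hT.1) (Nat.cast_nonneg _))
    have hsum := sum_le_sum hcnt
    rw [← mul_sum] at hsum
    have hL : ∑ T ∈ avail 𝒯 B A, w T * (R * (1 - potential 𝒯 B w ω l Ex S (p (i + 1))
        (δ (i + 1)) (s (i + 1)) (A \ B T))) = R * (Q - ∑ T ∈ avail 𝒯 B A, w T *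
          potential 𝒯 B w ω l Ex S (p (i + 1)) (δ (i + 1)) (s (i + 1)) (A \ B T)) := by
      rw [hQ, ← sum_sub_distrib, mul_sum]
      exact sum_congr rfl fun T _ => by ring
    rw [hL] at hsum
    have hfin : R * (Q * (1 - Φ)) ≤ ω * (greedyCount 𝒯 B good (j + 1) A : ℝ) := by
      refine le_trans ?_ (hsum.trans (le_of_eq ?_))
      · exact mul_le_mul_of_nonneg_left (by linarith) hR0
      · simp [greedyCount]
    have h3 : (N * p i * (p i ^ 2 - δ i) / (3 * ω)) ≤ Q / ω := by
      rw [div_le_div_iff₀ (by positivity) hω]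
      linarith [mul_le_mul_of_nonneg_right hQl hω.le]
    calc R * (N * p i * (p i ^ 2 - δ i) / (3 * ω)) * (1 - Φ) ≤ R * (Q / ω) * (1 - Φ) := by
          have : 0 ≤ 1 - Φ := by linarith
          gcongr
      _ = R * (Q * (1 - Φ)) / ω := by ring
      _ ≤ _ := by rw [div_le_iff₀ hω]; linarith

set_option maxHeartbeats 1000000 in
/-- The random greedy packing bound: there are many packings with `m` triples whose leave has
small intersection with each set `Ex x`. -/
lemma card_packings_ge (h : LinearSystem 𝒯 B w ω) (hω : 0 < ω) {A₀ : Finset E} {δ₀ pm : ℝ}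
    {m : ℕ} (hA : 0 < A₀.card) (h𝒯 : ∀ T ∈ 𝒯, B T ⊆ A₀) (hreg : ∀ e ∈ A₀, ∑ T ∈ 𝒯 with e ∈ B T, w T = 1)
    (hpm : pm = 1 - 3 * (m : ℝ) / A₀.card) (hpm0 : 0 < pm) (hδ0 : 0 < δ₀)
    (hδpm : δ₀ ≤ pm ^ 14 / 100) (hωδ : ω ≤ δ₀ / 100) (hAδ : 9 ≤ δ₀ * A₀.card)
    (hEx : ∀ x ∈ S, ω * ((Ex x ∩ A₀).card : ℝ) ≤ 2)
    (hexp : (2 * A₀.card + S.card : ℝ) * Real.exp (-(δ₀ ^ 2 / (60 * ω))) ≤ 1 / 2) :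
    1 / 2 * ∏ k ∈ range m, (A₀.card * (1 - 3 * (k : ℝ) / A₀.card) *
      ((1 - 3 * (k : ℝ) / A₀.card) ^ 2 - δ₀ / (1 - 3 * (k : ℝ) / A₀.card) ^ 12) / (3 * ω)) ≤
    (m.factorial * (packings 𝒯 B
      (fun A => ∀ x ∈ S, ω * ((Ex x ∩ A).card : ℝ) ≤ 3 * √pm) m A₀).card : ℝ) := by
  set N : ℝ := (A₀.card : ℝ) with hN
  have hN0 : 0 < N := by rw [hN]; exact_mod_cast hA
  set p : ℕ → ℝ := fun i => 1 - 3 * (i : ℝ) / N with hp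
  set l := δ₀ / (60 * ω) with hl
  have hl0 : 0 < l := by positivity
  have hlω : l * ω = δ₀ / 60 := by rw [hl]; field_simp
  have hanti : ∀ i ≤ m, pm ≤ p i := by
    intro i hi
    rw [hpm, hp]
    simp only
    gcongr
  have hp0 : ∀ i ≤ m, 0 < p i := fun i hi => hpm0.trans_le (hanti i hi)
  have hp1 : ∀ i, p i ≤ 1 := fun i => by
    rw [hp]; simp only
    have : 0 ≤ 3 * (i : ℝ) / N := by positivity
    linarith
  have hpm1 : pm ≤ 1 := (hanti m le_rfl).trans (hp1 m)
  have hδ1 : δ₀ ≤ 1 / 100 := hδpm.trans (by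
    have : pm ^ 14 ≤ 1 := pow_le_one₀ hpm0.le hpm1
    linarith)
  have hpsucc : ∀ i, p (i + 1) = p i - 3 / N := fun i => by
    rw [hp]; simp only; push_cast; ring
  have hδ14 : ∀ i ≤ m, δ₀ ≤ p i ^ 14 / 100 := fun i hi => hδpm.trans (by
    have := hanti i hi
    gcongr)
  have hδp : ∀ i ≤ m, δ₀ / p i ^ 12 ≤ p i ^ 2 / 100 := fun i hi => by
    have h1 := hp0 i hi
    rw [div_le_iff₀ (by positivity)]
    have := hδ14 i hi
    calc δ₀ ≤ p i ^ 14 / 100 := this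
      _ = _ := by ring
  have hδge : ∀ i ≤ m, δ₀ ≤ δ₀ / p i ^ 12 := fun i hi => by
    have h1 := hp0 i hi
    rw [le_div_iff₀ (by positivity)]
    have : p i ^ 12 ≤ 1 := pow_le_one₀ h1.le (hp1 i)
    nlinarith
  have hpN : ∀ i ≤ m, 4 ≤ p i * N := fun i hi => by
    have h1 := hp0 i hi
    have h2 := hδ14 i hi
    have h3 : p i ^ 14 ≤ p i := by
      calc p i ^ 14 ≤ p i ^ 1 := pow_le_pow_of_le_one h1.le (hp1 i) (by norm_num)
        _ = p i := pow_one _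
    have h4 : δ₀ * N ≤ p i * N / 100 := by nlinarith
    linarith
  have hstep : ∀ i < m, ∀ A : Finset E, (A.card : ℝ) = p i * N →
      potential 𝒯 B w ω l Ex S (p i) (δ₀ / p i ^ 12) (√(p i)) A < 1 →
      ∑ T ∈ avail 𝒯 B A, w T * potential 𝒯 B w ω l Ex S (p (i + 1)) (δ₀ / p (i + 1) ^ 12)
        (√(p (i + 1))) (A \ B T) ≤
      (∑ T ∈ avail 𝒯 B A, w T) * potential 𝒯 B w ω l Ex S (p i) (δ₀ / p i ^ 12) (√(p i)) A := by
    intro i hi A hAc hΦ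
    have q0 := hp0 i hi.le
    have q1 := hp0 (i + 1) hi
    have g0 := hδge i hi.le
    have hps := hpsucc i
    have hle : p (i + 1) ≤ p i := by
      rw [hps]
      have : 0 < 3 / N := by positivity
      linarith
    set y := 3 / (p i * N) with hy
    have hy0 : 0 < y := by positivity
    have hy1 : y ≤ 3 / 4 := by
      rw [hy]; exact div_le_div_of_nonneg_left (by norm_num) (by norm_num) (hpN i hi.le)
    have hpy : p (i + 1) = p i * (1 - y) := by
      rw [hps, hy]; field_simp
    have hyN : y * (p i * N) = 3 := by rw [hy]; field_simp
    refine sum_mul_potential_le h hAc hps q0 (hp1 i) hN0 hω hl0 (by positivity) ?_ ?_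
      (hδp i hi.le) ?_ ?_ (Real.sqrt_pos.mpr q1) (Real.sqrt_le_sqrt hle) ?_ ?_ hΦ
    · rw [hlω]; linarith
    · linarith
    · have := hp1 i
      have := mul_le_mul_of_nonneg_right g0 hN0.le
      linarith
    · have e1 : 1 + 12 * y ≤ 1 / (1 - y) ^ 12 := by
        have h1y : 0 < 1 - y := by linarith
        rw [le_div_iff₀ (by positivity)]
        have b1 : 1 + 12 * y ≤ (1 + y) ^ 12 := by
          have := one_add_mul_le_pow (a := y) (by linarith) 12
          simpa using this
        calc (1 + 12 * y) * (1 - y) ^ 12 ≤ (1 + y) ^ 12 * (1 - y) ^ 12 := by gcongr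
          _ = (1 - y ^ 2) ^ 12 := by ring
          _ ≤ 1 := pow_le_one₀ (by nlinarith) (by nlinarith)
      have e2 : δ₀ / p (i + 1) ^ 12 = δ₀ / p i ^ 12 * (1 / (1 - y) ^ 12) := by
        rw [hpy, mul_pow, div_mul_div_comm, mul_one]
      rw [e2]
      have e3 : δ₀ / p i ^ 12 * (12 * y) ≤
          δ₀ / p i ^ 12 * (1 / (1 - y) ^ 12) - δ₀ / p i ^ 12 := by
        have := mul_le_mul_of_nonneg_left e1 (by positivity : 0 ≤ δ₀ / p i ^ 12)
        linarith
      have e4 := mul_le_mul_of_nonneg_left e3 (by positivity : 0 ≤ p i * N)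
      refine le_trans (le_of_eq ?_) e4
      linear_combination (-(12 * (δ₀ / p i ^ 12))) * hyN
    · rw [hlω]
      have : √(p (i + 1)) ^ 2 = p (i + 1) := Real.sq_sqrt q1.le
      refine Real.le_sqrt_of_sq_le ?_
      have h2 := hδ14 (i + 1) hi
      have h3 : p (i + 1) ^ 14 ≤ p (i + 1) := by
        calc p (i + 1) ^ 14 ≤ p (i + 1) ^ 1 :=
              pow_le_pow_of_le_one q1.le (hp1 (i + 1)) (by norm_num)
          _ = p (i + 1) := pow_one _
      nlinarith
    · have hs : √(p (i + 1)) = √(p i) * √(1 - y) := by rw [hpy, Real.sqrt_mul q0.le]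
      have hs2 : 1 - 2 / 3 * y ≤ √(1 - y) := by
        refine Real.le_sqrt_of_sq_le ?_
        nlinarith
      rw [hs]
      have hsp := Real.sqrt_nonneg (p i)
      have a1 : (√(p i) - √(p i) * √(1 - y)) ≤ √(p i) * (2 / 3 * y) := by
        have := mul_le_mul_of_nonneg_left hs2 hsp
        linarith
      have a2 := mul_le_mul_of_nonneg_right a1 (by positivity : 0 ≤ p i * N)
      refine a2.trans (le_of_eq ?_)
      linear_combination (2 / 3 * √(p i)) * hyN
  have hmain := le_greedyCount (Ex := Ex) (S := S) h hω hl0 hN0 p (fun i => δ₀ / p i ^ 12)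
    (fun i => √(p i)) m (fun A => ∀ x ∈ S, ω * ((Ex x ∩ A).card : ℝ) ≤ 3 * √pm) hp0
    (fun i _ => hpsucc i) (fun i hi => (hδp i hi).trans (by
      have := sq_nonneg (p i); linarith)) hstep ?_ m 0 (by simp) A₀ ?_
  · have hΦ : potential 𝒯 B w ω l Ex S (p 0) (δ₀ / p 0 ^ 12) (√(p 0)) A₀ ≤ 1 / 2 := by
      have hp00 : p 0 = 1 := by rw [hp]; simp
      refine le_trans ?_ hexp
      have hav : avail 𝒯 B A₀ = 𝒯 := by
        ext T; rw [mem_avail]; exact ⟨fun hh => hh.1, fun hh => ⟨hh, h𝒯 T hh⟩⟩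
      have hw1 : ∀ e ∈ A₀, wdeg 𝒯 B w A₀ e = 1 := fun e he => by
        rw [wdeg, hav]; exact hreg e he
      have hll : l * δ₀ = δ₀ ^ 2 / (60 * ω) := by rw [hl]; ring
      rw [hp00, potential]
      have t1 : ∑ e ∈ A₀, (Real.exp (l * (wdeg 𝒯 B w A₀ e - 1 ^ 2 - δ₀ / 1 ^ 12)) +
          Real.exp (l * (1 ^ 2 - wdeg 𝒯 B w A₀ e - δ₀ / 1 ^ 12))) ≤
          A₀.card • (2 * Real.exp (-(δ₀ ^ 2 / (60 * ω)))) := by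
        refine sum_le_card_nsmul _ _ _ fun e he => ?_
        rw [hw1 e he, ← hll]
        norm_num
        linarith
      have t2 : ∑ x ∈ S, Real.exp (l * (ω * ((Ex x ∩ A₀).card : ℝ) / √1 - 3)) ≤
          S.card • Real.exp (-(δ₀ ^ 2 / (60 * ω))) := by
        refine sum_le_card_nsmul _ _ _ fun x hx => ?_
        have := hEx x hx
        rw [← hll, Real.sqrt_one, div_one]
        refine Real.exp_le_exp.mpr ?_
        nlinarith
      rw [nsmul_eq_mul] at t1 t2
      linarith
    simp only [zero_add] at hmain
    have hle := greedyCount_le (𝒯 := 𝒯) (B := B) (fun T hT => card_pos.mp (by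
      rw [h.card_eq T hT]; norm_num))
      (fun A => ∀ x ∈ S, ω * ((Ex x ∩ A).card : ℝ) ≤ 3 * √pm) m A₀
    have hle' : (greedyCount 𝒯 B (fun A => ∀ x ∈ S, ω * ((Ex x ∩ A).card : ℝ) ≤ 3 * √pm) m A₀ : ℝ)
      ≤ (m.factorial * (packings 𝒯 B
      (fun A => ∀ x ∈ S, ω * ((Ex x ∩ A).card : ℝ) ≤ 3 * √pm) m A₀).card : ℝ) := by
      exact_mod_cast hle
    refine le_trans ?_ (hmain.trans hle')
    rw [mul_comm]
    refine mul_le_mul_of_nonneg_left (by linarith) (prod_nonneg fun k hk => ?_)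
    have hk' := (mem_range.mp hk).le
    have := hp0 k hk'
    have := hδp k hk'
    have : 0 ≤ p k ^ 2 - δ₀ / p k ^ 12 := by nlinarith [sq_nonneg (p k)]
    positivity
  · intro A hΦ x hx
    have hpe : p m = pm := by rw [hpm]
    rw [← hpe]
    exact card_inter_le_of_potential_lt_one hl0 (Real.sqrt_pos.mpr (hp0 m le_rfl)) hΦ hx
  · rw [hp]; simp [hN]

end GreedyCount

section Gadget

/-- The weights (times six) of the ten triangles of `K₅` combining to the edge `01`. -/
def gadgetCoef (c : Finset (Fin 5)) : ℤ :=
  if 0 ∈ c ∧ 1 ∈ c then 2 else if 0 ∈ c ∨ 1 ∈ c then -1 else 2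

lemma sum_gadgetCoef : ∀ i j : Fin 5, i ≠ j →
    ∑ c ∈ (univ : Finset (Fin 5)).powersetCard 3 with i ∈ c ∧ j ∈ c, gadgetCoef c =
      if (i = 0 ∧ j = 1) ∨ (i = 1 ∧ j = 0) then 6 else 0 := by
  decide

lemma sum_abs_gadgetCoef :
    ∑ c ∈ (univ : Finset (Fin 5)).powersetCard 3, |gadgetCoef c| = 14 := by
  decide

variable {U : Type*} [Fintype U] [DecidableEq U] (G : SimpleGraph U) [DecidableRel G.Adj]

/-- The ordered cliques with five vertices. -/
def fiveCliques : Finset (Fin 5 → U) := univ.filter fun t => ∀ i j, i ≠ j → G.Adj (t i) (t j)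

variable {G}

lemma mem_fiveCliques {t : Fin 5 → U} :
    t ∈ fiveCliques G ↔ ∀ i j, i ≠ j → G.Adj (t i) (t j) := by simp [fiveCliques]

lemma injective_of_mem_fiveCliques {t : Fin 5 → U} (ht : t ∈ fiveCliques G) :
    Function.Injective t := by
  intro i j hij
  by_contra hne
  exact (mem_fiveCliques.mp ht i j hne).ne hij

lemma image_mem_cliqueFinset {t : Fin 5 → U} (ht : t ∈ fiveCliques G) {c : Finset (Fin 5)}
    (hc : c ∈ (univ : Finset (Fin 5)).powersetCard 3) : c.image t ∈ G.cliqueFinset 3 := by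
  have hinj := injective_of_mem_fiveCliques ht
  rw [mem_powersetCard] at hc
  rw [SimpleGraph.mem_cliqueFinset_iff, SimpleGraph.isNClique_iff]
  refine ⟨?_, by rw [card_image_of_injective _ hinj, hc.2]⟩
  intro a ha b hb hab
  simp only [coe_image, Set.mem_image, mem_coe] at ha hb
  obtain ⟨i, _, rfl⟩ := ha
  obtain ⟨j, _, rfl⟩ := hb
  exact mem_fiveCliques.mp ht i j fun h => hab (h ▸ rfl)

lemma sum_gadget {t : Fin 5 → U} (ht : t ∈ fiveCliques G) {x y : U} (hxy : x ≠ y) :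
    ∑ c ∈ (univ : Finset (Fin 5)).powersetCard 3,
      (gadgetCoef c : ℝ) * (if ({x, y} : Finset U) ⊆ c.image t then 1 else 0) =
      (if t 0 = x ∧ t 1 = y then 6 else 0) + (if t 0 = y ∧ t 1 = x then 6 else 0) := by
  have hinj := injective_of_mem_fiveCliques ht
  have h1 : ∀ c : Finset (Fin 5), ({x, y} : Finset U) ⊆ c.image t ↔
      (∃ i ∈ c, t i = x) ∧ ∃ j ∈ c, t j = y := by
    intro c
    rw [insert_subset_iff, singleton_subset_iff, mem_image, mem_image]
  by_cases hx : ∃ i, t i = x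
  · by_cases hy : ∃ j, t j = y
    · obtain ⟨i, rfl⟩ := hx
      obtain ⟨j, rfl⟩ := hy
      have hij : i ≠ j := fun h => hxy (h ▸ rfl)
      have h2 := sum_gadgetCoef i j hij
      have h3 : ∀ c : Finset (Fin 5), ({t i, t j} : Finset U) ⊆ c.image t ↔ i ∈ c ∧ j ∈ c := by
        intro c
        rw [h1]
        simp [hinj.eq_iff]
      simp only [h3, mul_ite, mul_one, mul_zero, ← sum_filter, hinj.eq_iff]
      rw [← Int.cast_sum, h2]
      by_cases a1 : i = 0 ∧ j = 1
      · rw [if_pos (Or.inl a1), if_pos ⟨a1.1.symm, a1.2.symm⟩, if_neg]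
        · norm_num
        · rintro ⟨rfl, rfl⟩
          simp at a1
      · by_cases a2 : i = 1 ∧ j = 0
        · rw [if_pos (Or.inr a2), if_pos (show 0 = j ∧ 1 = i from ⟨a2.2.symm, a2.1.symm⟩), if_neg]
          · norm_num
          · rintro ⟨rfl, rfl⟩
            simp at a2
        · rw [if_neg (by tauto), if_neg (by rintro ⟨h, h'⟩; exact a1 ⟨h.symm, h'.symm⟩),
            if_neg (by rintro ⟨h, h'⟩; exact a2 ⟨h'.symm, h.symm⟩)]
          norm_num
    · have h4 : ∀ j, t j ≠ y := by simpa using hy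
      rw [sum_eq_zero fun c _ => by
        rw [if_neg, mul_zero]; rw [h1]; rintro ⟨_, j, _, hj⟩; exact h4 j hj]
      simp [h4]
  · have h4 : ∀ j, t j ≠ x := by simpa using hx
    rw [sum_eq_zero fun c _ => by
      rw [if_neg, mul_zero]; rw [h1]; rintro ⟨⟨j, _, hj⟩, _⟩; exact h4 j hj]
    simp [h4]

lemma card_common_ge {r : ℕ} (hr : ∀ x, (univ.filter fun y => ¬ G.Adj x y).card ≤ r)
    (s : Finset U) :
    Fintype.card U ≤ (univ.filter fun z => ∀ x ∈ s, G.Adj x z).card + s.card * r := by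
  have h1 : (univ : Finset U) ⊆ (univ.filter fun z => ∀ x ∈ s, G.Adj x z) ∪
      s.biUnion fun x => univ.filter fun y => ¬ G.Adj x y := by
    intro z _
    simp only [mem_union, mem_filter, mem_univ, true_and, mem_biUnion]
    by_contra! h
    obtain ⟨x, hx, hxz⟩ := h.1
    exact hxz (h.2 x hx)
  calc Fintype.card U = (univ : Finset U).card := rfl
    _ ≤ _ := card_le_card h1
    _ ≤ _ := card_union_le _ _
    _ ≤ _ := Nat.add_le_add_left (card_biUnion_le_card_mul _ _ _ fun x _ => hr x) _

lemma card_fiveCliques_ge {r : ℕ} (hr : ∀ x, (univ.filter fun y => ¬ G.Adj x y).card ≤ r)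
    {x y : U} (hxy : G.Adj x y) :
    (Fintype.card U - 4 * r) ^ 3 ≤
      ((fiveCliques G).filter fun t => t 0 = x ∧ t 1 = y).card := by
  classical
  let N : Finset U → Finset U := fun s => univ.filter fun z => ∀ x ∈ s, G.Adj x z
  have hN : ∀ s : Finset U, s.card ≤ 4 → Fintype.card U - 4 * r ≤ (N s).card := by
    intro s hs
    have h1 := card_common_ge hr s
    have h2 : s.card * r ≤ 4 * r := Nat.mul_le_mul_right _ hs
    have h3 : (N s).card = (univ.filter fun z => ∀ x ∈ s, G.Adj x z).card := rfl
    omega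
  let Z : Finset (Σ _ : U, Σ _ : U, U) := (N {x, y}).sigma fun a => (N {x, y, a}).sigma fun b =>
    N {x, y, a, b}
  have hZ : (Fintype.card U - 4 * r) ^ 3 ≤ Z.card := by
    rw [card_sigma, pow_succ', mul_comm]
    refine (Nat.mul_le_mul_left ((Fintype.card U - 4 * r) ^ 2)
      (hN {x, y} ((card_le_two).trans (by norm_num)))).trans ?_
    · rw [mul_comm, ← smul_eq_mul]
      refine card_nsmul_le_sum _ _ _ fun a _ => ?_
      rw [card_sigma, pow_two]
      refine le_trans (Nat.mul_le_mul_right _ (hN {x, y, a} ((card_le_three).trans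
        (by norm_num)))) ?_
      rw [← smul_eq_mul]
      exact card_nsmul_le_sum _ _ _ fun b _ => hN _ card_le_four
  refine hZ.trans (card_le_card_of_injOn (fun q => ![x, y, q.1, q.2.1, q.2.2]) ?_ ?_)
  · rintro ⟨a, b, c⟩ hq
    simp only [Z, N, coe_sigma, Set.mem_sigma_iff, mem_coe, mem_filter, mem_univ, true_and,
      mem_insert, mem_singleton, forall_eq_or_imp, forall_eq] at hq
    obtain ⟨⟨h1, h2⟩, ⟨h3, h4, h5⟩, h6, h7, h8, h9⟩ := hq
    simp only [coe_filter, mem_fiveCliques, Set.mem_ofPred_eq]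
    refine ⟨?_, rfl, rfl⟩
    intro i j hij
    fin_cases i <;> fin_cases j <;>
      first | exact absurd rfl hij | assumption | (apply SimpleGraph.Adj.symm; assumption)
  · rintro ⟨a, b, c⟩ _ ⟨a', b', c'⟩ _ h
    have h2 := congrFun h 2
    have h3 := congrFun h 3
    have h4 := congrFun h 4
    simp at h2 h3 h4
    subst h2 h3 h4
    rfl

lemma card_triangles_eq {x y : U} (hxy : G.Adj x y) :
    ((G.cliqueFinset 3).filter fun T => {x, y} ⊆ T).card =
      (univ.filter fun z => ∀ u ∈ ({x, y} : Finset U), G.Adj u z).card := by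
  symm
  refine card_bij (fun z _ => {x, y, z}) ?_ ?_ ?_
  · intro z hz
    simp only [mem_filter, mem_univ, true_and, mem_insert, mem_singleton, forall_eq_or_imp,
      forall_eq] at hz
    rw [mem_filter, SimpleGraph.mem_cliqueFinset_iff, SimpleGraph.is3Clique_triple_iff]
    refine ⟨⟨hxy, hz.1, hz.2⟩, ?_⟩
    intro u; simp only [mem_insert, mem_singleton]; tauto
  · intro z hz z' hz' h
    simp only [mem_filter, mem_univ, true_and, mem_insert, mem_singleton, forall_eq_or_imp,
      forall_eq] at hz hz'
    have : z ∈ ({x, y, z'} : Finset U) := by rw [← h]; simp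
    simp only [mem_insert, mem_singleton] at this
    rcases this with rfl | rfl | rfl
    · exact absurd rfl hz.1.ne
    · exact absurd rfl hz.2.ne
    · rfl
  · intro T hT
    rw [mem_filter, SimpleGraph.mem_cliqueFinset_iff, SimpleGraph.isNClique_iff] at hT
    obtain ⟨⟨hcl, hc⟩, hsub⟩ := hT
    have h1 : (T \ {x, y}).card = 1 := by
      rw [card_sdiff_of_subset hsub, hc, card_pair hxy.ne]
    obtain ⟨z, hz⟩ := card_eq_one.mp h1
    have hzT : z ∈ T \ {x, y} := by rw [hz]; simp
    rw [mem_sdiff] at hzT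
    refine ⟨z, ?_, ?_⟩
    · simp only [mem_filter, mem_univ, true_and]
      intro u hu
      exact hcl (hsub hu) hzT.1 fun h => hzT.2 (h ▸ hu)
    · have := sdiff_union_of_subset hsub
      rw [hz] at this
      rw [← this]
      ext; simp; tauto

lemma card_piFinset_le {T : Finset U} (hT : T.card = 3) {c : Finset (Fin 5)}
    (hc : c ∈ (univ : Finset (Fin 5)).powersetCard 3) :
    (univ.filter fun t : Fin 5 → U => T = c.image t).card ≤ 27 * Fintype.card U ^ 2 := by
  have h1 : (univ.filter fun t : Fin 5 → U => T = c.image t) ⊆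
      Fintype.piFinset fun i => if i ∈ c then T else univ := by
    intro t ht
    rw [mem_filter] at ht
    rw [Fintype.mem_piFinset]
    intro i
    split_ifs with hi
    · rw [ht.2]; exact mem_image_of_mem t hi
    · exact mem_univ _
  refine (card_le_card h1).trans ?_
  rw [Fintype.card_piFinset]
  have h2 : ∀ i : Fin 5, (if i ∈ c then T else univ).card =
      if i ∈ c then 3 else Fintype.card U := fun i => by
    split_ifs
    · exact hT
    · rfl
  simp only [h2]
  rw [mem_powersetCard] at hc
  rw [prod_ite, prod_const, prod_const, filter_mem_eq_inter, univ_inter, hc.2, filter_notMem_eq_sdiff,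
    card_sdiff_of_subset (subset_univ _), hc.2]
  simp

/-- A graph of large minimum degree has an almost uniform fractional triangle decomposition. -/
lemma exists_triangle_weights {r : ℕ}
    (hr : ∀ x, (univ.filter fun y => ¬ G.Adj x y).card ≤ r)
    (hv : 126 * r ≤ Fintype.card U) (hr1 : 1 ≤ r) :
    ∃ w : Finset U → ℝ,
      (∀ T ∈ G.cliqueFinset 3, 0 ≤ w T ∧
        w T ≤ (1 + 126 * r / Fintype.card U) / (Fintype.card U - 2)) ∧
      ∀ x y, G.Adj x y → ∑ T ∈ G.cliqueFinset 3 with {x, y} ⊆ T, w T = 1 := by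
  classical
  set v := Fintype.card U with hvdef
  have hv0 : (126 : ℝ) ≤ v := by exact_mod_cast (by omega : 126 ≤ v)
  have hvr : 126 * (r : ℝ) ≤ v := by exact_mod_cast hv
  have hr1' : (1 : ℝ) ≤ r := by exact_mod_cast hr1
  set codeg : U → U → ℝ := fun x y => (((G.cliqueFinset 3).filter fun T => {x, y} ⊆ T).card : ℝ)
    with hcodeg
  set κ : U → U → ℝ := fun x y => (((fiveCliques G).filter fun t => t 0 = x ∧ t 1 = y).card : ℝ)
    with hκ
  set ρ : U → U → ℝ := fun x y => (1 - codeg x y / (v - 2)) / κ x y with hρ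
  have hcod : ∀ x y, G.Adj x y → (v : ℝ) - 2 * r ≤ codeg x y ∧ codeg x y ≤ v - 2 := by
    intro x y hxy
    have hcard2 : ({x, y} : Finset U).card = 2 := card_pair hxy.ne
    simp only [hcodeg]
    rw [card_triangles_eq hxy]
    constructor
    · have h1 := card_common_ge hr {x, y}
      rw [hcard2, ← hvdef] at h1
      have h2 : (v : ℝ) ≤ ((univ.filter fun z => ∀ u ∈ ({x, y} : Finset U), G.Adj u z).card : ℝ)
        + 2 * r := by exact_mod_cast h1
      linarith
    · have h1 : (univ.filter fun z => ∀ u ∈ ({x, y} : Finset U), G.Adj u z) ⊆ univ \ {x, y} := by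
        intro z hz
        rw [mem_filter] at hz
        rw [mem_sdiff]
        exact ⟨mem_univ _, fun h => (hz.2 z h).ne rfl⟩
      have h2 := card_le_card h1
      rw [card_sdiff_of_subset (subset_univ _), hcard2, card_univ, ← hvdef] at h2
      have h3 : (univ.filter fun z => ∀ u ∈ ({x, y} : Finset U), G.Adj u z).card + 2 ≤ v := by
        omega
      have h4 : ((univ.filter fun z => ∀ u ∈ ({x, y} : Finset U), G.Adj u z).card : ℝ) + 2 ≤ v := by
        exact_mod_cast h3
      linarith
  have hκ0 : ∀ x y, G.Adj x y → (v : ℝ) ^ 3 / 2 ≤ κ x y := by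
    intro x y hxy
    have h1 := card_fiveCliques_ge hr hxy
    rw [← hvdef] at h1
    have h2 : ((v : ℝ) - 4 * r) ^ 3 ≤ κ x y := by
      have : (((v - 4 * r : ℕ) : ℝ)) ^ 3 ≤ κ x y := by
        simp only [hκ]; exact_mod_cast h1
      rw [Nat.cast_sub (by omega)] at this
      push_cast at this
      exact this
    refine le_trans ?_ h2
    have h3 : 9 / 10 * (v : ℝ) ≤ v - 4 * r := by linarith
    have h4 : (9 / 10 * (v : ℝ)) ^ 3 ≤ ((v : ℝ) - 4 * r) ^ 3 := by gcongr
    refine le_trans ?_ h4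
    have : 0 ≤ (v : ℝ) ^ 3 := by positivity
    nlinarith only [this]
  have hρ0 : ∀ x y, G.Adj x y → 0 ≤ ρ x y ∧ ρ x y ≤ 4 * r / ((v - 2) * v ^ 3) := by
    intro x y hxy
    have h1 := hcod x y hxy
    have h2 := hκ0 x y hxy
    have hv2 : (0 : ℝ) < v - 2 := by linarith
    have h3 : 0 ≤ 1 - codeg x y / (v - 2) := by
      have : codeg x y / (v - 2) ≤ 1 := by rw [div_le_one hv2]; exact h1.2
      linarith
    have h4 : 1 - codeg x y / (v - 2) ≤ 2 * r / (v - 2) := by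
      rw [sub_le_iff_le_add, ← add_div, le_div_iff₀ hv2]
      linarith [h1.1]
    have h5 : (0 : ℝ) < v ^ 3 / 2 := by positivity
    refine ⟨div_nonneg h3 (h5.le.trans h2), ?_⟩
    calc ρ x y ≤ (2 * r / (v - 2)) / (v ^ 3 / 2) := div_le_div₀ (by positivity) h4 h5 h2
      _ = _ := by field_simp; ring
  set w : Finset U → ℝ := fun T => 1 / (v - 2) + ∑ t ∈ fiveCliques G, ρ (t 0) (t 1) / 12 *
    ∑ c ∈ (univ : Finset (Fin 5)).powersetCard 3, (gadgetCoef c : ℝ) *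
      (if T = c.image t then 1 else 0) with hw
  have hadj01 : ∀ t ∈ fiveCliques G, G.Adj (t 0) (t 1) := fun t ht =>
    mem_fiveCliques.mp ht 0 1 (by decide)
  refine ⟨w, ?_, ?_⟩
  · intro T hT
    have hTc : T.card = 3 := ((SimpleGraph.mem_cliqueFinset_iff).mp hT).card_eq
    have hv2 : (0 : ℝ) < v - 2 := by linarith
    set R : ℝ := 4 * r / ((v - 2) * v ^ 3) with hR
    have hR0 : 0 ≤ R := by positivity
    have hbound : |∑ t ∈ fiveCliques G, ρ (t 0) (t 1) / 12 *
        ∑ c ∈ (univ : Finset (Fin 5)).powersetCard 3, (gadgetCoef c : ℝ) *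
        (if T = c.image t then 1 else 0)| ≤ R / 12 * (14 * (27 * v ^ 2)) := by
      calc _ ≤ ∑ t ∈ fiveCliques G, |ρ (t 0) (t 1) / 12 *
            ∑ c ∈ (univ : Finset (Fin 5)).powersetCard 3, (gadgetCoef c : ℝ) *
            (if T = c.image t then 1 else 0)| := abs_sum_le_sum_abs _ _
        _ ≤ ∑ t ∈ fiveCliques G, R / 12 * ∑ c ∈ (univ : Finset (Fin 5)).powersetCard 3,
            |(gadgetCoef c : ℝ)| * (if T = c.image t then 1 else 0) := by
          refine sum_le_sum fun t ht => ?_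
          have h1 := hρ0 _ _ (hadj01 t ht)
          rw [abs_mul, abs_of_nonneg (by have := h1.1; positivity : 0 ≤ ρ (t 0) (t 1) / 12)]
          refine mul_le_mul (by linarith [h1.2]) ?_ (abs_nonneg _) (by positivity)
          refine (abs_sum_le_sum_abs _ _).trans (sum_le_sum fun c _ => ?_)
          rw [abs_mul]
          split_ifs <;> simp
        _ ≤ ∑ t : Fin 5 → U, R / 12 * ∑ c ∈ (univ : Finset (Fin 5)).powersetCard 3,
            |(gadgetCoef c : ℝ)| * (if T = c.image t then 1 else 0) := by
          refine sum_le_sum_of_subset_of_nonneg (subset_univ _) fun t _ _ => ?_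
          refine mul_nonneg (by positivity) (sum_nonneg fun c _ => ?_)
          split_ifs <;> simp
        _ = R / 12 * ∑ c ∈ (univ : Finset (Fin 5)).powersetCard 3, |(gadgetCoef c : ℝ)| *
            ((univ.filter fun t : Fin 5 → U => T = c.image t).card : ℝ) := by
          rw [← mul_sum, sum_comm]
          congr 1
          refine sum_congr rfl fun c _ => ?_
          rw [← mul_sum]
          simp
        _ ≤ R / 12 * ∑ c ∈ (univ : Finset (Fin 5)).powersetCard 3, |(gadgetCoef c : ℝ)| *
            (27 * v ^ 2) := by
          gcongr with c hc
          exact_mod_cast card_piFinset_le hTc hc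
        _ = R / 12 * (14 * (27 * v ^ 2)) := by
          rw [← sum_mul]
          congr 2
          exact_mod_cast sum_abs_gadgetCoef
    have hval : R / 12 * (14 * (27 * v ^ 2)) = (126 * r / v) / (v - 2) := by
      rw [hR]
      have : (v : ℝ) ≠ 0 := by positivity
      field_simp
      ring
    rw [hval, abs_le] at hbound
    have h126 : 126 * (r : ℝ) / v ≤ 1 := by rw [div_le_one (by linarith)]; exact hvr
    have h127 : 126 * (r : ℝ) / v / (v - 2) ≤ 1 / (v - 2) := by gcongr
    simp only [hw]
    rw [add_div]
    constructor <;> linarith [hbound.1, hbound.2]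
  · intro x y hxy
    simp only [hw]
    rw [sum_add_distrib, sum_comm]
    have h1 : ∀ t ∈ fiveCliques G, ∑ T ∈ G.cliqueFinset 3 with {x, y} ⊆ T, ρ (t 0) (t 1) / 12 *
        ∑ c ∈ (univ : Finset (Fin 5)).powersetCard 3, (gadgetCoef c : ℝ) *
        (if T = c.image t then 1 else 0) =
        (if t 0 = x ∧ t 1 = y then ρ x y / 2 else 0) +
        (if t 0 = y ∧ t 1 = x then ρ y x / 2 else 0) := by
      intro t ht
      rw [← mul_sum, sum_comm]
      have h2 : ∀ c ∈ (univ : Finset (Fin 5)).powersetCard 3,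
          ∑ T ∈ G.cliqueFinset 3 with {x, y} ⊆ T, (gadgetCoef c : ℝ) *
            (if T = c.image t then 1 else 0) =
          (gadgetCoef c : ℝ) * (if ({x, y} : Finset U) ⊆ c.image t then 1 else 0) := by
        intro c hc
        rw [← mul_sum, sum_ite_eq']
        simp only [mem_filter, image_mem_cliqueFinset ht hc, true_and]
      rw [sum_congr rfl h2, sum_gadget ht hxy.ne, mul_add]
      congr 1
      · split_ifs with h
        · rw [h.1, h.2]; ring
        · simp
      · split_ifs with h
        · rw [h.1, h.2]; ring
        · simp
    rw [sum_congr rfl h1, sum_add_distrib, ← sum_filter, ← sum_filter, sum_const, sum_const,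
      sum_const, nsmul_eq_mul, nsmul_eq_mul, nsmul_eq_mul]
    have hκρ : ∀ a b, G.Adj a b → κ a b * ρ a b = 1 - codeg a b / (v - 2) := by
      intro a b hab
      have h2 := hκ0 a b hab
      have h5 : (0 : ℝ) < v ^ 3 / 2 := by positivity
      simp only [hρ]
      rw [mul_div_cancel₀]
      exact (h5.trans_le h2).ne'
    have e1 := hκρ x y hxy
    have e2 := hκρ y x hxy.symm
    have e3 : codeg y x = codeg x y := by simp only [hcodeg, pair_comm]
    rw [e3] at e2
    have e4 : (((G.cliqueFinset 3).filter fun T => {x, y} ⊆ T).card : ℝ) = codeg x y := rfl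
    have e5 : (((fiveCliques G).filter fun t => t 0 = x ∧ t 1 = y).card : ℝ) = κ x y := rfl
    have e6 : (((fiveCliques G).filter fun t => t 0 = y ∧ t 1 = x).card : ℝ) = κ y x := rfl
    rw [e4, e5, e6]
    linear_combination e1 / 2 + e2 / 2

end Gadget

section Konig

variable {X Y : Type*} [Fintype X] [Fintype Y] [DecidableEq X] [DecidableEq Y]

/-- A regular bipartite graph has a system of distinct representatives. -/
lemma exists_injective_of_regular {w : ℕ} (hw : 0 < w) (t : X → Finset Y)
    (h1 : ∀ x, (t x).card = w) (h2 : ∀ y, (univ.filter fun x => y ∈ t x).card = w) :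
    ∃ f : X → Y, Function.Injective f ∧ ∀ x, f x ∈ t x := by
  rw [← all_card_le_biUnion_card_iff_exists_injective]
  intro s
  have h3 : s.card * w = ∑ y ∈ s.biUnion t, (s.filter fun x => y ∈ t x).card := by
    have e1 : s.card * w = ∑ x ∈ s, (t x).card := by
      rw [sum_congr rfl fun x _ => h1 x, sum_const, smul_eq_mul]
    rw [e1]
    have e2 : ∀ x ∈ s, (t x).card = ((s.biUnion t).filter fun y => y ∈ t x).card := by
      intro x hx
      congr 1
      ext y
      simp only [mem_filter, mem_biUnion]
      exact ⟨fun h => ⟨⟨x, hx, h⟩, h⟩, fun h => h.2⟩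
    rw [sum_congr rfl e2]
    exact sum_card_bipartiteAbove_eq_sum_card_bipartiteBelow (r := fun x y => y ∈ t x)
  have h4 : ∑ y ∈ s.biUnion t, (s.filter fun x => y ∈ t x).card ≤ (s.biUnion t).card * w := by
    rw [← smul_eq_mul]
    refine sum_le_card_nsmul _ _ _ fun y _ => ?_
    rw [← h2 y]
    exact card_le_card (filter_subset_filter _ (subset_univ _))
  exact Nat.le_of_mul_le_mul_right (h3 ▸ h4) hw

/-- A `w`-regular bipartite graph decomposes into `w` perfect matchings. -/
lemma exists_one_factorization (w : ℕ) : ∀ t : X → Finset Y, (∀ x, (t x).card = w) →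
    (∀ y, (univ.filter fun x => y ∈ t x).card = w) →
    ∃ f : Fin w → X → Y, (∀ i, Function.Bijective (f i)) ∧ (∀ i x, f i x ∈ t x) ∧
      ∀ x, Function.Injective fun i => f i x := by
  induction w with
  | zero =>
    intro t _ _
    exact ⟨fun i => i.elim0, fun i => i.elim0, fun i => i.elim0, fun x i => i.elim0⟩
  | succ w ih =>
    intro t h1 h2
    obtain ⟨f, hf, hft⟩ := exists_injective_of_regular w.succ_pos t h1 h2
    have hcard : Fintype.card X = Fintype.card Y := by
      have h3 : ∑ x : X, (t x).card = ∑ y : Y, (univ.filter fun x => y ∈ t x).card := by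
        have e2 : ∀ x ∈ (univ : Finset X), (t x).card =
            ((univ : Finset Y).filter fun y => y ∈ t x).card := by
          intro x _; congr 1; ext y; simp
        rw [sum_congr rfl e2]
        exact sum_card_bipartiteAbove_eq_sum_card_bipartiteBelow (r := fun x y => y ∈ t x)
      rw [sum_congr rfl fun x _ => h1 x, sum_congr rfl fun y _ => h2 y, sum_const, sum_const,
        smul_eq_mul, smul_eq_mul, card_univ, card_univ] at h3
      exact Nat.eq_of_mul_eq_mul_right w.succ_pos h3
    have hbij : Function.Bijective f := (Fintype.bijective_iff_injective_and_card f).mpr ⟨hf, hcard⟩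
    obtain ⟨F, hF1, hF2, hF3⟩ := ih (fun x => (t x).erase (f x))
      (fun x => by rw [card_erase_of_mem (hft x), h1]; rfl)
      (fun y => by
        obtain ⟨x₀, rfl⟩ := hbij.2 y
        have : (univ.filter fun x => f x₀ ∈ (t x).erase (f x)) =
            (univ.filter fun x => f x₀ ∈ t x).erase x₀ := by
          ext x
          simp only [mem_filter, mem_univ, true_and, mem_erase, ne_eq, hf.eq_iff]
          exact ⟨fun h => ⟨fun h' => h.1 h'.symm, h.2⟩, fun h => ⟨fun h' => h.1 h'.symm, h.2⟩⟩
        rw [this, card_erase_of_mem (by simp [hft]), h2]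
        rfl)
    refine ⟨Fin.cons f F, ?_, ?_, ?_⟩
    · intro i
      refine Fin.cases ?_ (fun i => ?_) i
      · exact hbij
      · exact hF1 i
    · intro i x
      refine Fin.cases ?_ (fun i => ?_) i
      · exact hft x
      · exact mem_of_mem_erase (hF2 i x)
    · intro x i j
      refine Fin.cases ?_ (fun i => ?_) i <;> refine Fin.cases ?_ (fun j => ?_) j
      · intro; rfl
      · intro h
        exact absurd h.symm (ne_of_mem_erase (hF2 j x))
      · intro h
        exact absurd h (ne_of_mem_erase (hF2 i x))
      · intro h
        exact congrArg Fin.succ (hF3 x h)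

end Konig

section Glue

variable {U W : Type*} [Fintype U] [DecidableEq U] [Fintype W] [DecidableEq W]

lemma isSTS_iff {V : Type*} {E : Finset (Finset V)} : IsSTS E ↔ (∀ e ∈ E, e.card = 3) ∧
    (∀ x y : V, x ≠ y → ∃ e ∈ E, x ∈ e ∧ y ∈ e) ∧
    ∀ x y : V, x ≠ y → ∀ e ∈ E, ∀ e' ∈ E, x ∈ e → y ∈ e → x ∈ e' → y ∈ e' → e = e' := by
  constructor
  · rintro ⟨h1, h2⟩
    refine ⟨h1, fun x y hxy => ?_, fun x y hxy e he e' he' a b c d => ?_⟩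
    · obtain ⟨e, he, _⟩ := h2 x y hxy
      exact ⟨e, he⟩
    · exact (h2 x y hxy).unique ⟨he, a, b⟩ ⟨he', c, d⟩
  · rintro ⟨h1, h2, h3⟩
    refine ⟨h1, fun x y hxy => ?_⟩
    obtain ⟨e, he, hx, hy⟩ := h2 x y hxy
    exact ⟨e, ⟨he, hx, hy⟩, fun e' he' => h3 x y hxy e' he'.1 e he he'.2.1 he'.2.2 hx hy⟩

/-- The vertices forming no covered pair with `x`. -/
def uncovered (P : Finset (Finset U)) (x : U) : Finset U :=
  univ.filter fun y => y ≠ x ∧ ∀ e ∈ P, x ∈ e → y ∉ e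

lemma card_uncovered {P : Finset (Finset U)} (hc : ∀ e ∈ P, e.card = 3)
    (hu : ∀ x y, x ≠ y → ∀ e ∈ P, ∀ e' ∈ P, x ∈ e → y ∈ e → x ∈ e' → y ∈ e' → e = e') (x : U) :
    (uncovered P x).card + 2 * (P.filter fun e => x ∈ e).card + 1 = Fintype.card U := by
  have h1 : ((P.filter fun e => x ∈ e).biUnion fun e => e.erase x).card =
      2 * (P.filter fun e => x ∈ e).card := by
    rw [card_biUnion, sum_congr rfl (g := fun _ => 2), sum_const, smul_eq_mul, mul_comm]
    · intro e he
      rw [mem_filter] at he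
      rw [card_erase_of_mem he.2, hc e he.1]
    · intro e he e' he' hne
      rw [mem_coe, mem_filter] at he he'
      change Disjoint _ _
      rw [disjoint_left]
      intro y hy hy'
      rw [mem_erase] at hy hy'
      exact hne (hu x y hy.1.symm e he.1 e' he'.1 he.2 hy.2 he'.2 hy'.2)
  have h2 : uncovered P x = (univ.erase x) \ ((P.filter fun e => x ∈ e).biUnion
      fun e => e.erase x) := by
    ext y
    simp only [uncovered, mem_filter, mem_univ, true_and, mem_sdiff, mem_erase, mem_biUnion,
      and_true, not_exists, not_and]
    constructor
    · rintro ⟨a, b⟩; exact ⟨a, fun e he _ => b e he.1 he.2⟩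
    · rintro ⟨a, b⟩; exact ⟨a, fun e he hx => b e ⟨he, hx⟩ a⟩
  have h3 : ((P.filter fun e => x ∈ e).biUnion fun e => e.erase x) ⊆ univ.erase x := by
    intro y hy
    simp only [mem_biUnion, mem_erase] at hy
    obtain ⟨e, _, h, _⟩ := hy
    simp [h]
  have h4 := card_sdiff_add_card_eq_card h3
  rw [← h2, h1, card_erase_of_mem (mem_univ x), card_univ] at h4
  have : 0 < Fintype.card U := Fintype.card_pos_iff.mpr ⟨x⟩
  omega

/-- A packing of triples on two sides covering all inner pairs, with regular leave, extends to a
Steiner triple system. -/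
lemma exists_isSTS_of_packing (side : U → Bool) {P : Finset (Finset U)}
    (hc : ∀ e ∈ P, e.card = 3)
    (hu : ∀ x y, x ≠ y → ∀ e ∈ P, ∀ e' ∈ P, x ∈ e → y ∈ e → x ∈ e' → y ∈ e' → e = e')
    (hin : ∀ x y, x ≠ y → side x = side y → ∃ e ∈ P, x ∈ e ∧ y ∈ e)
    (hdeg : ∀ x, 2 * (P.filter fun e => x ∈ e).card + Fintype.card W + 1 = Fintype.card U)
    {SW : Finset (Finset W)} (hSW : IsSTS SW) :
    ∃ E : Finset (Finset (U ⊕ W)), IsSTS E ∧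
      ∀ T : Finset U, T.map Function.Embedding.inl ∈ E ↔ T ∈ P := by
  have hN : ∀ x, (uncovered P x).card = Fintype.card W := fun x => by
    have h1 := card_uncovered hc hu x
    have h2 := hdeg x
    omega
  have hNs : ∀ x y, y ∈ uncovered P x → side y ≠ side x := by
    intro x y hy hs
    simp only [uncovered, mem_filter, mem_univ, true_and] at hy
    obtain ⟨e, he, h1, h2⟩ := hin x y hy.1.symm hs.symm
    exact hy.2 e he h1 h2
  have hsymm : ∀ x y, y ∈ uncovered P x ↔ x ∈ uncovered P y := by
    intro x y
    simp only [uncovered, mem_filter, mem_univ, true_and]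
    constructor <;> rintro ⟨a, b⟩ <;> exact ⟨a.symm, fun e he h1 h2 => b e he h2 h1⟩
  let t : {x // side x = false} → Finset {y // side y = true} := fun x =>
    (uncovered P x).subtype _
  have ht1 : ∀ x, (t x).card = Fintype.card W := by
    intro x
    simp only [t]
    rw [card_subtype, filter_true_of_mem, hN]
    intro y hy
    have := hNs _ _ hy
    rw [x.2] at this
    simpa using this
  have ht2 : ∀ y, (univ.filter fun x => y ∈ t x).card = Fintype.card W := by
    intro y
    have : (univ.filter fun x => y ∈ t x) = (uncovered P y).subtype fun x => side x = false := by
      ext x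
      simp only [t, mem_filter, mem_univ, true_and, mem_subtype]
      exact hsymm _ _
    rw [this, card_subtype, filter_true_of_mem, hN]
    intro x hx
    have := hNs _ _ hx
    rw [y.2] at this
    simpa using this
  obtain ⟨f', hf1', hf2', hf3'⟩ := exists_one_factorization (Fintype.card W) t ht1 ht2
  let eW := Fintype.equivFin W
  obtain ⟨f, hf1, hf2, hf3⟩ : ∃ f : W → {x // side x = false} → {y // side y = true},
      (∀ i, Function.Bijective (f i)) ∧ (∀ i x, f i x ∈ t x) ∧
      ∀ x, Function.Injective fun i => f i x :=
    ⟨fun i => f' (eW i), fun i => hf1' _, fun i x => hf2' _ x, fun x i j hij =>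
      eW.injective (hf3' x hij)⟩
  have hunc : ∀ i (x : {x // side x = false}), ((f i x : U)) ∈ uncovered P x := fun i x => by
    have := hf2 i x
    simpa [t] using this
  have hsurj : ∀ x : {x // side x = false}, ∀ y ∈ uncovered P x, ∃ i, (f i x : U) = y := by
    intro x y hy
    have hyside : side y = true := by
      have := hNs _ _ hy
      rw [x.2] at this
      simpa using this
    have him : univ.image (fun i => f i x) = t x := by
      refine eq_of_subset_of_card_le ?_ ?_
      · intro z hz
        simp only [mem_image, mem_univ, true_and] at hz
        obtain ⟨i, rfl⟩ := hz
        exact hf2 i x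
      · rw [ht1, card_image_of_injective _ (hf3 x), card_univ]
    have : (⟨y, hyside⟩ : {y // side y = true}) ∈ univ.image (fun i => f i x) := by
      rw [him]; simpa [t] using hy
    simp only [mem_image, mem_univ, true_and] at this
    obtain ⟨i, hi⟩ := this
    exact ⟨i, by rw [hi]⟩
  let cr : W × {x // side x = false} → Finset (U ⊕ W) := fun q =>
    {Sum.inl (q.2 : U), Sum.inl (f q.1 q.2 : U), Sum.inr q.1}
  let E : Finset (Finset (U ⊕ W)) := P.image (fun T => T.map Function.Embedding.inl) ∪
    univ.image cr ∪ SW.image (fun T => T.map Function.Embedding.inr)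
  have hE : ∀ e, e ∈ E ↔ (∃ T ∈ P, T.map Function.Embedding.inl = e) ∨ (∃ q, cr q = e) ∨
      ∃ T ∈ SW, T.map Function.Embedding.inr = e := by
    intro e
    simp only [E, mem_union, mem_image, mem_univ, true_and, or_assoc]
  have hinj1 : ∀ T : Finset U, ∀ u, Sum.inl u ∈ T.map (Function.Embedding.inl (β := W)) ↔ u ∈ T := by
    intro T u; simp
  have hinj2 : ∀ T : Finset W, ∀ u, Sum.inr u ∈ T.map (Function.Embedding.inr (α := U)) ↔ u ∈ T := by
    intro T u; simp
  have hcr1 : ∀ q u, Sum.inl u ∈ cr q ↔ u = q.2 ∨ u = f q.1 q.2 := by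
    intro q u; simp [cr]
  have hcr2 : ∀ q u, Sum.inr u ∈ cr q ↔ u = q.1 := by
    intro q u; simp [cr]
  have hSW' := isSTS_iff.mp hSW
  have hside : ∀ (x : {x // side x = false}) (y : {y // side y = true}), (x : U) ≠ y := by
    intro x y h
    have h1 := x.2
    rw [h, y.2] at h1
    exact absurd h1 (by simp)
  refine ⟨E, isSTS_iff.mpr ⟨?_, ?_, ?_⟩, ?_⟩
  · intro e he
    rcases (hE e).mp he with ⟨T, hT, rfl⟩ | ⟨q, rfl⟩ | ⟨T, hT, rfl⟩
    · rw [card_map, hc T hT]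
    · rw [card_eq_three]
      refine ⟨_, _, _, ?_, ?_, ?_, rfl⟩
      · simpa using hside _ _
      · simp
      · simp
    · rw [card_map, hSW'.1 T hT]
  · have hcross : ∀ u v, u ≠ v → side u = false → v ∈ uncovered P u →
        ∃ e ∈ E, Sum.inl u ∈ e ∧ Sum.inl v ∈ e := by
      intro u v _ hsu hun
      obtain ⟨i, hi⟩ := hsurj ⟨u, hsu⟩ v hun
      refine ⟨cr (i, ⟨u, hsu⟩), (hE _).mpr (Or.inr (Or.inl ⟨_, rfl⟩)), ?_, ?_⟩
      · rw [hcr1]; exact Or.inl rfl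
      · rw [hcr1]; exact Or.inr hi.symm
    have hmix : ∀ u i, ∃ e ∈ E, Sum.inl u ∈ e ∧ Sum.inr i ∈ e := by
      intro u i
      cases hsu : side u with
      | false =>
        exact ⟨cr (i, ⟨u, hsu⟩), (hE _).mpr (Or.inr (Or.inl ⟨_, rfl⟩)),
          (hcr1 _ _).mpr (Or.inl rfl), (hcr2 _ _).mpr rfl⟩
      | true =>
        obtain ⟨x, hx⟩ := (hf1 i).2 ⟨u, hsu⟩
        exact ⟨cr (i, x), (hE _).mpr (Or.inr (Or.inl ⟨_, rfl⟩)),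
          (hcr1 _ _).mpr (Or.inr (by rw [hx])), (hcr2 _ _).mpr rfl⟩
    rintro (u | i) (v | j) hne
    · have huv : u ≠ v := fun h => hne (h ▸ rfl)
      by_cases hun : v ∈ uncovered P u
      · cases hsu : side u with
        | false => exact hcross u v huv hsu hun
        | true =>
          have hsv : side v = false := by
            have := hNs _ _ hun
            rw [hsu] at this
            simpa using this
          obtain ⟨e, he, h1, h2⟩ := hcross v u huv.symm hsv ((hsymm _ _).mp hun)
          exact ⟨e, he, h2, h1⟩
      · simp only [uncovered, mem_filter, mem_univ, true_and, not_and, not_forall, not_not] at hun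
        obtain ⟨T, hT, h1, h2⟩ := hun huv.symm
        exact ⟨_, (hE _).mpr (Or.inl ⟨T, hT, rfl⟩), (hinj1 _ _).mpr h1, (hinj1 _ _).mpr h2⟩
    · exact hmix u j
    · obtain ⟨e, he, h1, h2⟩ := hmix v i
      exact ⟨e, he, h2, h1⟩
    · obtain ⟨T, hT, h1, h2⟩ := hSW'.2.1 i j fun h => hne (h ▸ rfl)
      exact ⟨_, (hE _).mpr (Or.inr (Or.inr ⟨T, hT, rfl⟩)), (hinj2 _ _).mpr h1, (hinj2 _ _).mpr h2⟩
  · have hPc : ∀ T ∈ P, ∀ q u v, u ≠ v → u ∈ T → v ∈ T → Sum.inl u ∈ cr q →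
        Sum.inl v ∈ cr q → False := by
      intro T hT q u v huv h1 h2 h3 h4
      rw [hcr1] at h3 h4
      have h5 := hunc q.1 q.2
      simp only [uncovered, mem_filter, mem_univ, true_and] at h5
      rcases h3 with rfl | rfl <;> rcases h4 with rfl | rfl
      · exact huv rfl
      · exact h5.2 T hT h1 h2
      · exact h5.2 T hT h2 h1
      · exact huv rfl
    have hcc : ∀ q q' u i, Sum.inl u ∈ cr q → Sum.inl u ∈ cr q' → Sum.inr i ∈ cr q →
        Sum.inr i ∈ cr q' → cr q = cr q' := by
      rintro ⟨j, x⟩ ⟨j', x'⟩ u i h1 h2 h3 h4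
      rw [hcr2] at h3 h4
      simp only at h3 h4
      subst h3 h4
      rw [hcr1] at h1 h2
      simp only at h1 h2
      rcases h1 with h1 | h1 <;> rcases h2 with h2 | h2
      · rw [Subtype.ext (h1.symm.trans h2)]
      · exact absurd (h1.symm.trans h2) (hside _ _)
      · exact absurd (h2.symm.trans h1) (hside _ _)
      · rw [(hf1 i).1 (Subtype.ext (h1.symm.trans h2))]
    have hcc2 : ∀ q q' u v, u ≠ v → Sum.inl u ∈ cr q → Sum.inl u ∈ cr q' → Sum.inl v ∈ cr q →
        Sum.inl v ∈ cr q' → cr q = cr q' := by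
      rintro ⟨j, x⟩ ⟨j', x'⟩ u v huv h1 h2 h3 h4
      rw [hcr1] at h1 h2 h3 h4
      simp only at h1 h2 h3 h4
      have key : ∀ a b : U, a = x → b = f j x → a = x' → b = f j' x' → cr (j, x) = cr (j', x') := by
        intro a b k1 k2 k3 k4
        have e1 : x = x' := Subtype.ext (k1.symm.trans k3)
        subst e1
        have e2 : j = j' := hf3 x (Subtype.ext (k2.symm.trans k4))
        rw [e2]
      rcases h1 with h1 | h1 <;> rcases h3 with h3 | h3
      · exact absurd (h1.trans h3.symm) huv
      · rcases h2 with h2 | h2 <;> rcases h4 with h4 | h4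
        · exact absurd (h2.trans h4.symm) huv
        · exact key u v h1 h3 h2 h4
        · exact absurd (h1.symm.trans h2) (hside _ _)
        · exact absurd (h2.trans h4.symm) huv
      · rcases h2 with h2 | h2 <;> rcases h4 with h4 | h4
        · exact absurd (h2.trans h4.symm) huv
        · exact absurd (h3.symm.trans h4) (hside _ _)
        · exact key v u h3 h1 h4 h2
        · exact absurd (h2.trans h4.symm) huv
      · exact absurd (h1.trans h3.symm) huv
    rintro (u | i) (v | j) hne e he e' he' a b c d <;>
    rcases (hE e).mp he with ⟨T, hT, rfl⟩ | ⟨q, rfl⟩ | ⟨T, hT, rfl⟩ <;>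
    rcases (hE e').mp he' with ⟨T', hT', rfl⟩ | ⟨q', rfl⟩ | ⟨T', hT', rfl⟩ <;>
    first
      | (exfalso; simp only [mem_map, Function.Embedding.inl_apply, Function.Embedding.inr_apply, reduceCtorEq, and_false, exists_false] at a b c d; done)
      | skip
    · rw [hinj1] at a b c d
      rw [hu u v (fun h => hne (h ▸ rfl)) T hT T' hT' a b c d]
    · rw [hinj1] at a b
      exact (hPc T hT q' u v (fun h => hne (h ▸ rfl)) a b c d).elim
    · rw [hinj1] at c d
      exact (hPc T' hT' q u v (fun h => hne (h ▸ rfl)) c d a b).elim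
    · exact hcc2 q q' u v (fun h => hne (h ▸ rfl)) a c b d
    · exact hcc q q' u j a c b d
    · exact hcc q q' v i b d a c
    · rw [hcr2] at a b
      exact absurd (a.trans b.symm) fun h => hne (h ▸ rfl)
    · rw [hcr2] at a b
      exact absurd (a.trans b.symm) fun h => hne (h ▸ rfl)
    · rw [hcr2] at c d
      exact absurd (c.trans d.symm) fun h => hne (h ▸ rfl)
    · rw [hinj2] at a b c d
      rw [hSW'.2.2 i j (fun h => hne (h ▸ rfl)) T hT T' hT' a b c d]
  · intro T
    rw [hE]
    constructor
    · rintro (⟨T', hT', h⟩ | ⟨q, h⟩ | ⟨T', hT', h⟩)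
      · rwa [← map_injective _ h]
      · have : Sum.inr q.1 ∈ cr q := (hcr2 _ _).mpr rfl
        rw [h] at this
        simp at this
      · obtain ⟨i, hi⟩ := card_pos.mp (by rw [hSW'.1 T' hT']; norm_num : 0 < T'.card)
        have : Sum.inr i ∈ T'.map (Function.Embedding.inr (α := U)) := (hinj2 _ _).mpr hi
        rw [h] at this
        simp at this
    · exact fun h => Or.inl ⟨T, h, rfl⟩

end Glue

/-- A Steiner quasigroup gives a Steiner triple system. -/
lemma exists_isSTS_of_quasigroup {V : Type*} [Fintype V] [DecidableEq V] (op : V → V → V)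
    (h1 : ∀ x, op x x = x) (h2 : ∀ x y, op x y = op y x) (h3 : ∀ x y, op x (op x y) = y) :
    ∃ E : Finset (Finset V), IsSTS E := by
  have h4 : ∀ x y, x ≠ y → op x y ≠ x := by
    intro x y hxy h
    have h5 := h3 x y
    rw [h, h1] at h5
    exact hxy h5
  have h5 : ∀ x y, x ≠ y → op x y ≠ y := by
    intro x y hxy
    rw [h2]
    exact h4 y x hxy.symm
  have h6 : ∀ x y, op y (op x y) = x := fun x y => by rw [h2 x y, h3]
  have h7 : ∀ a b p q, p ≠ q → p ∈ ({a, b, op a b} : Finset V) → q ∈ ({a, b, op a b} : Finset V) →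
      ({a, b, op a b} : Finset V) = {p, q, op p q} := by
    intro a b p q hpq hp hq
    have h8 : op (op a b) a = b := by rw [h2, h3]
    have h9 : op (op a b) b = a := by rw [h2, h6]
    have h10 : op b a = op a b := h2 b a
    simp only [mem_insert, mem_singleton] at hp hq
    rcases hp with rfl | rfl | rfl <;> rcases hq with rfl | rfl | rfl <;>
      first
        | exact absurd rfl hpq
        | (ext z; simp only [mem_insert, mem_singleton, h3, h6, h8, h9, h10] <;> tauto)
  refine ⟨((univ : Finset (V × V)).filter fun q => q.1 ≠ q.2).image
    fun q => {q.1, q.2, op q.1 q.2}, isSTS_iff.mpr ⟨?_, ?_, ?_⟩⟩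
  · intro e he
    simp only [mem_image, mem_filter, mem_univ, true_and, Prod.exists] at he
    obtain ⟨x, y, hxy, rfl⟩ := he
    rw [card_eq_three]
    exact ⟨_, _, _, hxy, (h4 x y hxy).symm, (h5 x y hxy).symm, rfl⟩
  · intro x y hxy
    exact ⟨{x, y, op x y}, mem_image.mpr ⟨(x, y), by simpa using hxy, rfl⟩, by simp, by simp⟩
  · intro x y hxy e he e' he' hx hy hx' hy'
    simp only [mem_image, mem_filter, mem_univ, true_and, Prod.exists] at he he'
    obtain ⟨a, b, hab, rfl⟩ := he
    obtain ⟨a', b', hab', rfl⟩ := he'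
    rw [h7 a b x y hxy hx hy, h7 a' b' x y hxy hx' hy']

/-- The Bose product. -/
def boseOp {R : Type*} [CommRing R] [DecidableEq R] (c : R) (p q : R × ZMod 3) : R × ZMod 3 :=
  if p.1 = q.1 then (p.1, -(p.2 + q.2))
  else if p.2 = q.2 then (c * (p.1 + q.1), p.2 + 1)
  else if q.2 = p.2 + 1 then (2 * q.1 - p.1, p.2)
  else (2 * p.1 - q.1, q.2)

lemma boseOp_self {R : Type*} [CommRing R] [DecidableEq R] (c : R) (p : R × ZMod 3) :
    boseOp c p p = p := by
  obtain ⟨x, i⟩ := p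
  simp only [boseOp, if_true]
  rw [Prod.mk.injEq]
  refine ⟨rfl, ?_⟩
  revert i
  decide

lemma boseOp_comm {R : Type*} [CommRing R] [DecidableEq R] (c : R) (p q : R × ZMod 3) :
    boseOp c p q = boseOp c q p := by
  obtain ⟨x, i⟩ := p
  obtain ⟨y, j⟩ := q
  simp only [boseOp]
  by_cases h : x = y
  · subst h
    simp only [if_true, add_comm]
  · rw [if_neg h, if_neg (Ne.symm h)]
    have hi : j = i ∨ j = i + 1 ∨ j = i + 2 := by revert i j; decide
    have a0 : ∀ i : ZMod 3, i ≠ i + 1 := by decide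
    have a1 : ∀ i : ZMod 3, i + 1 ≠ i := by decide
    have a2 : ∀ i : ZMod 3, i ≠ i + 2 := by decide
    have a3 : ∀ i : ZMod 3, i + 2 ≠ i := by decide
    have a4 : ∀ i : ZMod 3, i + 2 ≠ i + 1 := by decide
    have a5 : ∀ i : ZMod 3, i = i + 2 + 1 := by decide
    have a6 : ∀ i : ZMod 3, i ≠ i + 1 + 1 := by decide
    rcases hi with rfl | rfl | rfl
    · simp [add_comm x y]
    · rw [if_neg (a0 i), if_pos rfl, if_neg (a1 i), if_neg (a6 i)]
    · rw [if_neg (a2 i), if_neg (a4 i), if_neg (a3 i), if_pos (a5 i)]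

lemma boseOp_boseOp {R : Type*} [CommRing R] [DecidableEq R] {c : R} (hc : 2 * c = 1)
    (p q : R × ZMod 3) : boseOp c p (boseOp c p q) = q := by
  obtain ⟨x, i⟩ := p
  obtain ⟨y, j⟩ := q
  by_cases h : x = y
  · subst h
    simp only [boseOp, if_true]
    rw [Prod.mk.injEq]
    refine ⟨rfl, ?_⟩
    ring
  · have hi : j = i ∨ j = i + 1 ∨ j = i + 2 := by revert i j; decide
    have a0 : ∀ i : ZMod 3, i ≠ i + 1 := by decide
    have a2 : ∀ i : ZMod 3, i ≠ i + 2 := by decide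
    have a4 : ∀ i : ZMod 3, i + 2 ≠ i + 1 := by decide
    have two : ∀ a b : R, 2 * a = 2 * b → a = b := by
      intro a b hab
      calc a = (2 * c) * a := by rw [hc, one_mul]
        _ = c * (2 * a) := by ring
        _ = c * (2 * b) := by rw [hab]
        _ = (2 * c) * b := by ring
        _ = b := by rw [hc, one_mul]
    rcases hi with rfl | rfl | rfl
    · have e1 : boseOp c (x, j) (y, j) = (c * (x + y), j + 1) := by simp [boseOp, h]
      have h2 : x ≠ c * (x + y) := fun hx => h (by
        have : 2 * x = (2 * c) * (x + y) := by rw [mul_assoc, ← hx]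
        rw [hc] at this
        linear_combination this)
      rw [e1]
      simp only [boseOp, if_neg h2, if_neg (a0 j), if_true]
      rw [Prod.mk.injEq]
      exact ⟨by linear_combination (x + y) * hc, rfl⟩
    · have e1 : boseOp c (x, i) (y, i + 1) = (2 * y - x, i) := by simp [boseOp, h]
      have h2 : x ≠ 2 * y - x := fun hx => h (two x y (by linear_combination hx))
      rw [e1]
      simp only [boseOp, if_neg h2, if_true]
      rw [Prod.mk.injEq]
      exact ⟨by linear_combination y * hc, rfl⟩
    · have e1 : boseOp c (x, i) (y, i + 2) = (2 * x - y, i + 2) := by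
        simp only [boseOp, if_neg h, if_neg (a2 i), if_neg (a4 i)]
      have h2 : x ≠ 2 * x - y := fun hx => h (by linear_combination -hx)
      rw [e1]
      simp only [boseOp, if_neg h2, if_neg (a2 i), if_neg (a4 i)]
      rw [Prod.mk.injEq]
      exact ⟨by ring, rfl⟩

lemma isSTS_map {V V' : Type*} (f : V ≃ V') {E : Finset (Finset V)} (hE : IsSTS E) :
    IsSTS (E.map (Finset.mapEmbedding f.toEmbedding).toEmbedding) := by
  have hE' := isSTS_iff.mp hE
  refine isSTS_iff.mpr ⟨?_, ?_, ?_⟩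
  · intro e he
    obtain ⟨T, hT, rfl⟩ := mem_map.mp he
    exact (card_map _).trans (hE'.1 T hT)
  · intro x y hxy
    obtain ⟨T, hT, h1, h2⟩ := hE'.2.1 (f.symm x) (f.symm y) fun h => hxy (f.symm.injective h)
    exact ⟨_, mem_map_of_mem _ hT, mem_map.mpr ⟨_, h1, by simp⟩, mem_map.mpr ⟨_, h2, by simp⟩⟩
  · intro x y hxy e he e' he' a b c d
    obtain ⟨T, hT, rfl⟩ := mem_map.mp he
    obtain ⟨T', hT', rfl⟩ := mem_map.mp he'
    have key : ∀ (T : Finset V) z, z ∈ (mapEmbedding f.toEmbedding).toEmbedding T →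
        f.symm z ∈ T := by
      intro T z hz
      obtain ⟨u, hu, rfl⟩ := mem_map.mp hz
      simpa using hu
    rw [hE'.2.2 (f.symm x) (f.symm y) (fun h => hxy (f.symm.injective h)) T hT T' hT'
      (key _ _ a) (key _ _ b) (key _ _ c) (key _ _ d)]

/-- The Bose construction. -/
lemma exists_isSTS_bose {W : Type*} [Fintype W] [DecidableEq W]
    (hW : Fintype.card W % 6 = 3) : ∃ E : Finset (Finset W), IsSTS E := by
  obtain ⟨t, ht⟩ : ∃ t, Fintype.card W = 3 * (2 * t + 1) :=
    ⟨Fintype.card W / 6, by omega⟩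
  have hc : (2 : ZMod (2 * t + 1)) * ((t + 1 : ℕ) : ZMod (2 * t + 1)) = 1 := by
    have : ((2 * t + 1 : ℕ) : ZMod (2 * t + 1)) = 0 := ZMod.natCast_self _
    push_cast at this ⊢
    linear_combination this
  obtain ⟨E, hE⟩ := exists_isSTS_of_quasigroup (boseOp ((t + 1 : ℕ) : ZMod (2 * t + 1)))
    (boseOp_self _) (boseOp_comm _) (boseOp_boseOp hc)
  have hcard : Fintype.card (ZMod (2 * t + 1) × ZMod 3) = Fintype.card W := by
    rw [Fintype.card_prod, ZMod.card, ZMod.card, ht, mul_comm]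
  exact ⟨_, isSTS_map (Fintype.equivOfCardEq hcard) hE⟩

section Greedy

variable {U : Type*} [Fintype U] [DecidableEq U]

/-- Greedy choice of apexes for a sparse family of pairs. -/
lemma exists_apex [Nonempty U] {F : Finset (Finset U)} {Cand : Finset U → Finset U} {d l : ℕ}
    (hl : 0 < l) (h2 : ∀ e ∈ F, e.card = 2) (hd : ∀ x, (F.filter fun e => x ∈ e).card ≤ d)
    (hc : ∀ e ∈ F, 2 * d + 4 * l + F.card / l < (Cand e).card) :
    ∃ ap : Finset U → U, (∀ e ∈ F, ap e ∈ Cand e) ∧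
      (∀ e ∈ F, ∀ e' ∈ F, e ≠ e' → (ap e = ap e' → Disjoint e e') ∧ ¬ (ap e ∈ e' ∧ ap e' ∈ e)) ∧
      ∀ z, (F.filter fun e => ap e = z).card ≤ l := by
  suffices H : ∀ F' ⊆ F, ∃ ap : Finset U → U, (∀ e ∈ F', ap e ∈ Cand e) ∧
      (∀ e ∈ F', ∀ e' ∈ F', e ≠ e' →
        (ap e = ap e' → Disjoint e e') ∧ ¬ (ap e ∈ e' ∧ ap e' ∈ e)) ∧
      ∀ z, (F'.filter fun e => ap e = z).card ≤ l from H F subset_rfl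
  intro F'
  induction F' using Finset.induction_on with
  | empty => exact fun _ => ⟨fun _ => Classical.arbitrary U, by simp, by simp, by simp⟩
  | insert e F' heF ih =>
    intro hsub
    have heF' : e ∈ F := hsub (mem_insert_self _ _)
    have hsub' : F' ⊆ F := fun a ha => hsub (mem_insert_of_mem ha)
    obtain ⟨ap, a1, a2, a3⟩ := ih hsub'
    let B1 : Finset U := e.biUnion fun x => (F.filter fun e' => x ∈ e').image ap
    let B2 : Finset U := e.biUnion fun x => (F'.filter fun e' => ap e' = x).biUnion id
    let B3 : Finset U := univ.filter fun z => (F'.filter fun e' => ap e' = z).card = l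
    have hB1 : B1.card ≤ 2 * d := by
      rw [← h2 e heF']
      exact card_biUnion_le_card_mul _ _ _ fun x _ => card_image_le.trans (hd x)
    have hB2 : B2.card ≤ 2 * (l * 2) := by
      rw [← h2 e heF']
      refine card_biUnion_le_card_mul _ _ _ fun x _ => ?_
      refine (card_biUnion_le_card_mul _ _ (e.card) fun e' he' => ?_).trans
        (Nat.mul_le_mul_right _ (a3 x))
      rw [id, h2 e heF', h2 e' (hsub' (mem_filter.mp he').1)]
    have hB3 : B3.card ≤ F.card / l := by
      rw [Nat.le_div_iff_mul_le hl]
      calc B3.card * l = ∑ z ∈ B3, (F'.filter fun e' => ap e' = z).card := by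
            rw [sum_congr rfl (g := fun _ => l), sum_const, smul_eq_mul]
            intro z hz
            exact (mem_filter.mp hz).2
        _ ≤ ∑ z : U, (F'.filter fun e' => ap e' = z).card :=
            sum_le_sum_of_subset (subset_univ _)
        _ = F'.card := (card_eq_sum_card_fiberwise fun _ _ => mem_univ _).symm
        _ ≤ F.card := card_le_card hsub'
    have hlt : (B1 ∪ B2 ∪ B3).card < (Cand e).card := by
      have h3 := card_union_le (B1 ∪ B2) B3
      have h4 := card_union_le B1 B2
      have h5 := hc e heF'
      omega
    obtain ⟨z, hz, hzB⟩ := exists_mem_notMem_of_card_lt_card hlt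
    simp only [mem_union, not_or] at hzB
    obtain ⟨⟨hz1, hz2⟩, hz3⟩ := hzB
    have hz1' : ∀ e' ∈ F', ap e' = z → Disjoint e e' := by
      intro e' he' h
      rw [disjoint_left]
      intro x hx hx'
      exact hz1 (mem_biUnion.mpr ⟨x, hx, mem_image.mpr ⟨e', mem_filter.mpr ⟨hsub' he', hx'⟩, h⟩⟩)
    have hz2' : ∀ e' ∈ F', ¬ (z ∈ e' ∧ ap e' ∈ e) := by
      rintro e' he' ⟨h3, h4⟩
      exact hz2 (mem_biUnion.mpr ⟨_, h4, mem_biUnion.mpr ⟨e', mem_filter.mpr ⟨he', rfl⟩, h3⟩⟩)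
    have hne : ∀ e' ∈ F', e' ≠ e := fun e' he' h => heF (h ▸ he')
    have hup : ∀ e' ∈ F', Function.update ap e z e' = ap e' := fun e' he' =>
      Function.update_of_ne (hne e' he') _ _
    refine ⟨Function.update ap e z, ?_, ?_, ?_⟩
    · intro e' he'
      rcases mem_insert.mp he' with rfl | he'
      · simpa using hz
      · rw [hup e' he']; exact a1 e' he'
    · intro e1 he1 e2 he2 hne12
      rcases mem_insert.mp he1 with rfl | he1' <;> rcases mem_insert.mp he2 with rfl | he2'
      · exact absurd rfl hne12
      · rw [hup e2 he2', Function.update_self]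
        exact ⟨fun h => hz1' e2 he2' h.symm, hz2' e2 he2'⟩
      · rw [hup e1 he1', Function.update_self]
        exact ⟨fun h => (hz1' e1 he1' h).symm, fun h => hz2' e1 he1' ⟨h.2, h.1⟩⟩
      · rw [hup e1 he1', hup e2 he2']
        exact a2 e1 he1' e2 he2' hne12
    · intro y
      have hF' : (F'.filter fun e' => Function.update ap e z e' = y) =
          F'.filter fun e' => ap e' = y := filter_congr fun e' he' => by rw [hup e' he']
      rw [filter_insert, hF', Function.update_self]
      split_ifs with h
      · subst h
        have h6 : (F'.filter fun e' => ap e' = z).card ≠ l := fun h =>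
          hz3 (mem_filter.mpr ⟨mem_univ _, h⟩)
        have h7 := a3 z
        have h8 := card_insert_le e (F'.filter fun e' => ap e' = z)
        omega
      · exact a3 y

/-- Greedy choice of a subfamily of given size and bounded degree. -/
lemma exists_subfamily {Q : Finset (Finset U)} {q D r : ℕ} (hD : 0 < D)
    (h3 : ∀ T ∈ Q, T.card = 3) (hr : ∀ x, (Q.filter fun T => x ∈ T).card ≤ r)
    (hq : q + 3 * q / D * r < Q.card) :
    ∃ X ⊆ Q, X.card = q ∧ ∀ x, (X.filter fun T => x ∈ T).card ≤ D := by
  suffices H : ∀ i ≤ q, ∃ X ⊆ Q, X.card = i ∧ ∀ x, (X.filter fun T => x ∈ T).card ≤ D from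
    H q le_rfl
  intro i
  induction i with
  | zero => exact fun _ => ⟨∅, empty_subset _, rfl, by simp⟩
  | succ i ih =>
    intro hi
    obtain ⟨X, hXQ, hXc, hXd⟩ := ih (by omega)
    let S : Finset U := univ.filter fun x => (X.filter fun T => x ∈ T).card = D
    let B : Finset (Finset U) := S.biUnion fun x => Q.filter fun T => x ∈ T
    have hS : S.card ≤ 3 * q / D := by
      rw [Nat.le_div_iff_mul_le hD]
      calc S.card * D = ∑ x ∈ S, (X.filter fun T => x ∈ T).card := by
            rw [sum_congr rfl (g := fun _ => D), sum_const, smul_eq_mul]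
            intro z hz
            exact (mem_filter.mp hz).2
        _ ≤ ∑ x : U, (X.filter fun T => x ∈ T).card := sum_le_sum_of_subset (subset_univ _)
        _ = ∑ T ∈ X, ((univ : Finset U).filter fun x => x ∈ T).card :=
            sum_card_bipartiteAbove_eq_sum_card_bipartiteBelow (r := fun x T => x ∈ T)
        _ = ∑ T ∈ X, 3 := by
            refine sum_congr rfl fun T hT => ?_
            rw [filter_mem_eq_inter, univ_inter, h3 T (hXQ hT)]
        _ ≤ 3 * q := by rw [sum_const, smul_eq_mul, hXc]; omega
    have hB : B.card ≤ 3 * q / D * r :=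
      (card_biUnion_le_card_mul _ _ _ fun x _ => hr x).trans (Nat.mul_le_mul_right _ hS)
    have hlt : (X ∪ B).card < Q.card := by
      have := card_union_le X B
      omega
    obtain ⟨T, hT, hTn⟩ := exists_mem_notMem_of_card_lt_card hlt
    simp only [mem_union, not_or] at hTn
    refine ⟨insert T X, insert_subset hT hXQ, by rw [card_insert_of_notMem hTn.1, hXc], ?_⟩
    intro x
    rw [filter_insert]
    split_ifs with h
    · have h4 : (X.filter fun T => x ∈ T).card ≠ D := fun h' =>
        hTn.2 (mem_biUnion.mpr ⟨x, mem_filter.mpr ⟨mem_univ _, h'⟩, mem_filter.mpr ⟨hT, h⟩⟩)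
      have h5 := hXd x
      have h6 := card_insert_le T (X.filter fun T => x ∈ T)
      omega
    · exact hXd x

/-- Cutting `{0, …, M-1}` into consecutive intervals of prescribed lengths. -/
lemma exists_intervals {h M : ℕ} (s : Fin h → ℕ) (hs : ∑ i, s i = M) :
    ∃ f : Fin M → Fin h, (∀ i, (univ.filter fun t => f t = i).card = s i) ∧
      ∀ t, ∑ i ∈ univ.filter (· < f t), s i ≤ (t : ℕ) ∧
        (t : ℕ) < ∑ i ∈ univ.filter (· < f t), s i + s (f t) := by
  subst hs
  let φ := finSigmaFinEquiv (n := s)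
  refine ⟨fun t => (φ.symm t).1, ?_, ?_⟩
  · intro i
    have : (univ.filter fun t => (φ.symm t).1 = i) =
        (univ : Finset (Fin (s i))).image fun j => φ ⟨i, j⟩ := by
      ext t
      simp only [mem_filter, mem_univ, true_and, mem_image]
      constructor
      · rintro rfl
        exact ⟨(φ.symm t).2, φ.apply_symm_apply t⟩
      · rintro ⟨j, rfl⟩
        rw [φ.symm_apply_apply]
    rw [this, card_image_of_injective, card_univ, Fintype.card_fin]
    intro j j' hj
    have := φ.injective hj
    simpa using this
  · intro t
    obtain ⟨p, rfl⟩ := φ.surjective t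
    simp only [Equiv.symm_apply_apply]
    have h1 : (φ p : ℕ) = ∑ i ∈ univ.filter (· < p.1), s i + p.2 := by
      have := finSigmaFinEquiv_apply (n := s) p
      refine this.trans ?_
      congr 1
      refine sum_bij (fun i _ => Fin.castLE p.1.2.le i) ?_ ?_ ?_ ?_
      · intro i _
        exact mem_filter.mpr ⟨mem_univ _, i.2⟩
      · intro i _ j _ hij
        simpa using hij
      · intro j hj
        simp only [mem_filter, mem_univ, true_and] at hj
        exact ⟨⟨j, hj⟩, mem_univ _, rfl⟩
      · intro i _
        rfl
    rw [h1]
    exact ⟨Nat.le_add_right _ _, Nat.add_lt_add_left p.2.2 _⟩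

end Greedy

section Unified

variable {U : Type*} [Fintype U] [DecidableEq U]

/-- The pairs inside one side not covered by `P`. -/
def innerUncovered (side : U → Bool) (P : Finset (Finset U)) : Finset (Finset U) :=
  (univ.powersetCard 2).filter fun e =>
    (∀ x ∈ e, ∀ y ∈ e, side x = side y) ∧ ∀ T ∈ P, ¬ e ⊆ T

lemma mem_innerUncovered {side : U → Bool} {P : Finset (Finset U)} {e : Finset U} :
    e ∈ innerUncovered side P ↔ e.card = 2 ∧ (∀ x ∈ e, ∀ y ∈ e, side x = side y) ∧
      ∀ T ∈ P, ¬ e ⊆ T := by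
  simp [innerUncovered, mem_powersetCard]

lemma eq_pair_of_card_two {e : Finset U} (he : e.card = 2) {x y : U} (hx : x ∈ e) (hy : y ∈ e)
    (hxy : x ≠ y) : e = {x, y} := by
  symm
  refine eq_of_subset_of_card_le ?_ (by rw [he, card_pair hxy])
  intro z hz
  simp only [mem_insert, mem_singleton] at hz
  rcases hz with rfl | rfl <;> assumption

/-- The packing obtained by adding an apex to every uncovered inner pair. -/
lemma packing_with_apexes (side : U → Bool) {P : Finset (Finset U)}
    (hc : ∀ e ∈ P, e.card = 3)
    (hu : ∀ x y, x ≠ y → ∀ e ∈ P, ∀ e' ∈ P, x ∈ e → y ∈ e → x ∈ e' → y ∈ e' → e = e')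
    {ap : Finset U → U}
    (h1 : ∀ e ∈ innerUncovered side P, ∀ x ∈ e, side (ap e) ≠ side x)
    (h2 : ∀ e ∈ innerUncovered side P, ∀ x ∈ e, ∀ T ∈ P, ap e ∈ T → x ∉ T)
    (h3 : ∀ e ∈ innerUncovered side P, ∀ e' ∈ innerUncovered side P, e ≠ e' →
      (ap e = ap e' → Disjoint e e') ∧ ¬ (ap e ∈ e' ∧ ap e' ∈ e)) :
    let P' := P ∪ (innerUncovered side P).image fun e => insert (ap e) e
    (∀ e ∈ P', e.card = 3) ∧
    (∀ x y, x ≠ y → ∀ e ∈ P', ∀ e' ∈ P', x ∈ e → y ∈ e → x ∈ e' → y ∈ e' → e = e') ∧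
    (∀ x y, x ≠ y → side x = side y → ∃ e ∈ P', x ∈ e ∧ y ∈ e) ∧
    ∀ x, (P'.filter fun e => x ∈ e).card = (P.filter fun e => x ∈ e).card +
      ((innerUncovered side P).filter fun e => x ∈ e).card +
      ((innerUncovered side P).filter fun e => ap e = x).card := by
  intro P'
  have hmem : ∀ T, T ∈ P' ↔ T ∈ P ∨ ∃ e ∈ innerUncovered side P, insert (ap e) e = T := by
    intro T
    simp only [P', mem_union, mem_image]
  have hap : ∀ e ∈ innerUncovered side P, ap e ∉ e := fun e he h => h1 e he _ h rfl
  have hinner : ∀ e ∈ innerUncovered side P, ∀ x y, x ≠ y → side x = side y →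
      x ∈ insert (ap e) e → y ∈ insert (ap e) e → e = {x, y} := by
    intro e he x y hxy hs hx hy
    rw [mem_insert] at hx hy
    have he' := mem_innerUncovered.mp he
    rcases hx with rfl | hx <;> rcases hy with rfl | hy
    · exact absurd rfl hxy
    · exact absurd hs (h1 e he y hy)
    · exact absurd hs.symm (h1 e he x hx)
    · exact eq_pair_of_card_two he'.1 hx hy hxy
  have hPe : ∀ e ∈ innerUncovered side P, ∀ T ∈ P, ∀ x y, x ≠ y → x ∈ T → y ∈ T →
      x ∈ insert (ap e) e → y ∈ insert (ap e) e → False := by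
    intro e he T hT x y hxy hx hy hxe hye
    by_cases hs : side x = side y
    · have := hinner e he x y hxy hs hxe hye
      refine (mem_innerUncovered.mp he).2.2 T hT ?_
      rw [this]
      intro z hz
      simp only [mem_insert, mem_singleton] at hz
      rcases hz with rfl | rfl <;> assumption
    · rw [mem_insert] at hxe hye
      rcases hxe with rfl | hxe <;> rcases hye with rfl | hye
      · exact hxy rfl
      · exact h2 e he y hye T hT hx hy
      · exact h2 e he x hxe T hT hy hx
      · exact hs ((mem_innerUncovered.mp he).2.1 x hxe y hye)
  have hee : ∀ e ∈ innerUncovered side P, ∀ e' ∈ innerUncovered side P, ∀ x y, x ≠ y →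
      x ∈ insert (ap e) e → y ∈ insert (ap e) e →
      x ∈ insert (ap e') e' → y ∈ insert (ap e') e' → e = e' := by
    intro e he e' he' x y hxy hx hy hx' hy'
    by_cases hs : side x = side y
    · rw [hinner e he x y hxy hs hx hy, hinner e' he' x y hxy hs hx' hy']
    · by_contra hne
      have h4 := h3 e he e' he' hne
      rw [mem_insert] at hx hy hx' hy'
      have hd : ap e = ap e' → ∀ z, z ∈ e → z ∈ e' → False := fun h z hz hz' =>
        disjoint_left.mp (h4.1 h) hz hz'
      have k1 : ¬ (x ∈ e ∧ y ∈ e) := fun h => hs ((mem_innerUncovered.mp he).2.1 x h.1 y h.2)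
      have k2 : ¬ (x ∈ e' ∧ y ∈ e') := fun h => hs ((mem_innerUncovered.mp he').2.1 x h.1 y h.2)
      rcases hx with hx | hx <;> rcases hy with hy | hy
      · exact hxy (hx.trans hy.symm)
      · rcases hx' with hx' | hx' <;> rcases hy' with hy' | hy'
        · exact hxy (hx'.trans hy'.symm)
        · exact hd (hx.symm.trans hx') y hy hy'
        · exact h4.2 ⟨hx ▸ hx', hy' ▸ hy⟩
        · exact k2 ⟨hx', hy'⟩
      · rcases hx' with hx' | hx' <;> rcases hy' with hy' | hy'
        · exact hxy (hx'.trans hy'.symm)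
        · exact h4.2 ⟨hy ▸ hy', hx' ▸ hx⟩
        · exact hd (hy.symm.trans hy') x hx hx'
        · exact k2 ⟨hx', hy'⟩
      · exact k1 ⟨hx, hy⟩
  refine ⟨?_, ?_, ?_, ?_⟩
  · intro T hT
    rcases (hmem T).mp hT with h | ⟨e, he, rfl⟩
    · exact hc T h
    · rw [card_insert_of_notMem (hap e he), (mem_innerUncovered.mp he).1]
  · intro x y hxy T hT T' hT' hx hy hx' hy'
    rcases (hmem T).mp hT with h | ⟨e, he, rfl⟩ <;>
      rcases (hmem T').mp hT' with h' | ⟨e', he', rfl⟩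
    · exact hu x y hxy T h T' h' hx hy hx' hy'
    · exact (hPe e' he' T h x y hxy hx hy hx' hy').elim
    · exact (hPe e he T' h' x y hxy hx' hy' hx hy).elim
    · rw [hee e he e' he' x y hxy hx hy hx' hy']
  · intro x y hxy hs
    by_cases h : ∃ T ∈ P, x ∈ T ∧ y ∈ T
    · obtain ⟨T, hT, hx⟩ := h
      exact ⟨T, (hmem T).mpr (Or.inl hT), hx⟩
    · have he : ({x, y} : Finset U) ∈ innerUncovered side P := by
        rw [mem_innerUncovered]
        refine ⟨card_pair hxy, ?_, ?_⟩
        · intro a ha b hb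
          simp only [mem_insert, mem_singleton] at ha hb
          rcases ha with rfl | rfl <;> rcases hb with rfl | rfl <;> simp [hs]
        · intro T hT hsub
          exact h ⟨T, hT, hsub (by simp), hsub (by simp)⟩
      exact ⟨_, (hmem _).mpr (Or.inr ⟨_, he, rfl⟩), by simp, by simp⟩
  · intro x
    have hinj : Set.InjOn (fun e => insert (ap e) e) (innerUncovered side P : Set (Finset U)) := by
      intro e he e' he' h
      rw [mem_coe] at he he'
      obtain ⟨a, b, hab, hab'⟩ := card_eq_two.mp (mem_innerUncovered.mp he).1
      have ha : a ∈ insert (ap e) e := by rw [hab']; simp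
      have hb : b ∈ insert (ap e) e := by rw [hab']; simp
      have h' : insert (ap e) e = insert (ap e') e' := h
      exact hee e he e' he' a b hab ha hb (h' ▸ ha) (h' ▸ hb)
    have hdisj : Disjoint (P.filter fun e => x ∈ e)
        (((innerUncovered side P).image fun e => insert (ap e) e).filter fun e => x ∈ e) := by
      rw [disjoint_left]
      intro T hT hT'
      simp only [mem_filter, mem_image] at hT hT'
      obtain ⟨⟨e, he, rfl⟩, _⟩ := hT'
      obtain ⟨a, b, hab, hab'⟩ := card_eq_two.mp (mem_innerUncovered.mp he).1
      have ha : a ∈ insert (ap e) e := by rw [hab']; simp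
      have hb : b ∈ insert (ap e) e := by rw [hab']; simp
      exact hPe e he _ hT.1 a b hab ha hb ha hb
    have himg : (((innerUncovered side P).image fun e => insert (ap e) e).filter fun e => x ∈ e) =
        ((innerUncovered side P).filter fun e => x ∈ insert (ap e) e).image
          fun e => insert (ap e) e := by
      rw [filter_image]
    have hsplit : ((innerUncovered side P).filter fun e => x ∈ insert (ap e) e).card =
        ((innerUncovered side P).filter fun e => x ∈ e).card +
        ((innerUncovered side P).filter fun e => ap e = x).card := by
      rw [← card_union_of_disjoint, ← filter_or]
      · congr 1
        refine filter_congr fun e _ => ?_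
        rw [mem_insert, or_comm, eq_comm]
      · rw [disjoint_filter]
        rintro e he h rfl
        exact hap e he h
    rw [filter_union, card_union_of_disjoint hdisj, himg,
      card_image_of_injOn (hinj.mono (coe_subset.mpr (filter_subset _ _))), hsplit, add_assoc]

end Unified

section Structure

/-- The vertices: a side, a block, a half of the block and a position in that half. -/
abbrev Vtx (I k : ℕ) : Type := Bool × ZMod I × Bool × ZMod k

variable {I k : ℕ}

/-- The block offset of two vertices on different sides. -/
def off (x z : Vtx I k) : ZMod I := if x.1 = false then z.2.1 - x.2.1 else x.2.1 - z.2.1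

lemma off_comm {x z : Vtx I k} (h : x.1 ≠ z.1) : off x z = off z x := by
  obtain ⟨a, b⟩ := x
  obtain ⟨c, d⟩ := z
  cases a <;> cases c <;> simp_all [off]

/-- The reserved inner graph. -/
def QAdj (g : ℕ) (x y : Vtx I k) : Prop := x.1 = y.1 ∧ x.2.1 = y.2.1 ∧
  ((x.2.2.1 = false ∧ y.2.2.1 = true ∧ (y.2.2.2 - x.2.2.2).val < g) ∨
    (x.2.2.1 = true ∧ y.2.2.1 = false ∧ (x.2.2.2 - y.2.2.2).val < g))

instance (g : ℕ) (x y : Vtx I k) : Decidable (QAdj g x y) := by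
  unfold QAdj
  infer_instance

lemma QAdj.symm {g : ℕ} {x y : Vtx I k} (h : QAdj g x y) : QAdj g y x := by
  obtain ⟨h1, h2, h3⟩ := h
  exact ⟨h1.symm, h2.symm, h3.symm.imp (fun h => ⟨h.2.1, h.1, h.2.2⟩) fun h => ⟨h.2.1, h.1, h.2.2⟩⟩

lemma QAdj.ne {g : ℕ} {x y : Vtx I k} (h : QAdj g x y) : x ≠ y := by
  rintro rfl
  obtain ⟨_, _, ⟨h1, h2, _⟩ | ⟨h1, h2, _⟩⟩ := h <;> simp [h1] at h2

variable [NeZero I] [NeZero k]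

lemma card_val_lt {g : ℕ} (hg : g ≤ k) : (univ.filter fun c : ZMod k => c.val < g).card = g := by
  have : (univ.filter fun c : ZMod k => c.val < g) = (range g).image fun i : ℕ => (i : ZMod k) := by
    ext c
    simp only [mem_filter, mem_univ, true_and, mem_image, mem_range]
    constructor
    · exact fun h => ⟨c.val, h, ZMod.natCast_zmod_val c⟩
    · rintro ⟨i, hi, rfl⟩
      rwa [ZMod.val_natCast, Nat.mod_eq_of_lt (by omega)]
  rw [this, card_image_of_injOn, card_range]
  intro i hi j hj hij
  simp only [coe_range, Set.mem_Iio] at hi hj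
  have h := congrArg ZMod.val hij
  simp only [ZMod.val_natCast] at h
  rwa [Nat.mod_eq_of_lt (by omega), Nat.mod_eq_of_lt (by omega)] at h

lemma card_QAdj {g : ℕ} (hg : g ≤ k) (x : Vtx I k) :
    (univ.filter fun y => QAdj g x y).card = g := by
  obtain ⟨s, i, b, a⟩ := x
  refine Eq.trans ?_ (card_val_lt hg)
  cases b with
  | false =>
    refine card_bij' (fun y _ => y.2.2.2 - a) (fun c _ => (s, i, true, c + a)) ?_ ?_ ?_ ?_
    · rintro ⟨s', i', b', a'⟩ h
      simpa [QAdj] using ((mem_filter.mp h).2.2.2.resolve_right (by simp)).2.2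
    · intro c hc
      simpa [QAdj] using hc
    · rintro ⟨s', i', b', a'⟩ h
      have h' := (mem_filter.mp h).2
      simp [QAdj] at h'
      simp [h'.1, h'.2.1, h'.2.2.1]
    · intro c _
      simp
  | true =>
    refine card_bij' (fun y _ => a - y.2.2.2) (fun c _ => (s, i, false, a - c)) ?_ ?_ ?_ ?_
    · rintro ⟨s', i', b', a'⟩ h
      simpa [QAdj] using ((mem_filter.mp h).2.2.2.resolve_left (by simp)).2.2
    · intro c hc
      simpa [QAdj] using hc
    · rintro ⟨s', i', b', a'⟩ h
      have h' := (mem_filter.mp h).2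
      simp [QAdj] at h'
      simp [h'.1, h'.2.1, h'.2.2.1]
    · intro c _
      simp

lemma card_side (s : Bool) : (univ.filter fun y : Vtx I k => y.1 = s).card = 2 * k * I := by
  have : (univ.filter fun y : Vtx I k => y.1 = s) =
      (univ : Finset (ZMod I × Bool × ZMod k)).image fun z => (s, z) := by
    ext ⟨a, b⟩
    simp [eq_comm]
  rw [this, card_image_of_injective _ (Prod.mk_right_injective s), card_univ, Fintype.card_prod,
    Fintype.card_prod, ZMod.card, ZMod.card, Fintype.card_bool]
  ring

lemma card_off (A : Finset (ZMod I)) (x : Vtx I k) :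
    (univ.filter fun y => x.1 ≠ y.1 ∧ off x y ∈ A).card = 2 * k * A.card := by
  have : (univ.filter fun y => x.1 ≠ y.1 ∧ off x y ∈ A).card =
      (A ×ˢ (univ : Finset (Bool × ZMod k))).card := by
    obtain ⟨s, i, c⟩ := x
    cases s with
    | false =>
      refine card_bij' (fun y _ => (y.2.1 - i, y.2.2)) (fun c _ => (true, c.1 + i, c.2)) ?_ ?_ ?_ ?_
      · rintro ⟨s', i', b'⟩ h
        simpa [off] using (mem_filter.mp h).2.2
      · intro c hc
        simpa [off] using hc
      · rintro ⟨s', i', b'⟩ h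
        have h' := (mem_filter.mp h).2.1
        simp at h'
        simp [h']
      · intro c _
        simp
    | true =>
      refine card_bij' (fun y _ => (i - y.2.1, y.2.2)) (fun c _ => (false, i - c.1, c.2)) ?_ ?_ ?_ ?_
      · rintro ⟨s', i', b'⟩ h
        simpa [off] using (mem_filter.mp h).2.2
      · intro c hc
        simpa [off] using hc
      · rintro ⟨s', i', b'⟩ h
        have h' := (mem_filter.mp h).2.1
        simp at h'
        simp [h']
      · intro c _
        simp
  rw [this, card_product, card_univ, Fintype.card_prod, Fintype.card_bool, ZMod.card]
  ring

/-- The left end of the `t`-th reserved edge. -/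
def qL (g : ℕ) (s : Bool) (t : ℕ) : Vtx I k := (s, ((t / k / g : ℕ) : ZMod I), false, (t : ZMod k))

/-- The right end of the `t`-th reserved edge. -/
def qR (g : ℕ) (s : Bool) (t : ℕ) : Vtx I k :=
  (s, ((t / k / g : ℕ) : ZMod I), true, ((t + t / k % g : ℕ) : ZMod k))

/-- The `t`-th reserved edge. -/
def qE (I k g : ℕ) (s : Bool) (t : ℕ) : Finset (Vtx I k) := {qL g s t, qR g s t}

lemma QAdj_qL_qR {g : ℕ} (hg0 : 0 < g) (hg : g ≤ k) (s : Bool) (t : ℕ) :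
    QAdj g (qL g s t : Vtx I k) (qR g s t) := by
  refine ⟨rfl, rfl, Or.inl ⟨rfl, rfl, ?_⟩⟩
  have h1 : t / k % g < g := Nat.mod_lt _ hg0
  simp only [qL, qR, Nat.cast_add, add_sub_cancel_left]
  rwa [ZMod.val_natCast, Nat.mod_eq_of_lt (by omega)]

lemma natCast_eq_natCast {n a b : ℕ} (h : (a : ZMod n) = b) (ha : a < n) (hb : b < n) : a = b := by
  rw [ZMod.natCast_eq_natCast_iff] at h
  exact Nat.ModEq.eq_of_lt_of_lt h ha hb

lemma div_div_lt {I k g t : ℕ} (ht : t < I * (k * g)) : t / k / g < I := by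
  rw [Nat.div_div_eq_div_mul]
  exact Nat.div_lt_of_lt_mul (by rw [mul_comm]; exact ht)

lemma disjoint_qE {g t t' : ℕ} (ht' : t' < I * (k * g)) (s : Bool) (h1 : t < t')
    (h2 : t' + 1 < t + k) : Disjoint (qE I k g s t) (qE I k g s t') := by
  have hk : 0 < k := Nat.pos_of_ne_zero (NeZero.ne k)
  have hL : (qL g s t : Vtx I k) ≠ qL g s t' := by
    intro h
    have h3 : ((t : ℕ) : ZMod k) = (t' : ℕ) := congrArg (fun x => x.2.2.2) h
    rw [ZMod.natCast_eq_natCast_iff, Nat.modEq_iff_dvd' h1.le] at h3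
    have := Nat.le_of_dvd (by omega) h3
    omega
  have hR : (qR g s t : Vtx I k) ≠ qR g s t' := by
    intro h
    have h3 : ((t + t / k % g : ℕ) : ZMod k) = (t' + t' / k % g : ℕ) := congrArg (fun x => x.2.2.2) h
    have h4 : ((t / k / g : ℕ) : ZMod I) = (t' / k / g : ℕ) := congrArg (fun x => x.2.1) h
    have h5 := natCast_eq_natCast h4 (div_div_lt (by omega)) (div_div_lt ht')
    have h6 : t / k ≤ t' / k := Nat.div_le_div_right h1.le
    have h7 : t' / k ≤ t / k + 1 := by
      rw [← Nat.add_div_right _ hk]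
      exact Nat.div_le_div_right (by omega)
    have h8 := Nat.div_add_mod (t / k) g
    have h9 := Nat.div_add_mod (t' / k) g
    rw [h5] at h8
    rw [ZMod.natCast_eq_natCast_iff, Nat.modEq_iff_dvd' (by omega)] at h3
    have := Nat.le_of_dvd (by omega) h3
    omega
  rw [disjoint_left]
  intro x hx hx'
  simp only [qE, mem_insert, mem_singleton] at hx hx'
  rcases hx with rfl | rfl <;> rcases hx' with h | h
  · exact hL h
  · exact absurd (congrArg (fun x => x.2.2.1) h) (by simp [qL, qR])
  · exact absurd (congrArg (fun x => x.2.2.1) h) (by simp [qL, qR])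
  · exact hR h

lemma qE_injOn {g t t' : ℕ} (hg0 : 0 < g) (hg : g ≤ k) (ht : t < I * (k * g))
    (ht' : t' < I * (k * g)) (s : Bool) (h : qE I k g s t = qE I k g s t') : t = t' := by
  have hk : 0 < k := Nat.pos_of_ne_zero (NeZero.ne k)
  have hL : (qL g s t : Vtx I k) = qL g s t' := by
    have : (qL g s t : Vtx I k) ∈ qE I k g s t' := by rw [← h]; simp [qE]
    simp only [qE, mem_insert, mem_singleton] at this
    rcases this with h | h
    · exact h
    · exact absurd (congrArg (fun x => x.2.2.1) h) (by simp [qL, qR])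
  have hR : (qR g s t : Vtx I k) = qR g s t' := by
    have : (qR g s t : Vtx I k) ∈ qE I k g s t' := by rw [← h]; simp [qE]
    simp only [qE, mem_insert, mem_singleton] at this
    rcases this with h | h
    · exact absurd (congrArg (fun x => x.2.2.1) h) (by simp [qL, qR])
    · exact h
  have h3 : ((t + t / k % g : ℕ) : ZMod k) = (t' + t' / k % g : ℕ) := congrArg (fun x => x.2.2.2) hR
  have h4 : ((t / k / g : ℕ) : ZMod I) = (t' / k / g : ℕ) := congrArg (fun x => x.2.1) hR
  have h5 := natCast_eq_natCast h4 (div_div_lt ht) (div_div_lt ht')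
  have h6 : ((t : ℕ) : ZMod k) = (t' : ℕ) := congrArg (fun x => x.2.2.2) hL
  push_cast at h3
  rw [h6, add_right_inj] at h3
  have h1 : t / k % g < g := Nat.mod_lt _ hg0
  have h2 : t' / k % g < g := Nat.mod_lt _ hg0
  have h7 := natCast_eq_natCast h3 (by omega) (by omega)
  rw [ZMod.natCast_eq_natCast_iff] at h6
  have h8 : t / k = t' / k := by
    rw [← Nat.div_add_mod (t / k) g, ← Nat.div_add_mod (t' / k) g, h5, h7]
  rw [← Nat.div_add_mod t k, ← Nat.div_add_mod t' k, h8, h6]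

lemma exists_qE {g : ℕ} {x y : Vtx I k} (h : QAdj g x y) :
    ∃ t < I * (k * g), ({x, y} : Finset (Vtx I k)) = qE I k g x.1 t := by
  have hk : 0 < k := Nat.pos_of_ne_zero (NeZero.ne k)
  have key : ∀ x y : Vtx I k, x.1 = y.1 → x.2.1 = y.2.1 → x.2.2.1 = false → y.2.2.1 = true →
      (y.2.2.2 - x.2.2.2).val < g → ∃ t < I * (k * g), x = qL g x.1 t ∧ y = qR g x.1 t := by
    rintro ⟨s, i, b, a⟩ ⟨s', i', b', a'⟩ h1 h2 h3 h4 h5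
    simp only at h1 h2 h3 h4 h5
    subst h1 h2 h3 h4
    have hi := ZMod.val_lt i
    have ha := ZMod.val_lt a
    generalize hj : (a' - a).val = j at h5
    have ht1 : (k * (g * i.val + j) + a.val) / k = g * i.val + j := by
      rw [Nat.mul_add_div hk, Nat.div_eq_of_lt ha, add_zero]
    have ht2 : (g * i.val + j) / g = i.val := by
      rw [Nat.mul_add_div (by omega), Nat.div_eq_of_lt h5, add_zero]
    have ht3 : (g * i.val + j) % g = j := by
      rw [Nat.mul_add_mod, Nat.mod_eq_of_lt h5]
    refine ⟨k * (g * i.val + j) + a.val, ?_, ?_, ?_⟩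
    · have h6 : g * i.val + j + 1 ≤ g * I := by
        calc g * i.val + j + 1 ≤ g * i.val + g := by omega
          _ = g * (i.val + 1) := by ring
          _ ≤ g * I := Nat.mul_le_mul_left _ hi
      calc k * (g * i.val + j) + a.val < k * (g * i.val + j) + k := by omega
        _ = k * (g * i.val + j + 1) := by ring
        _ ≤ k * (g * I) := Nat.mul_le_mul_left _ h6
        _ = I * (k * g) := by ring
    · simp only [qL, ht1, ht2, Prod.mk.injEq, true_and]
      exact ⟨(ZMod.natCast_zmod_val i).symm, by simp⟩
    · simp only [qR, ht1, ht2, ht3, Prod.mk.injEq, true_and]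
      refine ⟨(ZMod.natCast_zmod_val i).symm, ?_⟩
      rw [← hj]
      simp
  obtain ⟨h1, h2, ⟨h3, h4, h5⟩ | ⟨h3, h4, h5⟩⟩ := h
  · obtain ⟨t, ht, hx, hy⟩ := key x y h1 h2 h3 h4 h5
    refine ⟨t, ht, ?_⟩
    rw [qE, ← hx, ← hy]
  · obtain ⟨t, ht, hx, hy⟩ := key y x h1.symm h2.symm h4 h3 h5
    refine ⟨t, ht, ?_⟩
    rw [qE, h1, ← hx, ← hy, pair_comm]

end Structure

section Assign

variable {I k : ℕ} [NeZero I] [NeZero k]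

lemma exists_block_order (c : ZMod I) : ∃ E : Fin (I * (2 * k)) ≃ ZMod I × Bool × ZMod k,
    ∀ j, (E j).1 = (((j : ℕ) / (2 * k) : ℕ) : ZMod I) - c := by
  have h1 : Function.Bijective fun i : Fin I => ((i : ℕ) : ZMod I) - c := by
    rw [Fintype.bijective_iff_injective_and_card]
    refine ⟨fun i j hij => ?_, by rw [Fintype.card_fin, ZMod.card]⟩
    exact Fin.ext (natCast_eq_natCast (sub_left_injective hij) i.2 j.2)
  have h2 : Fintype.card (Fin (2 * k)) = Fintype.card (Bool × ZMod k) := by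
    rw [Fintype.card_fin, Fintype.card_prod, Fintype.card_bool, ZMod.card]
  refine ⟨finProdFinEquiv.symm.trans
    ((Equiv.ofBijective _ h1).prodCongr (Fintype.equivOfCardEq h2)), fun j => ?_⟩
  simp [finProdFinEquiv]

lemma interval_block {H g τ j S s t B kg : ℕ} (hH : H * τ ≤ 2 * kg) (hj : j < H)
    (h1 : j * g ≤ 2 * S + j * τ) (h2 : 2 * S ≤ j * (g + τ)) (h3 : 2 * s ≤ g + τ)
    (hS : S ≤ t) (hS' : t < S + s) (hB : 2 * (kg * B) ≤ j * g)
    (hB' : (j + 1) * g ≤ 2 * (kg * (B + 1))) (hkg : 0 < kg) :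
    t / kg + 1 = B ∨ t / kg = B ∨ t / kg = B + 1 := by
  have h4 : j * τ ≤ H * τ := Nat.mul_le_mul_right _ hj.le
  have h5 : (j + 1) * τ ≤ H * τ := Nat.mul_le_mul_right _ hj
  have h6 : t < kg * (B + 2) := by
    have : 2 * t < 2 * (kg * (B + 2)) := by
      calc 2 * t < 2 * S + 2 * s := by omega
        _ ≤ j * (g + τ) + (g + τ) := by omega
        _ = (j + 1) * g + (j + 1) * τ := by ring
        _ ≤ 2 * (kg * (B + 1)) + 2 * kg := by omega
        _ = 2 * (kg * (B + 2)) := by ring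
    omega
  have h7 : kg * B ≤ kg * (t / kg + 1) + 0 := by
    have h8 := Nat.lt_mul_div_succ t hkg
    have h9 : kg * B ≤ t + kg := by omega
    have h10 : kg * B < kg * (t / kg + 2) := by
      calc kg * B ≤ t + kg := h9
        _ < kg * (t / kg + 1) + kg := by omega
        _ = kg * (t / kg + 2) := by ring
    have h11 := Nat.lt_of_mul_lt_mul_left h10
    exact Nat.mul_le_mul_left _ (by omega)
  have h12 := Nat.div_lt_of_lt_mul h6
  have h13 : B ≤ t / kg + 1 := Nat.le_of_mul_le_mul_left h7 hkg
  omega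

/-- Distributing the reserved edges of one side among the vertices of the other side. -/
lemma exists_qassign {g τ : ℕ} (hg0 : 0 < g) (c : ZMod I) (s : Bool)
    (len : ZMod I × Bool × ZMod k → ℕ) (hsum : ∑ v, len v = I * (k * g))
    (h1 : ∀ v, g ≤ 2 * len v + τ) (h2 : ∀ v, 2 * len v ≤ g + τ)
    (hτ : I * (2 * k) * τ ≤ 2 * (k * g)) (hgk : g + τ + 2 ≤ 2 * k) :
    ∃ f : ℕ → ZMod I × Bool × ZMod k,
      (∀ v, ((range (I * (k * g))).filter fun t => f t = v).card = len v) ∧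
      (∀ t < I * (k * g), ∀ t' < I * (k * g), t ≠ t' → f t = f t' →
        Disjoint (qE I k g s t) (qE I k g s t')) ∧
      ∀ t < I * (k * g), ∃ r ∈ ({-1, 0, 1} : Finset (ZMod I)),
        ((t / k / g : ℕ) : ZMod I) = (f t).1 + c + r := by
  have hk : 0 < k := Nat.pos_of_ne_zero (NeZero.ne k)
  have hI : 0 < I := Nat.pos_of_ne_zero (NeZero.ne I)
  obtain ⟨E, hE⟩ := exists_block_order (k := k) c
  obtain ⟨f, f1, f2⟩ := exists_intervals (M := I * (k * g)) (fun j => len (E j))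
    (by rw [← hsum]; exact E.sum_comp len)
  have hM : 0 < I * (k * g) := by positivity
  let F : ℕ → Fin (I * (2 * k)) := fun t => if h : t < I * (k * g) then f ⟨t, h⟩ else f ⟨0, hM⟩
  have hF : ∀ t (h : t < I * (k * g)), F t = f ⟨t, h⟩ := fun t h => dif_pos h
  refine ⟨fun t => E (F t), ?_, ?_, ?_⟩
  · intro v
    have h3 := f1 (E.symm v)
    simp only [Equiv.apply_symm_apply] at h3
    rw [← h3]
    symm
    refine card_bij (fun t _ => (t : ℕ)) ?_ ?_ ?_
    · intro t ht
      simp only [mem_filter, mem_range, mem_univ, true_and] at ht ⊢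
      refine ⟨t.2, ?_⟩
      rw [hF t t.2, ht, Equiv.apply_symm_apply]
    · exact fun a _ b _ hab => Fin.ext hab
    · intro t ht
      simp only [mem_filter, mem_range] at ht
      refine ⟨⟨t, ht.1⟩, ?_, rfl⟩
      simp only [mem_filter, mem_univ, true_and]
      rw [← hF t ht.1, ← ht.2, Equiv.symm_apply_apply]
  · have key : ∀ t t', t' < I * (k * g) → t < t' → F t = F t' →
        Disjoint (qE I k g s t) (qE I k g s t') := by
      intro t t' ht' hlt hff
      refine disjoint_qE ht' s hlt ?_
      have a1 := f2 ⟨t, by omega⟩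
      have a2 := f2 ⟨t', ht'⟩
      rw [← hF] at a1 a2
      rw [hff] at a1
      have a3 := h2 (E (F t'))
      simp only at a1 a2
      omega
    intro t ht t' ht' hne hff
    have hff' : F t = F t' := E.injective hff
    rcases Nat.lt_or_gt_of_ne hne with h | h
    · exact key t t' ht' h hff'
    · exact (key t' t ht h hff'.symm).symm
  · intro t ht
    have a1 := f2 ⟨t, ht⟩
    rw [← hF] at a1
    simp only at a1 ⊢
    generalize F t = j at a1 ⊢
    have hcard : (univ.filter (· < j)).card = (j : ℕ) := by
      have : univ.filter (· < j) = Iio j := by ext i; simp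
      rw [this, Fin.card_Iio]
    have b1 : (j : ℕ) * g ≤ 2 * (∑ i ∈ univ.filter (· < j), len (E i)) + j * τ := by
      calc (j : ℕ) * g = ∑ i ∈ univ.filter (· < j), g := by rw [sum_const, hcard, smul_eq_mul]
        _ ≤ ∑ i ∈ univ.filter (· < j), (2 * len (E i) + τ) := sum_le_sum fun i _ => h1 _
        _ = _ := by rw [sum_add_distrib, sum_const, hcard, smul_eq_mul, mul_sum]
    have b2 : 2 * (∑ i ∈ univ.filter (· < j), len (E i)) ≤ j * (g + τ) := by
      calc 2 * (∑ i ∈ univ.filter (· < j), len (E i))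
          = ∑ i ∈ univ.filter (· < j), 2 * len (E i) := mul_sum _ _ _
        _ ≤ ∑ i ∈ univ.filter (· < j), (g + τ) := sum_le_sum fun i _ => h2 _
        _ = _ := by rw [sum_const, hcard, smul_eq_mul]
    have c1 := Nat.div_add_mod (j : ℕ) (2 * k)
    have c2 := Nat.mod_lt (j : ℕ) (show 0 < 2 * k by omega)
    have b3 : 2 * (k * g * ((j : ℕ) / (2 * k))) ≤ j * g := by
      calc 2 * (k * g * ((j : ℕ) / (2 * k))) = (2 * k * ((j : ℕ) / (2 * k))) * g := by ring
        _ ≤ j * g := Nat.mul_le_mul_right _ (by omega)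
    have b4 : ((j : ℕ) + 1) * g ≤ 2 * (k * g * ((j : ℕ) / (2 * k) + 1)) := by
      calc ((j : ℕ) + 1) * g ≤ (2 * k * ((j : ℕ) / (2 * k)) + 2 * k) * g :=
            Nat.mul_le_mul_right _ (by omega)
        _ = _ := by ring
    have b5 := interval_block hτ j.2 b1 b2 (h2 (E j)) a1.1 a1.2 b3 b4 (by positivity)
    rw [← Nat.div_div_eq_div_mul] at b5
    have b6 : (E j).1 + c = (((j : ℕ) / (2 * k) : ℕ) : ZMod I) := by rw [hE]; ring
    rw [b6]
    rcases b5 with b5 | b5 | b5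
    · refine ⟨-1, by simp, ?_⟩
      rw [← b5]; push_cast; ring
    · refine ⟨0, by simp, ?_⟩
      rw [← b5]; ring
    · refine ⟨1, by simp, ?_⟩
      rw [b5]; push_cast; ring

/-- The reserved inner edges. -/
def qSet (I k g : ℕ) [NeZero I] [NeZero k] : Finset (Finset (Vtx I k)) :=
  ((univ : Finset (Vtx I k × Vtx I k)).filter fun p => QAdj g p.1 p.2).image fun p => {p.1, p.2}

lemma mem_qSet {g : ℕ} {e : Finset (Vtx I k)} :
    e ∈ qSet I k g ↔ ∃ x y, QAdj g x y ∧ e = {x, y} := by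
  rw [qSet, mem_image]
  constructor
  · rintro ⟨p, h, h'⟩
    exact ⟨p.1, p.2, (mem_filter.mp h).2, h'.symm⟩
  · rintro ⟨x, y, h, h'⟩
    exact ⟨(x, y), mem_filter.mpr ⟨mem_univ _, h⟩, h'.symm⟩

lemma mem_qSet_iff {g : ℕ} (hg0 : 0 < g) (hg : g ≤ k) {e : Finset (Vtx I k)} :
    e ∈ qSet I k g ↔ ∃ s, ∃ t < I * (k * g), e = qE I k g s t := by
  rw [mem_qSet]
  constructor
  · rintro ⟨x, y, h, rfl⟩
    exact ⟨x.1, exists_qE h⟩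
  · rintro ⟨s, t, _, rfl⟩
    exact ⟨_, _, QAdj_qL_qR hg0 hg s t, rfl⟩

/-- The offsets used by the apexes of reserved edges, according to the side of the apex. -/
def qOff (I : ℕ) (s : Bool) : Finset (ZMod I) := if s then {-4, -3, -2} else {-1, 0, 1}

/-- Apexes for the reserved edges with prescribed loads. -/
lemma exists_qapex {g τ : ℕ} (hg0 : 0 < g) (len : Vtx I k → ℕ)
    (hsum : ∀ s, ∑ v, len (s, v) = I * (k * g))
    (h1 : ∀ v, g ≤ 2 * len v + τ) (h2 : ∀ v, 2 * len v ≤ g + τ)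
    (hτ : I * (2 * k) * τ ≤ 2 * (k * g)) (hgk : g + τ + 2 ≤ 2 * k) (hg : g ≤ k) :
    ∃ ap : Finset (Vtx I k) → Vtx I k,
      (∀ e ∈ qSet I k g, ∀ x ∈ e, (ap e).1 ≠ x.1 ∧ off x (ap e) ∈ qOff I (ap e).1) ∧
      (∀ e ∈ qSet I k g, ∀ e' ∈ qSet I k g, e ≠ e' → ap e = ap e' → Disjoint e e') ∧
      ∀ v, ((qSet I k g).filter fun e => ap e = v).card = len v := by
  have hex : ∀ s : Bool, ∃ f : ℕ → ZMod I × Bool × ZMod k,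
      (∀ v, ((range (I * (k * g))).filter fun t => f t = v).card = len (!s, v)) ∧
      (∀ t < I * (k * g), ∀ t' < I * (k * g), t ≠ t' → f t = f t' →
        Disjoint (qE I k g s t) (qE I k g s t')) ∧
      ∀ t < I * (k * g), ∃ r ∈ ({-1, 0, 1} : Finset (ZMod I)),
        ((t / k / g : ℕ) : ZMod I) = (f t).1 + (if s then 0 else 3) + r := fun s =>
    exists_qassign hg0 (if s then 0 else 3) s (fun v => len (!s, v)) (hsum _) (fun v => h1 _)
      (fun v => h2 _) hτ hgk
  choose f f1 f2 f3 using hex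
  have hdec : ∀ e : Finset (Vtx I k), ∃ p : Bool × ℕ, e ∈ qSet I k g →
      p.2 < I * (k * g) ∧ e = qE I k g p.1 p.2 := by
    intro e
    by_cases he : e ∈ qSet I k g
    · obtain ⟨s, t, ht, h⟩ := (mem_qSet_iff hg0 hg).mp he
      exact ⟨(s, t), fun _ => ⟨ht, h⟩⟩
    · exact ⟨(true, 0), fun h => absurd h he⟩
  choose p hp using hdec
  have hpE : ∀ s t, t < I * (k * g) → p (qE I k g s t) = (s, t) := by
    intro s t ht
    obtain ⟨a1, a2⟩ := hp (qE I k g s t) ((mem_qSet_iff hg0 hg).mpr ⟨s, t, ht, rfl⟩)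
    have hs : s = (p (qE I k g s t)).1 := by
      have : qL g s t ∈ qE I k g (p (qE I k g s t)).1 (p (qE I k g s t)).2 := by
        rw [← a2]; simp [qE]
      simp only [qE, mem_insert, mem_singleton] at this
      rcases this with h | h <;> exact congrArg Prod.fst h
    rw [← hs] at a2
    exact Prod.ext hs.symm (qE_injOn hg0 hg ht a1 s a2).symm
  refine ⟨fun e => (!(p e).1, f (p e).1 (p e).2), ?_, ?_, ?_⟩
  · intro e he x hx
    obtain ⟨s, t, ht, rfl⟩ := (mem_qSet_iff hg0 hg).mp he
    simp only [hpE s t ht]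
    have hx1 : x.1 = s ∧ x.2.1 = ((t / k / g : ℕ) : ZMod I) := by
      simp only [qE, mem_insert, mem_singleton] at hx
      rcases hx with rfl | rfl <;> exact ⟨rfl, rfl⟩
    refine ⟨by rw [hx1.1]; simp, ?_⟩
    obtain ⟨r, hr, hr'⟩ := f3 s t ht
    rw [off, hx1.1, hx1.2, hr']
    simp only [mem_insert, mem_singleton] at hr
    cases s with
    | false =>
      simp only [Bool.not_false, qOff, if_true, mem_insert, mem_singleton, Bool.false_eq_true,
        if_false]
      rcases hr with rfl | rfl | rfl
      · right; right; ring
      · right; left; ring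
      · left; ring
    | true =>
      simp only [Bool.not_true, qOff, if_true, mem_insert, mem_singleton, Bool.false_eq_true,
        if_false, Bool.true_eq_false, add_zero, add_sub_cancel_left]
      exact hr
  · intro e he e' he' hne heq
    obtain ⟨s, t, ht, rfl⟩ := (mem_qSet_iff hg0 hg).mp he
    obtain ⟨s', t', ht', rfl⟩ := (mem_qSet_iff hg0 hg).mp he'
    simp only [hpE s t ht, hpE s' t' ht', Prod.mk.injEq, Bool.not_eq_eq_eq_not, Bool.not_not]
      at heq
    obtain ⟨rfl, h3⟩ := heq
    exact f2 s t ht t' ht' (fun h => hne (by rw [h])) h3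
  · rintro ⟨s, v⟩
    have h3 := f1 (!s) v
    rw [Bool.not_not] at h3
    rw [← h3]
    symm
    refine card_bij (fun t _ => qE I k g (!s) t) ?_ ?_ ?_
    · intro t ht
      simp only [mem_filter, mem_range] at ht ⊢
      refine ⟨(mem_qSet_iff hg0 hg).mpr ⟨_, t, ht.1, rfl⟩, ?_⟩
      rw [hpE _ t ht.1, Bool.not_not, ht.2]
    · intro t ht t' ht' h
      simp only [mem_filter, mem_range] at ht ht'
      exact qE_injOn hg0 hg ht.1 ht'.1 _ h
    · intro e he
      rw [mem_filter] at he
      obtain ⟨s', t, ht, rfl⟩ := (mem_qSet_iff hg0 hg).mp he.1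
      have h4 := he.2
      simp only [hpE s' t ht] at h4
      rw [Prod.mk.injEq] at h4
      obtain ⟨rfl, h5⟩ := h4
      refine ⟨t, mem_filter.mpr ⟨mem_range.mpr ht, ?_⟩, ?_⟩
      · rw [Bool.not_not]; exact h5
      · rw [Bool.not_not]

end Assign

section Count

variable {U : Type*} [Fintype U] [DecidableEq U]

/-- The vertices on the side of `x` forming a covered pair with `x`. -/
def covIn (side : U → Bool) (P : Finset (Finset U)) (x : U) : Finset U :=
  univ.filter fun y => (y ≠ x ∧ side y = side x) ∧ ∃ T ∈ P, x ∈ T ∧ y ∈ T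

/-- The vertices on the other side forming a covered pair with `x`. -/
def covCr (side : U → Bool) (P : Finset (Finset U)) (x : U) : Finset U :=
  univ.filter fun y => side y ≠ side x ∧ ∃ T ∈ P, x ∈ T ∧ y ∈ T

/-- The triples inside one side. -/
def innerTriples (side : U → Bool) (P : Finset (Finset U)) : Finset (Finset U) :=
  P.filter fun T => ∀ x ∈ T, ∀ y ∈ T, side x = side y

lemma mem_innerTriples {side : U → Bool} {P : Finset (Finset U)} {T : Finset U} :
    T ∈ innerTriples side P ↔ T ∈ P ∧ ∀ x ∈ T, ∀ y ∈ T, side x = side y := by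
  rw [innerTriples, mem_filter]

/-- Any two triples share at most one vertex. -/
def Linear (P : Finset (Finset U)) : Prop :=
  ∀ x y, x ≠ y → ∀ e ∈ P, ∀ e' ∈ P, x ∈ e → y ∈ e → x ∈ e' → y ∈ e' → e = e'

lemma Linear.mono {P P' : Finset (Finset U)} (h : Linear P) (hs : P' ⊆ P) : Linear P' :=
  fun x y hxy e he e' he' => h x y hxy e (hs he) e' (hs he')

lemma card_covered {P : Finset (Finset U)} (hu : Linear P) (x : U) (p : U → Prop)
    [DecidablePred p] (hp : ¬ p x) :
    (univ.filter fun y => p y ∧ ∃ T ∈ P, x ∈ T ∧ y ∈ T).card =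
      ∑ T ∈ P with x ∈ T, (T.filter p).card := by
  rw [← card_biUnion]
  · congr 1
    ext y
    simp only [mem_filter, mem_univ, true_and, mem_biUnion]
    constructor
    · rintro ⟨h, T, hT, h1, h2⟩; exact ⟨T, ⟨hT, h1⟩, h2, h⟩
    · rintro ⟨T, ⟨hT, h1⟩, h2, h⟩; exact ⟨h, T, hT, h1, h2⟩
  · intro T hT T' hT' hne
    rw [mem_coe, mem_filter] at hT hT'
    change Disjoint _ _
    rw [disjoint_left]
    intro y hy hy'
    rw [mem_filter] at hy hy'
    refine hne (hu x y (fun h => hp (h ▸ hy.2)) T hT.1 T' hT'.1 hT.2 hy.1 hT'.2 hy'.1)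

lemma card_same_side (side : U → Bool) {T : Finset U} {x : U} (hx : x ∈ T) :
    (T.filter fun y => y ≠ x ∧ side y = side x).card + 1 =
      (T.filter fun y => side y = side x).card := by
  have : (T.filter fun y => y ≠ x ∧ side y = side x) =
      (T.filter fun y => side y = side x).erase x := by
    ext y
    simp only [mem_filter, mem_erase]
    tauto
  rw [this, card_erase_add_one (by simp [hx])]

lemma card_sides (side : U → Bool) (T : Finset U) (s : Bool) :
    (T.filter fun y => side y = s).card + (T.filter fun y => side y ≠ s).card = T.card :=
  card_filter_add_card_filter_not _

lemma sum_same_side (side : U → Bool) (T : Finset U) (s : Bool) :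
    ∑ x ∈ T with side x = s, ((T.filter fun y => y ≠ x ∧ side y = side x).card : ℤ) =
      ((T.filter fun y => side y = s).card : ℤ) * ((T.filter fun y => side y = s).card - 1) := by
  rw [sum_congr rfl (g := fun _ => ((T.filter fun y => side y = s).card : ℤ) - 1), sum_const,
    nsmul_eq_mul]
  intro x hx
  rw [mem_filter] at hx
  have := card_same_side side hx.1
  rw [hx.2] at this ⊢
  rw [← this]
  push_cast
  ring

lemma sum_same_side' (side : U → Bool) {T : Finset U} (hT : T.card = 3) (s : Bool) :
    ∑ x ∈ T with side x ≠ s, ((T.filter fun y => y ≠ x ∧ side y = side x).card : ℤ) =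
      (3 - (T.filter fun y => side y = s).card : ℤ) *
        (2 - (T.filter fun y => side y = s).card) := by
  have h1 : (T.filter fun y => side y ≠ s) = T.filter fun y => side y = !s := by
    refine filter_congr fun y _ => ?_
    cases side y <;> cases s <;> simp
  have h2 := card_sides side T s
  rw [h1, sum_same_side]
  rw [h1, hT] at h2
  have h3 : ((T.filter fun y => side y = !s).card : ℤ) =
      3 - (T.filter fun y => side y = s).card := by omega
  rw [h3]
  ring

lemma inner_iff (side : U → Bool) {T : Finset U} (hT : T.card = 3) (s : Bool) :
    (∀ x ∈ T, ∀ y ∈ T, side x = side y) ↔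
      (T.filter fun y => side y = s).card = 0 ∨ (T.filter fun y => side y = s).card = 3 := by
  constructor
  · intro h
    by_cases h0 : (T.filter fun y => side y = s).card = 0
    · exact Or.inl h0
    · right
      obtain ⟨x, hx⟩ := card_ne_zero.mp h0
      rw [mem_filter] at hx
      rw [filter_true_of_mem, hT]
      intro y hy
      rw [h y hy x hx.1, hx.2]
  · rintro (h | h) x hx y hy
    · rw [card_eq_zero, filter_eq_empty_iff] at h
      have h1 := h hx
      have h2 := h hy
      revert h1 h2
      cases side x <;> cases side y <;> cases s <;> simp
    · have h1 : (T.filter fun y => side y = s) = T :=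
        eq_of_subset_of_card_le (filter_subset _ _) (by rw [h, hT])
      rw [filter_eq_self] at h1
      rw [h1 x hx, h1 y hy]

lemma triple_identity (side : U → Bool) {T : Finset U} (hT : T.card = 3) (s : Bool) :
    2 * ((T.filter fun y => side y = s).card : ℤ) +
      6 * (if ∀ x ∈ T, ∀ y ∈ T, side x = side y then 1 else 0) =
      2 * ∑ x ∈ T with side x = s, ((T.filter fun y => y ≠ x ∧ side y = side x).card : ℤ) +
        ∑ x ∈ T with side x ≠ s, ((T.filter fun y => y ≠ x ∧ side y = side x).card : ℤ) := by
  rw [sum_same_side, sum_same_side' side hT]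
  have h := inner_iff side hT s
  have h3 : (T.filter fun y => side y = s).card ≤ 3 := hT ▸ card_le_card (filter_subset _ _)
  generalize (T.filter fun y => side y = s).card = a at h h3 ⊢
  simp only [h]
  interval_cases a <;> norm_num

lemma sum_incident {R : Type*} [AddCommMonoid R] (P : Finset (Finset U)) (S : Finset U)
    (f : U → Finset U → R) :
    ∑ x ∈ S, ∑ T ∈ P with x ∈ T, f x T = ∑ T ∈ P, ∑ x ∈ S.filter (· ∈ T), f x T := by
  rw [sum_comm' (t' := P) (s' := fun T => S.filter (· ∈ T))]
  intro x y
  simp only [mem_filter]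
  tauto

lemma card_covIn {P : Finset (Finset U)} (hu : Linear P) (side : U → Bool) (x : U) :
    (covIn side P x).card =
      ∑ T ∈ P with x ∈ T, (T.filter fun y => y ≠ x ∧ side y = side x).card :=
  card_covered hu x (fun y => y ≠ x ∧ side y = side x) (by simp)

lemma card_covCr {P : Finset (Finset U)} (hu : Linear P) (side : U → Bool) (x : U) :
    (covCr side P x).card = ∑ T ∈ P with x ∈ T, (T.filter fun y => side y ≠ side x).card :=
  card_covered hu x (fun y => side y ≠ side x) (by simp)

lemma covIn_add_covCr {P : Finset (Finset U)} (hc : ∀ e ∈ P, e.card = 3) (hu : Linear P)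
    (side : U → Bool) (x : U) :
    (covIn side P x).card + (covCr side P x).card = 2 * (P.filter fun T => x ∈ T).card := by
  rw [card_covIn hu, card_covCr hu, ← sum_add_distrib, sum_congr rfl (g := fun _ => 2),
    sum_const, smul_eq_mul, mul_comm]
  intro T hT
  rw [mem_filter] at hT
  have h1 := card_same_side side hT.2
  have h2 := card_sides side T (side x)
  rw [hc T hT.1] at h2
  omega

/-- Counting the incidences of one side with the triples. -/
lemma side_identity {P : Finset (Finset U)} (hc : ∀ e ∈ P, e.card = 3) (hu : Linear P)
    (side : U → Bool) (s : Bool) :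
    2 * ∑ x with side x = s, ((P.filter fun T => x ∈ T).card : ℤ) +
      6 * (innerTriples side P).card =
      2 * ∑ x with side x = s, ((covIn side P x).card : ℤ) +
        ∑ x with side x ≠ s, ((covIn side P x).card : ℤ) := by
  have e1 : ∀ S : Finset U, ∑ x ∈ S, ((covIn side P x).card : ℤ) = ∑ T ∈ P,
      ∑ x ∈ S.filter (· ∈ T), ((T.filter fun y => y ≠ x ∧ side y = side x).card : ℤ) := by
    intro S
    rw [← sum_incident]
    refine sum_congr rfl fun x _ => ?_
    rw [card_covIn hu]
    push_cast
    rfl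
  have e2 : ∑ x with side x = s, ((P.filter fun T => x ∈ T).card : ℤ) =
      ∑ T ∈ P, ((T.filter fun y => side y = s).card : ℤ) := by
    have : ∑ x with side x = s, ((P.filter fun T => x ∈ T).card : ℤ) =
        ∑ x with side x = s, ∑ T ∈ P with x ∈ T, (1 : ℤ) :=
      sum_congr rfl fun x _ => by simp
    rw [this, sum_incident]
    refine sum_congr rfl fun T _ => ?_
    rw [sum_const, nsmul_eq_mul, mul_one]
    congr 2
    ext x
    simp [and_comm]
  have e3 : ((innerTriples side P).card : ℤ) =
      ∑ T ∈ P, if ∀ x ∈ T, ∀ y ∈ T, side x = side y then (1 : ℤ) else 0 := by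
    rw [innerTriples, card_filter]
    push_cast
    rfl
  rw [e1, e1, e2, e3, mul_sum, mul_sum, mul_sum, ← sum_add_distrib, ← sum_add_distrib]
  refine sum_congr rfl fun T hT => ?_
  have f1 : ∀ q : U → Prop, ∀ _ : DecidablePred q, (univ.filter q).filter (· ∈ T) = T.filter q := by
    intro q _
    ext x
    simp [and_comm]
  rw [f1, f1]
  exact triple_identity side (hc T hT) s

/-- The number of inner triples in terms of covered pairs. -/
lemma innerTriples_identity {P : Finset (Finset U)} (hc : ∀ e ∈ P, e.card = 3) (hu : Linear P)
    (side : U → Bool) :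
    12 * ((innerTriples side P).card : ℤ) + ∑ x, ((covCr side P x).card : ℤ) =
      2 * ∑ x, ((covIn side P x).card : ℤ) := by
  have h1 := side_identity hc hu side true
  have h2 := side_identity hc hu side false
  have h3 : ∀ f : U → ℤ, ∑ x, f x = ∑ x with side x = true, f x + ∑ x with side x ≠ true, f x :=
    fun f => (sum_filter_add_sum_filter_not _ _ _).symm
  have h4 : (univ.filter fun x => side x ≠ true) = univ.filter fun x => side x = false := by
    refine filter_congr fun x _ => ?_
    cases side x <;> simp
  have h5 : (univ.filter fun x => side x ≠ false) = univ.filter fun x => side x = true := by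
    refine filter_congr fun x _ => ?_
    cases side x <;> simp
  have h6 : ∑ x, ((covCr side P x).card : ℤ) =
      2 * ∑ x, ((P.filter fun T => x ∈ T).card : ℤ) - ∑ x, ((covIn side P x).card : ℤ) := by
    rw [mul_sum, ← sum_sub_distrib]
    refine sum_congr rfl fun x _ => ?_
    have := covIn_add_covCr hc hu side x
    linarith
  rw [h6]
  rw [h3 fun x => ((covIn side P x).card : ℤ), h3 fun x => ((P.filter fun T => x ∈ T).card : ℤ)]
  rw [h4] at h1 ⊢
  rw [h5] at h2
  linarith

lemma card_pairs_at {F : Finset (Finset U)} (h2 : ∀ e ∈ F, e.card = 2) (x : U) :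
    (F.filter fun e => x ∈ e).card = (univ.filter fun y => y ≠ x ∧ ({x, y} : Finset U) ∈ F).card := by
  symm
  refine card_bij (fun y _ => {x, y}) ?_ ?_ ?_
  · intro y hy
    rw [mem_filter] at hy ⊢
    exact ⟨hy.2.2, by simp⟩
  · intro y hy y' hy' h
    rw [mem_filter] at hy hy'
    have h3 : y ∈ ({x, y'} : Finset U) := by rw [← h]; simp
    simp only [mem_insert, mem_singleton] at h3
    exact h3.resolve_left hy.2.1
  · intro e he
    rw [mem_filter] at he
    obtain ⟨y, hy, hyx⟩ : ∃ y ∈ e, y ≠ x := exists_mem_ne (by rw [h2 e he.1]; norm_num) x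
    have := eq_pair_of_card_two (h2 e he.1) he.2 hy hyx.symm
    exact ⟨y, mem_filter.mpr ⟨mem_univ _, hyx, this ▸ he.1⟩, this.symm⟩

/-- Degree sums of pairs on one side, when each pair has an apex on the other side. -/
lemma sum_degree_apex {F : Finset (Finset U)} (h2 : ∀ e ∈ F, e.card = 2) (side : U → Bool)
    {ap : Finset U → U} (hap : ∀ e ∈ F, ∀ x ∈ e, side (ap e) ≠ side x) (s : Bool) :
    ∑ x with side x ≠ s, (F.filter fun e => x ∈ e).card =
      2 * ∑ x with side x = s, (F.filter fun e => ap e = x).card := by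
  have e1 : ∑ x with side x ≠ s, (F.filter fun e => x ∈ e).card =
      ∑ e ∈ F, (e.filter fun x => side x ≠ s).card := by
    have := sum_card_bipartiteAbove_eq_sum_card_bipartiteBelow (s := univ.filter fun x => side x ≠ s)
      (t := F) (r := fun x e => x ∈ e)
    refine this.trans (sum_congr rfl fun e _ => ?_)
    congr 1
    ext x
    simp [bipartiteBelow, and_comm]
  have e2 : ∑ x with side x = s, (F.filter fun e => ap e = x).card =
      ∑ e ∈ F, if side (ap e) = s then 1 else 0 := by
    have := sum_card_bipartiteAbove_eq_sum_card_bipartiteBelow (s := univ.filter fun x => side x = s)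
      (t := F) (r := fun x e => ap e = x)
    refine this.trans (sum_congr rfl fun e _ => ?_)
    rw [bipartiteBelow, filter_filter]
    split_ifs with h
    · have : (univ.filter fun x => side x = s ∧ ap e = x) = {ap e} := by
        ext x
        simp only [mem_filter, mem_univ, true_and, mem_singleton]
        constructor
        · exact fun h => h.2.symm
        · rintro rfl
          exact ⟨h, rfl⟩
      rw [this, card_singleton]
    · rw [card_eq_zero, filter_eq_empty_iff]
      rintro x _ ⟨h1, rfl⟩
      exact h h1
  rw [e1, e2, mul_sum]
  refine sum_congr rfl fun e he => ?_
  split_ifs with h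
  · have h3 : (e.filter fun x => side x ≠ s) = e :=
      filter_true_of_mem fun x hx hxs => hap e he x hx (h.trans hxs.symm)
    simpa only [h3, mul_one] using h2 e he
  · rw [mul_zero, card_eq_zero, filter_eq_empty_iff]
    intro x hx hxs
    have h1 := hap e he x hx
    revert h h1 hxs
    cases side (ap e) <;> cases side x <;> cases s <;> simp

end Count

section Completion

variable {I k : ℕ} [NeZero I] [NeZero k]

/-- The graph whose triangles are used by the random packing. -/
def baseGraph (A : Finset (ZMod I)) (g : ℕ) : SimpleGraph (Vtx I k) where
  Adj x y := x ≠ y ∧ if x.1 = y.1 then ¬ QAdj g x y else off x y ∉ A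
  symm := ⟨by
    rintro x y ⟨h1, h2⟩
    refine ⟨h1.symm, ?_⟩
    split_ifs at h2 with h
    · rw [if_pos h.symm]
      exact fun h' => h2 h'.symm
    · rw [if_neg fun h' => h h'.symm, ← off_comm h]
      exact h2⟩
  loopless := ⟨fun x h => h.1 rfl⟩

instance (A : Finset (ZMod I)) (g : ℕ) : DecidableRel (baseGraph (k := k) A g).Adj := by
  intro x y
  unfold baseGraph
  infer_instance

lemma base_inner {A : Finset (ZMod I)} {g : ℕ} {x y : Vtx I k} (h : x.1 = y.1) :
    (baseGraph A g).Adj x y ↔ x ≠ y ∧ ¬ QAdj g x y := by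
  change (x ≠ y ∧ _) ↔ _
  rw [if_pos h]

lemma base_cross {A : Finset (ZMod I)} {g : ℕ} {x y : Vtx I k} (h : x.1 ≠ y.1) :
    (baseGraph A g).Adj x y ↔ off x y ∉ A := by
  change (x ≠ y ∧ _) ↔ _
  rw [if_neg h]
  exact and_iff_right fun heq => h (heq ▸ rfl)

/-- The uncovered neighbours of a vertex. -/
def leave (A : Finset (ZMod I)) (g : ℕ) (P : Finset (Finset (Vtx I k))) (x : Vtx I k) :
    Finset (Vtx I k) :=
  univ.filter fun y => (baseGraph A g).Adj x y ∧ ∀ T ∈ P, x ∈ T → y ∉ T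

/-- All pairs inside triples of `P` are edges of the base graph. -/
def InBase (A : Finset (ZMod I)) (g : ℕ) (P : Finset (Finset (Vtx I k))) : Prop :=
  ∀ T ∈ P, T.card = 3 ∧ ∀ x ∈ T, ∀ y ∈ T, x ≠ y → (baseGraph A g).Adj x y

lemma card_split {α : Type*} [DecidableEq α] (s : Finset α) (p q : α → Prop) [DecidablePred p]
    [DecidablePred q] (h : ∀ a ∈ s, p a → ¬ q a) :
    s.card = (s.filter p).card + (s.filter q).card + (s.filter fun a => ¬ p a ∧ ¬ q a).card := by
  rw [← card_union_of_disjoint, ← card_union_of_disjoint]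
  · congr 1
    ext a
    simp only [mem_union, mem_filter]
    tauto
  · rw [disjoint_left]
    intro a ha hb
    simp only [mem_union, mem_filter] at ha hb
    tauto
  · rw [disjoint_left]
    intro a ha hb
    simp only [mem_filter] at ha hb
    exact h a ha.1 ha.2 hb.2

lemma card_cov_leave_inner {A : Finset (ZMod I)} {g : ℕ} (hg : g ≤ k)
    {P : Finset (Finset (Vtx I k))} (hP : InBase A g P) (x : Vtx I k) :
    (covIn Prod.fst P x).card + ((leave A g P x).filter fun y => y.1 = x.1).card + g + 1 =
      2 * k * I := by
  have h1 := card_split (univ.filter fun y : Vtx I k => y.1 = x.1) (fun y => QAdj g x y)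
    (fun y => y = x) (fun y _ h h' => h.ne h'.symm)
  have h2 : ((univ.filter fun y : Vtx I k => y.1 = x.1).filter fun y => QAdj g x y).card = g := by
    refine Eq.trans ?_ (card_QAdj hg x)
    rw [filter_filter]
    congr 1
    ext y
    simp only [mem_filter, mem_univ, true_and]
    exact ⟨fun h => h.2, fun h => ⟨h.1.symm, h⟩⟩
  have h3 : ((univ.filter fun y : Vtx I k => y.1 = x.1).filter fun y => y = x).card = 1 := by
    rw [card_eq_one]
    refine ⟨x, ?_⟩
    ext y
    simp only [mem_filter, mem_univ, true_and, mem_singleton]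
    exact ⟨fun h => h.2, fun h => ⟨h ▸ rfl, h⟩⟩
  have h4 : ((univ.filter fun y : Vtx I k => y.1 = x.1).filter
      fun y => ¬ QAdj g x y ∧ ¬ y = x).card =
      (covIn Prod.fst P x).card + ((leave A g P x).filter fun y => y.1 = x.1).card := by
    rw [← card_union_of_disjoint]
    · congr 1
      ext y
      simp only [mem_union, mem_filter, mem_univ, true_and, covIn, leave]
      constructor
      · rintro ⟨a, b, c⟩
        by_cases h : ∃ T ∈ P, x ∈ T ∧ y ∈ T
        · exact Or.inl ⟨⟨c, a⟩, h⟩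
        · refine Or.inr ⟨⟨(base_inner a.symm).mpr ⟨fun h => c h.symm, b⟩, ?_⟩, a⟩
          exact fun T hT hx hy => h ⟨T, hT, hx, hy⟩
      · rintro (⟨⟨a, b⟩, T, hT, hx, hy⟩ | ⟨⟨a, b⟩, c⟩)
        · exact ⟨b, ((base_inner b.symm).mp ((hP T hT).2 x hx y hy a.symm)).2, a⟩
        · have := (base_inner c.symm).mp a
          exact ⟨c, this.2, this.1.symm⟩
    · rw [disjoint_left]
      intro y ha hb
      simp only [mem_filter, mem_univ, true_and, covIn, leave] at ha hb
      obtain ⟨_, T, hT, hx, hy⟩ := ha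
      exact hb.1.2 T hT hx hy
  rw [card_side, h2, h3, h4] at h1
  omega

lemma card_cov_leave_cross {A : Finset (ZMod I)} {g : ℕ}
    {P : Finset (Finset (Vtx I k))} (hP : InBase A g P) (x : Vtx I k) :
    (covCr Prod.fst P x).card + ((leave A g P x).filter fun y => ¬ y.1 = x.1).card +
      2 * k * A.card = 2 * k * I := by
  have h1 := card_split (univ.filter fun y : Vtx I k => y.1 = !x.1)
    (fun y => y.1 ≠ x.1 ∧ ∃ T ∈ P, x ∈ T ∧ y ∈ T)
    (fun y => x.1 ≠ y.1 ∧ off x y ∈ A) (by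
      rintro y _ ⟨a, T, hT, hx, hy⟩ ⟨b, c⟩
      exact (base_cross b).mp ((hP T hT).2 x hx y hy fun h => b (h ▸ rfl)) c)
  have hs : ∀ y : Vtx I k, y.1 = (!x.1) ↔ y.1 ≠ x.1 := by
    intro y
    cases y.1 <;> cases x.1 <;> simp
  have h2 : ((univ.filter fun y : Vtx I k => y.1 = !x.1).filter
      fun y => x.1 ≠ y.1 ∧ off x y ∈ A).card = 2 * k * A.card := by
    rw [← card_off A x, filter_filter]
    congr 1
    ext y
    simp only [mem_filter, mem_univ, true_and, hs]
    exact ⟨fun h => h.2, fun h => ⟨h.1.symm, h⟩⟩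
  have h3 : ((univ.filter fun y : Vtx I k => y.1 = !x.1).filter
      fun y => y.1 ≠ x.1 ∧ ∃ T ∈ P, x ∈ T ∧ y ∈ T) = covCr Prod.fst P x := by
    ext y
    simp only [mem_filter, mem_univ, true_and, hs, covCr]
    exact ⟨fun h => h.2, fun h => ⟨h.1, h⟩⟩
  have h4 : ((univ.filter fun y : Vtx I k => y.1 = !x.1).filter
      fun y => ¬ (y.1 ≠ x.1 ∧ ∃ T ∈ P, x ∈ T ∧ y ∈ T) ∧ ¬ (x.1 ≠ y.1 ∧ off x y ∈ A)) =
      (leave A g P x).filter fun y => ¬ y.1 = x.1 := by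
    ext y
    simp only [mem_filter, mem_univ, true_and, hs, leave]
    constructor
    · rintro ⟨a, b, c⟩
      refine ⟨⟨(base_cross a.symm).mpr fun h => c ⟨a.symm, h⟩, ?_⟩, a⟩
      exact fun T hT hx hy => b ⟨a, T, hT, hx, hy⟩
    · rintro ⟨⟨a, b⟩, c⟩
      refine ⟨c, ?_, fun h => (base_cross h.1).mp a h.2⟩
      rintro ⟨_, T, hT, hx, hy⟩
      exact b T hT hx hy
  rw [card_side, h2, h3, h4] at h1
  omega

lemma sum_const_side (s : Bool) (c : ℤ) :
    ∑ _x : Vtx I k with _x.1 = s, c = (2 * k * I : ℕ) * c := by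
  rw [sum_const, card_side, nsmul_eq_mul]

lemma card_leave_split {A : Finset (ZMod I)} {g : ℕ} (P : Finset (Finset (Vtx I k)))
    (x : Vtx I k) : ((leave A g P x).filter fun y => y.1 = x.1).card +
      ((leave A g P x).filter fun y => ¬ y.1 = x.1).card = (leave A g P x).card :=
  card_filter_add_card_filter_not _

/-- Removing a few inner triples adjusts the number of inner triples. -/
lemma exists_trimmed {A : Finset (ZMod I)} {g w e0 Ts Δ : ℕ} (hg : g ≤ k)
    {P : Finset (Finset (Vtx I k))} (hP : InBase A g P) (hu : Linear P)
    (hw : w + 2 * g + e0 = 2 * k * A.card)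
    (hTs : 6 * Ts + 2 * (2 * k * I) = 2 * k * I * (2 * k * I + w))
    (hlv : ∀ x, (leave A g P x).card ≤ Δ) (he0 : 0 < e0) (hΔ : 2 * Δ ≤ e0)
    (hw5 : 5 ≤ w) :
    ∃ X ⊆ innerTriples Prod.fst P, 4 * X.card ≤ 2 * k * I * e0 ∧
      (∀ x, (X.filter fun T => x ∈ T).card ≤ 9 * e0) ∧
      (innerTriples Prod.fst (P \ X)).card = Ts := by
  set h := 2 * k * I with hh
  have hid := innerTriples_identity (fun e he => (hP e he).1) hu Prod.fst
  have e1 : ∀ x : Vtx I k, 2 * ((covIn Prod.fst P x).card : ℤ) - ((covCr Prod.fst P x).card : ℤ) ≤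
      (h - 2 + w + e0 : ℤ) + Δ ∧ (h - 2 + w + e0 : ℤ) - 2 * Δ ≤
      2 * ((covIn Prod.fst P x).card : ℤ) - ((covCr Prod.fst P x).card : ℤ) := by
    intro x
    have a1 := card_cov_leave_inner hg hP x
    have a2 := card_cov_leave_cross hP x
    have a3 := card_leave_split (A := A) (g := g) P x
    have a4 := hlv x
    constructor <;> omega
  have hcardU : Fintype.card (Vtx I k) = 2 * h := by
    simp only [Fintype.card_prod, Fintype.card_bool, ZMod.card, hh]
    ring
  have e2 : 12 * ((innerTriples Prod.fst P).card : ℤ) = ∑ x : Vtx I k,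
      (2 * ((covIn Prod.fst P x).card : ℤ) - ((covCr Prod.fst P x).card : ℤ)) := by
    rw [sum_sub_distrib, ← mul_sum]
    linarith
  have e3 : 12 * ((innerTriples Prod.fst P).card : ℤ) ≤ 2 * h * ((h - 2 + w + e0 : ℤ) + Δ) := by
    rw [e2]
    refine (sum_le_card_nsmul _ _ _ fun x _ => (e1 x).1).trans (le_of_eq ?_)
    rw [card_univ, hcardU, nsmul_eq_mul]
    push_cast
    ring
  have e4 : 2 * h * ((h - 2 + w + e0 : ℤ) - 2 * Δ) ≤ 12 * ((innerTriples Prod.fst P).card : ℤ) := by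
    rw [e2]
    refine (le_of_eq ?_).trans (card_nsmul_le_sum _ _ _ fun x _ => (e1 x).2)
    rw [card_univ, hcardU, nsmul_eq_mul]
    push_cast
    ring
  have hTs' : 6 * (Ts : ℤ) = h * (h + w - 2) := by
    have : (6 * Ts + 2 * h : ℤ) = h * (h + w) := by exact_mod_cast hTs
    linarith
  have hΔ' : 2 * (Δ : ℤ) ≤ e0 := by exact_mod_cast hΔ
  have hh0 : 0 < h := by
    have := NeZero.pos k
    have := NeZero.pos I
    positivity
  have hm := mul_le_mul_of_nonneg_left hΔ' (by positivity : (0 : ℤ) ≤ h)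
  have hle : Ts ≤ (innerTriples Prod.fst P).card := by
    have : (12 * Ts : ℤ) ≤ 12 * ((innerTriples Prod.fst P).card : ℤ) := by linarith
    omega
  obtain ⟨q, hq⟩ := Nat.exists_eq_add_of_le hle
  have hq4 : 4 * q ≤ h * e0 := by
    have : ((innerTriples Prod.fst P).card : ℤ) = Ts + q := by exact_mod_cast hq
    rw [this] at e3
    have : (4 * q : ℤ) ≤ h * e0 := by linarith
    exact_mod_cast this
  have hdeg : ∀ x, ((innerTriples Prod.fst P).filter fun T => x ∈ T).card ≤ h := by
    intro x
    have a : ((innerTriples Prod.fst P).filter fun T => x ∈ T).card ≤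
        (P.filter fun T => x ∈ T).card :=
      card_le_card (filter_subset_filter _ fun T hT => (mem_innerTriples.mp hT).1)
    have a0 := covIn_add_covCr (fun e he => (hP e he).1) hu Prod.fst x
    have a1 := card_cov_leave_inner hg hP x
    have a2 := card_cov_leave_cross hP x
    rw [← hh] at a1 a2
    omega
  have hqd : q + 3 * q / (9 * e0) * h < (innerTriples Prod.fst P).card := by
    have b1 : 3 * q / (9 * e0) ≤ h / 12 := by
      refine (Nat.le_div_iff_mul_le (by norm_num)).mpr ?_
      have : 3 * q / (9 * e0) * (9 * e0) ≤ 3 * q := Nat.div_mul_le_self _ _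
      have : (3 * q / (9 * e0) * 12) * e0 ≤ h * e0 := by nlinarith only [this, hq4]
      exact Nat.le_of_mul_le_mul_right this he0
    have b2 := Nat.mul_le_mul_right h b1
    have b3 : 12 * (h / 12) ≤ h := Nat.mul_div_le _ _
    have b4 := Nat.mul_le_mul_right h b3
    have b5 : h * 5 ≤ h * w := Nat.mul_le_mul_left h hw5
    have b6 : h * (h + w) = h * h + h * w := by ring
    have b7 : 12 * (h / 12) * h = 12 * (h / 12 * h) := by ring
    rw [b7] at b4
    rw [hq]
    omega
  obtain ⟨X, hX, hXq, hXd⟩ := exists_subfamily (by omega : 0 < 9 * e0)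
    (fun T hT => (hP T (mem_innerTriples.mp hT).1).1) hdeg hqd
  refine ⟨X, hX, hXq ▸ hq4, hXd, ?_⟩
  have : innerTriples Prod.fst (P \ X) = innerTriples Prod.fst P \ X := by
    ext T
    simp only [mem_innerTriples, mem_sdiff]
    tauto
  rw [this, card_sdiff_of_subset hX, hXq, hq]
  omega

end Completion

section Completion

variable {I k : ℕ} [NeZero I] [NeZero k]

lemma card_of_mem_qSet {g : ℕ} {e : Finset (Vtx I k)} (he : e ∈ qSet I k g) : e.card = 2 := by
  obtain ⟨x, y, h, rfl⟩ := mem_qSet.mp he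
  exact card_pair h.ne

lemma pair_mem_qSet {g : ℕ} {x y : Vtx I k} : {x, y} ∈ qSet I k g ↔ QAdj g x y := by
  rw [mem_qSet]
  constructor
  · rintro ⟨a, b, h, h'⟩
    have hx : x ∈ ({a, b} : Finset (Vtx I k)) := h' ▸ mem_insert_self _ _
    have hy : y ∈ ({a, b} : Finset (Vtx I k)) := h' ▸ by simp
    have ha : a ∈ ({x, y} : Finset (Vtx I k)) := h' ▸ mem_insert_self _ _
    have hb : b ∈ ({x, y} : Finset (Vtx I k)) := h' ▸ by simp
    simp only [mem_insert, mem_singleton] at hx hy ha hb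
    have := h.ne
    have := h.symm
    rcases hx with rfl | rfl <;> rcases hy with rfl | rfl <;> simp_all
  · exact fun h => ⟨x, y, h, rfl⟩

lemma card_qSet_at {g : ℕ} (hg : g ≤ k) (x : Vtx I k) :
    ((qSet I k g).filter fun e => x ∈ e).card = g := by
  rw [card_pairs_at (fun e he => card_of_mem_qSet he)]
  refine Eq.trans ?_ (card_QAdj hg x)
  congr 1
  ext y
  simp only [mem_filter, mem_univ, true_and, pair_mem_qSet]
  exact ⟨fun h => h.2, fun h => ⟨h.ne.symm, h⟩⟩

lemma qSet_subset {A : Finset (ZMod I)} {g : ℕ} {P : Finset (Finset (Vtx I k))}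
    (hP : InBase A g P) : qSet I k g ⊆ innerUncovered Prod.fst P := by
  intro e he
  rw [mem_innerUncovered]
  refine ⟨card_of_mem_qSet he, ?_⟩
  obtain ⟨x, y, h, rfl⟩ := mem_qSet.mp he
  refine ⟨?_, ?_⟩
  · intro a ha b hb
    simp only [mem_insert, mem_singleton] at ha hb
    have := h.1
    rcases ha with rfl | rfl <;> rcases hb with rfl | rfl <;> simp_all
  · intro T hT hs
    exact ((base_inner h.1).mp ((hP T hT).2 x (hs (by simp)) y (hs (by simp)) h.ne)).2 h

lemma card_free_at {A : Finset (ZMod I)} {g : ℕ} (P : Finset (Finset (Vtx I k))) (x : Vtx I k) :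
    ((innerUncovered Prod.fst P \ qSet I k g).filter fun e => x ∈ e).card =
      ((leave A g P x).filter fun y => y.1 = x.1).card := by
  rw [card_pairs_at (fun e he => (mem_innerUncovered.mp (mem_sdiff.mp he).1).1)]
  congr 1
  ext y
  simp only [mem_filter, mem_univ, true_and, mem_sdiff, pair_mem_qSet, mem_innerUncovered, leave]
  constructor
  · rintro ⟨a, ⟨_, b, c⟩, d⟩
    have hs := b x (by simp) y (by simp)
    refine ⟨⟨(base_inner hs).mpr ⟨a.symm, d⟩, fun T hT hx hy => c T hT ?_⟩, hs.symm⟩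
    intro z hz
    simp only [mem_insert, mem_singleton] at hz
    rcases hz with rfl | rfl <;> assumption
  · rintro ⟨⟨a, b⟩, c⟩
    have h := (base_inner c.symm).mp a
    refine ⟨h.1.symm, ⟨card_pair h.1, ?_, ?_⟩, h.2⟩
    · intro u hu v hv
      simp only [mem_insert, mem_singleton] at hu hv
      rcases hu with rfl | rfl <;> rcases hv with rfl | rfl <;> simp_all
    · exact fun T hT hs => b T hT (hs (by simp)) (hs (by simp))

lemma two_mul_card_pairs {U : Type*} [Fintype U] [DecidableEq U] {F : Finset (Finset U)}
    (h2 : ∀ e ∈ F, e.card = 2) : 2 * F.card = ∑ x, (F.filter fun e => x ∈ e).card := by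
  have := sum_card_bipartiteAbove_eq_sum_card_bipartiteBelow (s := (univ : Finset U))
      (t := F) (r := fun x e => x ∈ e)
  refine Eq.symm (this.trans ?_)
  rw [sum_congr rfl (g := fun _ => 2), sum_const, smul_eq_mul, mul_comm]
  intro e he
  rw [← h2 e he]
  congr 1
  ext x
  simp [bipartiteBelow]

lemma card_vtx : Fintype.card (Vtx I k) = 2 * (2 * k * I) := by
  simp only [Fintype.card_prod, Fintype.card_bool, ZMod.card]
  ring

lemma card_pairs_le {F : Finset (Finset (Vtx I k))} (h2 : ∀ e ∈ F, e.card = 2) {d : ℕ}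
    (hd : ∀ x, (F.filter fun e => x ∈ e).card ≤ d) : F.card ≤ 2 * k * I * d := by
  have h := two_mul_card_pairs h2
  have h' := sum_le_card_nsmul (univ : Finset (Vtx I k)) _ _ fun x _ => hd x
  rw [card_univ, card_vtx, smul_eq_mul, ← h] at h'
  linarith

/-- The possible apexes of an inner pair. -/
def cand (A' : Finset (ZMod I)) (e : Finset (Vtx I k)) : Finset (Vtx I k) :=
  univ.filter fun z => ∀ x ∈ e, z.1 ≠ x.1 ∧ off x z ∈ A'

lemma le_card_cand {A' : Finset (ZMod I)} (hA' : ∀ d, ∃ a ∈ A', ∃ a' ∈ A', d = a - a')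
    {x y : Vtx I k} (hxy : x.1 = y.1) : 2 * k ≤ (cand A' {x, y}).card := by
  obtain ⟨a, ha, a', ha', hd⟩ := hA' (x.2.1 - y.2.1)
  have key : ∀ i : ZMod I, (∀ c : Bool × ZMod k, (!x.1, i, c) ∈ cand A' {x, y}) →
      2 * k ≤ (cand A' {x, y}).card := by
    intro i hi
    have : ((univ : Finset (Bool × ZMod k)).image fun c => ((!x.1, i, c) : Vtx I k)) ⊆
        cand A' {x, y} := by
      intro z hz
      obtain ⟨c, -, rfl⟩ := mem_image.mp hz
      exact hi c
    refine le_trans (le_of_eq ?_) (card_le_card this)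
    rw [card_image_of_injective, card_univ, Fintype.card_prod, Fintype.card_bool, ZMod.card]
    intro c c' h
    simpa using h
  obtain ⟨s, i, u⟩ := x
  obtain ⟨s', j, v⟩ := y
  simp only at hxy hd
  subst hxy
  cases s with
  | false =>
    refine key (a + j) fun c => ?_
    have : a + j - i = a' := by linear_combination -hd
    simp [cand, off, ha, this, ha']
  | true =>
    refine key (i - a) fun c => ?_
    have : j - (i - a) = a' := by linear_combination -hd
    simp [cand, off, ha, this, ha']

/-- Apexes for the free inner pairs. -/
lemma exists_free_apex {A A' : Finset (ZMod I)} (hA' : ∀ d, ∃ a ∈ A', ∃ a' ∈ A', d = a - a')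
    {g d : ℕ} {P : Finset (Finset (Vtx I k))}
    (hd : ∀ x, ((leave A g P x).filter fun y => y.1 = x.1).card ≤ d) (hd0 : 0 < d)
    (hk : 16 * (I ^ 2 * d) ≤ k) :
    ∃ ap : Finset (Vtx I k) → Vtx I k,
      (∀ e ∈ innerUncovered Prod.fst P \ qSet I k g, ap e ∈ cand A' e) ∧
      (∀ e ∈ innerUncovered Prod.fst P \ qSet I k g,
        ∀ e' ∈ innerUncovered Prod.fst P \ qSet I k g, e ≠ e' →
        (ap e = ap e' → Disjoint e e') ∧ ¬ (ap e ∈ e' ∧ ap e' ∈ e)) ∧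
      ∀ z, ((innerUncovered Prod.fst P \ qSet I k g).filter fun e => ap e = z).card ≤
        2 * I * d := by
  have hI := NeZero.pos I
  have hk0 := NeZero.pos k
  have h2 : ∀ e ∈ innerUncovered Prod.fst P \ qSet I k g, e.card = 2 := fun e he =>
    (mem_innerUncovered.mp (mem_sdiff.mp he).1).1
  have hd' : ∀ x, ((innerUncovered Prod.fst P \ qSet I k g).filter fun e => x ∈ e).card ≤ d :=
    fun x => (card_free_at (A := A) P x).trans_le (hd x)
  refine exists_apex (by positivity) h2 hd' ?_
  intro e he
  have hF := card_pairs_le h2 hd'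
  have h3 : (innerUncovered Prod.fst P \ qSet I k g).card / (2 * I * d) ≤ k := by
    refine Nat.div_le_of_le_mul ?_
    linarith
  have h4 : 2 * k ≤ (cand A' e).card := by
    obtain ⟨x, y, hxy, rfl⟩ := card_eq_two.mp (h2 e he)
    exact le_card_cand hA'
      ((mem_innerUncovered.mp (mem_sdiff.mp he).1).2.1 x (by simp) y (by simp))
  have h5 : d ≤ I * d := Nat.le_mul_of_pos_left d hI
  have h6 : I * d ≤ I ^ 2 * d := Nat.mul_le_mul_right d (Nat.le_self_pow (by norm_num) I)
  have h7 : 4 * (2 * I * d) = 8 * (I * d) := by ring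
  omega

end Completion

section Completion

variable {I k : ℕ} [NeZero I] [NeZero k]

/-- The loads of the reserved apexes add up correctly on each side. -/
lemma sum_loads {A : Finset (ZMod I)} {g w w' Ts : ℕ} (hg : g ≤ k)
    {P : Finset (Finset (Vtx I k))} (hP : InBase A g P) (hu : Linear P)
    (hw' : w = 2 * w' + 1)
    (hTs : 6 * Ts + 2 * (2 * k * I) = 2 * k * I * (2 * k * I + w))
    (hin : (innerTriples Prod.fst P).card = Ts)
    {ap : Finset (Vtx I k) → Vtx I k}
    (hap : ∀ e ∈ innerUncovered Prod.fst P \ qSet I k g, ∀ x ∈ e, (ap e).1 ≠ x.1)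
    {len : Vtx I k → ℕ}
    (hlen : ∀ x, (P.filter fun T => x ∈ T).card +
      ((leave A g P x).filter fun y => y.1 = x.1).card + g +
      ((innerUncovered Prod.fst P \ qSet I k g).filter fun e => ap e = x).card + len x + w' + 1 =
        2 * k * I) (s : Bool) :
    ∑ v, len (s, v) = I * (k * g) := by
  set h := 2 * k * I with hh
  set F := innerUncovered Prod.fst P \ qSet I k g with hF
  have h2 : ∀ e ∈ F, e.card = 2 := fun e he => (mem_innerUncovered.mp (mem_sdiff.mp he).1).1
  have e1 := side_identity (fun e he => (hP e he).1) hu Prod.fst s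
  have e2 := sum_degree_apex h2 Prod.fst hap s
  have e0 : ∑ v, len (s, v) = ∑ x with x.1 = s, len x := by
    have : (univ.filter fun x : Vtx I k => x.1 = s) =
        (univ : Finset (ZMod I × Bool × ZMod k)).image fun z => (s, z) := by
      ext ⟨a, b⟩
      simp [eq_comm]
    rw [this, sum_image]
    intro a _ b _ hab
    exact (Prod.mk.inj hab).2
  have hs : (univ.filter fun x : Vtx I k => x.1 ≠ s) = univ.filter fun x => x.1 = !s := by
    refine filter_congr fun x _ => ?_
    cases x.1 <;> cases s <;> simp
  have e3 : ∀ s' : Bool, ∑ x : Vtx I k with x.1 = s', ((covIn Prod.fst P x).card : ℤ) =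
      h * (h - g - 1) - ∑ x : Vtx I k with x.1 = s', ((F.filter fun e => x ∈ e).card : ℤ) := by
    intro s'
    rw [hh, ← sum_const_side, ← sum_sub_distrib]
    refine sum_congr rfl fun x _ => ?_
    have a1 := card_cov_leave_inner hg hP x
    have a2 := card_free_at (A := A) (g := g) P x
    rw [← hF] at a2
    rw [← a2] at a1
    omega
  have e4 : (∑ x : Vtx I k with x.1 = s, (len x : ℤ)) =
      h * (h - 1 - w' - g) - (∑ x : Vtx I k with x.1 = s, ((P.filter fun T => x ∈ T).card : ℤ)) -
        (∑ x : Vtx I k with x.1 = s, ((F.filter fun e => x ∈ e).card : ℤ)) -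
        ∑ x : Vtx I k with x.1 = s, ((F.filter fun e => ap e = x).card : ℤ) := by
    rw [hh, ← sum_const_side, ← sum_sub_distrib, ← sum_sub_distrib, ← sum_sub_distrib]
    refine sum_congr rfl fun x _ => ?_
    have a1 := hlen x
    have a2 := card_free_at (A := A) (g := g) P x
    rw [← hF] at a2
    rw [← a2] at a1
    omega
  rw [hs] at e1 e2
  rw [e3, e3, hin] at e1
  have e2' : ∑ x : Vtx I k with x.1 = !s, ((F.filter fun e => x ∈ e).card : ℤ) =
      2 * ∑ x : Vtx I k with x.1 = s, ((F.filter fun e => ap e = x).card : ℤ) := by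
    exact_mod_cast e2
  have hTs' : (6 * Ts + 2 * h : ℤ) = h * (h + w) := by exact_mod_cast hTs
  have hw'' : (w : ℤ) = 2 * w' + 1 := by exact_mod_cast hw'
  rw [e0]
  have hfin : 2 * (∑ x : Vtx I k with x.1 = s, (len x : ℤ)) = h * g := by
    rw [e4]
    rw [hw''] at hTs'
    linarith
  have h3 : (h : ℤ) * g = 2 * (I * (k * g)) := by
    rw [hh]
    push_cast
    ring
  have : ((∑ x : Vtx I k with x.1 = s, len x : ℕ) : ℤ) = (I * (k * g) : ℕ) := by
    push_cast
    linarith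
  exact_mod_cast this

/-- Completing a nearly perfect packing of triangles. -/
theorem exists_completion {A A' : Finset (ZMod I)}
    (hA' : ∀ d, ∃ a ∈ A', ∃ a' ∈ A', d = a - a') (hAA' : A' ⊆ A)
    (hq : ∀ s, qOff I s ⊆ A) (hA'q : ∀ s, Disjoint A' (qOff I s))
    (hqq : Disjoint (qOff I true) (qOff I false))
    {g w w' e0 Ts Δ d : ℕ} (hw : w + 2 * g + e0 = 2 * k * A.card) (hw' : w = 2 * w' + 1)
    (hTs : 6 * Ts + 2 * (2 * k * I) = 2 * k * I * (2 * k * I + w)) (hw5 : 5 ≤ w)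
    (he0 : 0 < e0) (hΔ : 2 * Δ ≤ e0) (hd : Δ + 18 * e0 ≤ d) (hdg : 8 * (I ^ 2 * d) ≤ g)
    (hgk : 2 * g ≤ k) {P0 : Finset (Finset (Vtx I k))} (hP0 : InBase A g P0) (hu : Linear P0)
    (hlv : ∀ x, (leave A g P0 x).card ≤ Δ) :
    ∃ P : Finset (Finset (Vtx I k)), (∀ e ∈ P, e.card = 3) ∧ Linear P ∧
      (∀ x y : Vtx I k, x ≠ y → x.1 = y.1 → ∃ e ∈ P, x ∈ e ∧ y ∈ e) ∧
      (∀ x, 2 * (P.filter fun e => x ∈ e).card + w + 1 = 2 * (2 * k * I)) ∧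
      (P \ P0).card ≤ 2 * (2 * k * I * g) ∧ (P0 \ P).card ≤ 2 * (2 * k * I * g) := by
  have hI := NeZero.pos I
  have hd0 : 0 < d := by omega
  have h5 : d ≤ I * d := Nat.le_mul_of_pos_left d hI
  have h6 : I * d ≤ I ^ 2 * d := Nat.mul_le_mul_right d (Nat.le_self_pow (by norm_num) I)
  have hg : g ≤ k := by omega
  have hg0 : 0 < g := by omega
  obtain ⟨X, hX, hXc, hXd, hXT⟩ := exists_trimmed hg hP0 hu hw hTs hlv he0 hΔ hw5
  set P := P0 \ X with hPdef
  have hP : InBase A g P := fun T hT => hP0 T (mem_sdiff.mp hT).1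
  have huP : Linear P := hu.mono sdiff_subset
  have hXP : X ⊆ P0 := fun T hT => (mem_innerTriples.mp (hX hT)).1
  have hdeg : ∀ x, (P0.filter fun T => x ∈ T).card =
      (P.filter fun T => x ∈ T).card + (X.filter fun T => x ∈ T).card := by
    intro x
    rw [← card_union_of_disjoint, ← filter_union, hPdef, sdiff_union_of_subset hXP]
    exact disjoint_filter_filter sdiff_disjoint
  have hcr : ∀ x, (covCr Prod.fst P x).card ≤ (covCr Prod.fst P0 x).card := by
    intro x
    refine card_le_card fun y hy => ?_
    simp only [covCr, mem_filter, mem_univ, true_and] at hy ⊢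
    obtain ⟨a, T, hT, b⟩ := hy
    exact ⟨a, T, (mem_sdiff.mp hT).1, b⟩
  have hc0 : ∀ e ∈ P0, e.card = 3 := fun e he => (hP0 e he).1
  have hc : ∀ e ∈ P, e.card = 3 := fun e he => (hP e he).1
  have hfree : ∀ x, ((leave A g P x).filter fun y => y.1 = x.1).card ≤ d := by
    intro x
    have a1 := card_cov_leave_inner hg hP0 x
    have a2 := card_cov_leave_inner hg hP x
    have a3 := covIn_add_covCr hc0 hu Prod.fst x
    have a4 := covIn_add_covCr hc huP Prod.fst x
    have a5 := hcr x
    have a6 := hdeg x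
    have a7 := hXd x
    have a8 := hlv x
    have a9 := card_leave_split (A := A) (g := g) P0 x
    omega
  obtain ⟨apF, f1, f2, f3⟩ := exists_free_apex hA' hfree hd0 (by omega)
  set F := innerUncovered Prod.fst P \ qSet I k g with hF
  have f0 : ∀ e ∈ F, ∀ x ∈ e, (apF e).1 ≠ x.1 ∧ off x (apF e) ∈ A' := fun e he x hx => by
    have := f1 e he
    rw [cand, mem_filter] at this
    exact this.2 x hx
  have hnum : ∀ x, ∃ l : ℕ, (P.filter fun T => x ∈ T).card +
      ((leave A g P x).filter fun y => y.1 = x.1).card + g +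
      (F.filter fun e => apF e = x).card + l + w' + 1 = 2 * k * I ∧
      g ≤ 2 * l + 8 * (I * d) ∧ 2 * l ≤ g + 8 * (I * d) := by
    intro x
    refine ⟨2 * k * I - ((P.filter fun T => x ∈ T).card +
      ((leave A g P x).filter fun y => y.1 = x.1).card + g +
      (F.filter fun e => apF e = x).card + w' + 1), ?_⟩
    have a1 := card_cov_leave_inner hg hP0 x
    have a2 := card_cov_leave_cross hP0 x
    have a3 := covIn_add_covCr hc0 hu Prod.fst x
    have a6 := hdeg x
    have a7 := hXd x
    have a8 := hlv x
    have a9 := card_leave_split (A := A) (g := g) P0 x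
    have a10 := hfree x
    have a11 : (F.filter fun e => apF e = x).card ≤ 2 * (I * d) := (f3 x).trans_eq (by ring)
    refine ⟨?_, ?_, ?_⟩ <;> omega
  choose len hlen hl1 hl2 using hnum
  have hsum := sum_loads hg hP huP hw' hTs hXT (fun e he x hx => (f0 e he x hx).1) hlen
  obtain ⟨apQ, q1, q2, q3⟩ := exists_qapex hg0 len hsum hl1 hl2
    (by
      have : I * (2 * k) * (8 * (I * d)) = 2 * k * (8 * (I ^ 2 * d)) := by ring
      rw [this, mul_assoc]
      exact Nat.mul_le_mul_left 2 (Nat.mul_le_mul_left k hdg)) (by omega) hg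
  set ap : Finset (Vtx I k) → Vtx I k := fun e => if e ∈ qSet I k g then apQ e else apF e with hap
  have apq : ∀ e ∈ qSet I k g, ap e = apQ e := fun e he => if_pos he
  have apf : ∀ e ∈ F, ap e = apF e := fun e he => if_neg (mem_sdiff.mp he).2
  have hsub := qSet_subset hP
  have hcase : ∀ e ∈ innerUncovered Prod.fst P, e ∈ qSet I k g ∨ e ∈ F := by
    intro e he
    by_cases h : e ∈ qSet I k g
    · exact Or.inl h
    · exact Or.inr (mem_sdiff.mpr ⟨he, h⟩)
  have h1 : ∀ e ∈ innerUncovered Prod.fst P, ∀ x ∈ e, (ap e).1 ≠ x.1 ∧ off x (ap e) ∈ A := by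
    intro e he x hx
    rcases hcase e he with h | h
    · rw [apq e h]
      exact ⟨(q1 e h x hx).1, hq _ (q1 e h x hx).2⟩
    · rw [apf e h]
      exact ⟨(f0 e h x hx).1, hAA' (f0 e h x hx).2⟩
  have hmix : ∀ e ∈ F, ∀ e' ∈ qSet I k g,
      (apF e = apQ e' → Disjoint e e') ∧ ¬ (apF e ∈ e' ∧ apQ e' ∈ e) := by
    intro e he e' he'
    constructor
    · intro h
      rw [disjoint_left]
      intro x hx hx'
      have b1 := (f0 e he x hx).2
      rw [h] at b1
      exact disjoint_left.mp (hA'q _) b1 (q1 e' he' x hx').2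
    · rintro ⟨hx, hx'⟩
      have b1 := f0 e he _ hx'
      have b2 := (q1 e' he' _ hx).2
      rw [off_comm b1.1] at b2
      exact disjoint_left.mp (hA'q _) b1.2 b2
  obtain ⟨r1, r2, r3, r4⟩ := packing_with_apexes Prod.fst hc huP
    (fun e he x hx => (h1 e he x hx).1)
    (by
      intro e he x hx T hT hapT hxT
      have b := h1 e he x hx
      exact (base_cross b.1.symm).mp
        ((hP T hT).2 x hxT _ hapT fun h => b.1 (h ▸ rfl)) b.2)
    (by
      intro e he e' he' hne
      rcases hcase e he with h | h <;> rcases hcase e' he' with h' | h'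
      · rw [apq e h, apq e' h']
        refine ⟨q2 e h e' h' hne, ?_⟩
        rintro ⟨hx, hx'⟩
        have b1 := q1 e h _ hx'
        have b2 := q1 e' h' _ hx
        rw [off_comm b1.1] at b2
        have b3 := b1.1
        have b4 := b1.2
        have b5 := b2.2
        revert b3 b4 b5
        cases (apQ e).1 <;> cases (apQ e').1
        · exact fun b => absurd rfl b
        · exact fun _ b b' => disjoint_left.mp hqq b' b
        · exact fun _ b b' => disjoint_left.mp hqq b b'
        · exact fun b => absurd rfl b
      · rw [apq e h, apf e' h']
        obtain ⟨b1, b2⟩ := hmix e' h' e h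
        exact ⟨fun h => (b1 h.symm).symm, fun h => b2 ⟨h.2, h.1⟩⟩
      · rw [apf e h, apq e' h']
        exact hmix e h e' h'
      · rw [apf e h, apf e' h']
        exact f2 e h e' h' hne)
  refine ⟨_, r1, r2, r3, ?_, ?_, ?_⟩
  · intro x
    have hun : innerUncovered Prod.fst P = F ∪ qSet I k g := (sdiff_union_of_subset hsub).symm
    have hdis : Disjoint F (qSet I k g) := sdiff_disjoint
    have c1 : ((innerUncovered Prod.fst P).filter fun e => x ∈ e).card =
        ((leave A g P x).filter fun y => y.1 = x.1).card + g := by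
      rw [hun, filter_union, card_union_of_disjoint (disjoint_filter_filter hdis),
        card_qSet_at hg, hF, card_free_at (A := A)]
    have c2 : ((innerUncovered Prod.fst P).filter fun e => ap e = x).card =
        (F.filter fun e => apF e = x).card + len x := by
      rw [hun, filter_union, card_union_of_disjoint (disjoint_filter_filter hdis), ← q3 x]
      congr 2
      · exact filter_congr fun e he => by rw [apf e he]
      · exact filter_congr fun e he => by rw [apq e he]
    have c3 := r4 x
    rw [c1, c2] at c3
    have c4 := hlen x
    have c5 : ∀ a b : ℕ, a = b → b + ((leave A g P x).filter fun y => y.1 = x.1).card + g +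
        (F.filter fun e => apF e = x).card + len x + w' + 1 = 2 * k * I →
        2 * (a + (((leave A g P x).filter fun y => y.1 = x.1).card + g) +
          ((F.filter fun e => apF e = x).card + len x)) + w + 1 = 2 * (2 * k * I) := by
      intro a b
      omega
    rw [c3]
    exact c5 _ _ rfl c4
  · have c1 : (innerUncovered Prod.fst P).card ≤ F.card + (qSet I k g).card := by
      rw [← sdiff_union_of_subset hsub]
      exact card_union_le _ _
    have c2 : F.card ≤ 2 * k * I * g :=
      card_pairs_le (fun e he => (mem_innerUncovered.mp (mem_sdiff.mp he).1).1) fun x =>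
        ((card_free_at (A := A) P x).trans_le (hfree x)).trans (by omega)
    have c3 : (qSet I k g).card ≤ 2 * k * I * g :=
      card_pairs_le (fun e he => card_of_mem_qSet he) fun x => (card_qSet_at hg x).le
    refine (card_le_card (t := (innerUncovered Prod.fst P).image fun e => insert (ap e) e) ?_).trans
      (card_image_le.trans (by omega))
    intro T hT
    rw [mem_sdiff, mem_union] at hT
    exact hT.1.resolve_left fun h => hT.2 (mem_sdiff.mp h).1
  · refine (card_le_card (t := X) ?_).trans ?_
    · intro T hT
      rw [mem_sdiff, mem_union] at hT
      by_contra h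
      exact hT.2 (Or.inl (mem_sdiff.mpr ⟨hT.1, h⟩))
    · have : 2 * k * I * e0 ≤ 2 * k * I * g := Nat.mul_le_mul_left _ (by omega)
      omega

end Completion

section Fibre

lemma card_small_subsets {α : Type*} [DecidableEq α] (S : Finset α) (t : ℕ) :
    (S.powerset.filter fun s => s.card ≤ t).card ≤ (S.card + 1) ^ t := by
  induction t with
  | zero =>
    rw [pow_zero, card_le_one]
    intro a ha b hb
    simp only [mem_filter, Nat.le_zero, card_eq_zero] at ha hb
    rw [ha.2, hb.2]
  | succ t ih =>
    have : (S.powerset.filter fun s => s.card ≤ t + 1) ⊆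
        ((insertNone S) ×ˢ (S.powerset.filter fun s => s.card ≤ t)).image
          fun p => p.1.elim p.2 fun x => insert x p.2 := by
      intro s hs
      rw [mem_filter, mem_powerset] at hs
      rw [mem_image]
      by_cases h : s.card ≤ t
      · refine ⟨(none, s), ?_, rfl⟩
        simp [hs.1, h]
      · obtain ⟨x, hx⟩ : s.Nonempty := by
          rw [← card_pos]
          omega
        refine ⟨(some x, s.erase x), ?_, insert_erase hx⟩
        rw [mem_product, mem_filter, mem_powerset, card_erase_of_mem hx]
        refine ⟨?_, (erase_subset x s).trans hs.1, ?_⟩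
        · simp [hs.1 hx]
        · omega
    refine (card_le_card this).trans (card_image_le.trans ?_)
    rw [card_product, card_insertNone, pow_succ, mul_comm]
    exact Nat.mul_le_mul_right _ ih

open Classical in
/-- The Steiner triple systems on `Fin n`. -/
noncomputable def allSTS (n : ℕ) : Finset (Finset (Finset (Fin n))) := univ.filter IsSTS

lemma mem_allSTS {n : ℕ} {E : Finset (Finset (Fin n))} : E ∈ allSTS n ↔ IsSTS E := by
  simp [allSTS]

lemma card_le_of_completions {U : Type*} [Fintype U] [DecidableEq U] {n t : ℕ}
    {𝒬 : Finset (Finset (Finset U))} (h3 : ∀ P₀ ∈ 𝒬, ∀ T ∈ P₀, T.card = 3) (f : U ↪ Fin n)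
    (hf : ∀ P₀ ∈ 𝒬, ∃ P : Finset (Finset U), ∃ E : Finset (Finset (Fin n)),
      (∀ T ∈ P, T.card = 3) ∧ IsSTS E ∧ (∀ T, T.map f ∈ E ↔ T ∈ P) ∧
      (P \ P₀).card ≤ t ∧ (P₀ \ P).card ≤ t) :
    𝒬.card ≤ (allSTS n).card * ((Fintype.card U ^ 3 + 1) ^ t * (Fintype.card U ^ 3 + 1) ^ t) := by
  classical
  choose! P E hP hE hPE h1 h2 using hf
  set D := ((univ : Finset U).powersetCard 3).powerset.filter fun s => s.card ≤ t with hD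
  have hDc : D.card ≤ (Fintype.card U ^ 3 + 1) ^ t := by
    refine (card_small_subsets _ t).trans (Nat.pow_le_pow_left ?_ t)
    rw [card_powersetCard, card_univ]
    exact Nat.add_le_add_right (Nat.choose_le_pow _ _) 1
  refine le_trans ?_ (Nat.mul_le_mul_left _ (Nat.mul_le_mul hDc hDc))
  rw [← card_product, ← card_product]
  refine card_le_card_of_injOn (fun P₀ => (E P₀, P P₀ \ P₀, P₀ \ P P₀)) ?_ ?_
  · intro P₀ h₀
    have h₀' : P₀ ∈ 𝒬 := h₀
    rw [mem_coe, mem_product, mem_product, hD, mem_filter, mem_filter, mem_powerset, mem_powerset]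
    refine ⟨mem_allSTS.mpr (hE P₀ h₀'), ⟨?_, h1 P₀ h₀'⟩, ?_, h2 P₀ h₀'⟩
    · intro T hT
      exact mem_powersetCard.mpr ⟨subset_univ _, hP P₀ h₀' T (mem_sdiff.mp hT).1⟩
    · intro T hT
      exact mem_powersetCard.mpr ⟨subset_univ _, h3 P₀ h₀' T (mem_sdiff.mp hT).1⟩
  · intro P₀ h₀ P₁ h₁ heq
    have h₀' : P₀ ∈ 𝒬 := h₀
    have h₁' : P₁ ∈ 𝒬 := h₁
    simp only [Prod.mk.injEq] at heq
    obtain ⟨a, b, c⟩ := heq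
    have hPP : P P₀ = P P₁ := by
      ext T
      rw [← hPE P₀ h₀', ← hPE P₁ h₁', a]
    ext T
    have b' := Finset.ext_iff.mp b T
    have c' := Finset.ext_iff.mp c T
    have p' := Finset.ext_iff.mp hPP T
    simp only [mem_sdiff] at b' c'
    tauto

/-- A good packing extends to a Steiner triple system. -/
lemma exists_isSTS_extension {U : Type*} [Fintype U] [DecidableEq U] {n w : ℕ}
    (hn : Fintype.card U + w = n) (hw : w % 6 = 3) :
    ∃ f : U ↪ Fin n, ∀ (side : U → Bool) (P : Finset (Finset U)),
      (∀ e ∈ P, e.card = 3) → Linear P →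
      (∀ x y, x ≠ y → side x = side y → ∃ e ∈ P, x ∈ e ∧ y ∈ e) →
      (∀ x, 2 * (P.filter fun e => x ∈ e).card + w + 1 = Fintype.card U) →
      ∃ E : Finset (Finset (Fin n)), IsSTS E ∧ ∀ T, T.map f ∈ E ↔ T ∈ P := by
  have hc : Fintype.card (U ⊕ Fin w) = Fintype.card (Fin n) := by simp [hn]
  set φ : U ⊕ Fin w ≃ Fin n := Fintype.equivOfCardEq hc
  obtain ⟨SW, hSW⟩ := exists_isSTS_bose (W := Fin w) (by simpa using hw)
  refine ⟨Function.Embedding.inl.trans φ.toEmbedding, fun side P h3 hu hin hdeg => ?_⟩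
  obtain ⟨E, hE, hEP⟩ := exists_isSTS_of_packing side h3 hu hin (by simpa using hdeg) hSW
  refine ⟨_, isSTS_map φ hE, fun T => ?_⟩
  rw [← hEP, ← map_map]
  exact mem_map' (Finset.mapEmbedding φ.toEmbedding).toEmbedding

end Fibre

section Product

lemma cast_descFactorial {M m : ℕ} (hm : m ≤ M) :
    ((M.descFactorial m : ℕ) : ℝ) = ∏ k ∈ range m, ((M : ℝ) - k) := by
  rw [Nat.descFactorial_eq_prod_range, Nat.cast_prod]
  refine prod_congr rfl fun k hk => ?_
  rw [Nat.cast_sub ((mem_range.mp hk).le.trans hm)]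

lemma exp_neg_le_prod {M m : ℕ} (hM : 0 < M) (hm : m ≤ M) :
    Real.exp (-M) ≤ ∏ k ∈ range m, ((M : ℝ) - k) / M := by
  have h1 : ∏ k ∈ range M, ((M : ℝ) - k) / M ≤ ∏ k ∈ range m, ((M : ℝ) - k) / M := by
    have hM' : (0 : ℝ) < M := by exact_mod_cast hM
    refine Finset.prod_le_prod_of_subset_of_le_one (range_subset_range.mpr hm) ?_ ?_
    · intro i hi
      have : (i : ℝ) < M := by exact_mod_cast (mem_range.mp hi)
      exact div_nonneg (by linarith) hM'.le
    · intro i hi _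
      rw [div_le_one hM']
      linarith [(i.cast_nonneg : (0 : ℝ) ≤ i)]
  refine le_trans ?_ h1
  have h2 : ∏ k ∈ range M, ((M : ℝ) - k) / M = M.factorial / M ^ M := by
    rw [prod_div_distrib, prod_const, card_range]
    congr 1
    rw [← Nat.descFactorial_self, cast_descFactorial le_rfl]
  rw [h2, Real.exp_neg]
  have h3 := Real.pow_div_factorial_le_exp (M : ℝ) (by positivity) M
  have hM' : (0 : ℝ) < M := by exact_mod_cast hM
  rw [inv_le_comm₀ (Real.exp_pos _) (by positivity), inv_div]
  exact h3

lemma prod_ge {M m : ℕ} (hM : 0 < M) (hm : m ≤ M) {N δ₀ pm ω : ℝ} (hN : 3 * (M : ℝ) ≤ N)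
    (hpm : pm = 1 - 3 * (m : ℝ) / N) (hpm0 : 0 < pm) (hδ0 : 0 < δ₀) (hδpm : δ₀ ≤ pm ^ 14)
    (hω : 0 < ω) :
    m.factorial * (((1 - δ₀ / pm ^ 14) / ω) ^ m * Real.exp (-(2 * M))) ≤
      ∏ k ∈ range m, (N * (1 - 3 * (k : ℝ) / N) *
      ((1 - 3 * (k : ℝ) / N) ^ 2 - δ₀ / (1 - 3 * (k : ℝ) / N) ^ 12) / (3 * ω)) := by
  have hM' : (0 : ℝ) < M := by exact_mod_cast hM
  have hN0 : 0 < N := by linarith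
  set c := (1 - δ₀ / pm ^ 14) / ω with hc
  have hc0 : 0 ≤ c := by
    refine div_nonneg ?_ hω.le
    rw [sub_nonneg, div_le_one (by positivity)]
    exact hδpm
  have hfac : ∀ k ∈ range m, c * (((M : ℝ) - k) * ((((M : ℝ) - k) / M) * (((M : ℝ) - k) / M))) ≤
      N * (1 - 3 * (k : ℝ) / N) *
      ((1 - 3 * (k : ℝ) / N) ^ 2 - δ₀ / (1 - 3 * (k : ℝ) / N) ^ 12) / (3 * ω) := by
    intro k hk
    have hkm : (k : ℝ) ≤ m := by exact_mod_cast (mem_range.mp hk).le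
    have hkM : (k : ℝ) ≤ M := hkm.trans (by exact_mod_cast hm)
    set p := 1 - 3 * (k : ℝ) / N with hp
    have hpp : pm ≤ p := by
      rw [hpm, hp]
      gcongr
    have hp0 : 0 < p := hpm0.trans_le hpp
    set q := ((M : ℝ) - k) / M with hq
    have hq0 : 0 ≤ q := div_nonneg (by linarith) hM'.le
    have hqp : q ≤ p := by
      rw [hq, hp, sub_div, div_self hM'.ne']
      have : 3 * (k : ℝ) / N ≤ k / M := by
        rw [div_le_div_iff₀ hN0 hM']
        nlinarith only [hN, (k.cast_nonneg : (0 : ℝ) ≤ k)]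
      linarith
    have e1 : (M : ℝ) - k = M * q := by
      rw [hq]
      field_simp
    have e2 : N * p * (p ^ 2 - δ₀ / p ^ 12) / (3 * ω) =
        (N / 3) * (p ^ 3 * ((1 - δ₀ / p ^ 14) / ω)) := by
      field_simp
    rw [e1, e2, hc]
    have e3 : (1 - δ₀ / pm ^ 14) / ω ≤ (1 - δ₀ / p ^ 14) / ω := by gcongr
    have e4 : (M : ℝ) ≤ N / 3 := by linarith
    have e5 : q ^ 3 ≤ p ^ 3 := by gcongr
    calc (1 - δ₀ / pm ^ 14) / ω * (M * q * (q * q)) = M * (q ^ 3 * c) := by rw [hc]; ring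
      _ ≤ N / 3 * (p ^ 3 * ((1 - δ₀ / p ^ 14) / ω)) := by gcongr
  refine le_trans ?_ (prod_le_prod ?_ hfac)
  · rw [prod_mul_distrib, prod_mul_distrib, prod_mul_distrib, prod_const, card_range]
    have h1 := exp_neg_le_prod hM hm
    have h2 : (m.factorial : ℝ) ≤ ∏ k ∈ range m, ((M : ℝ) - k) := by
      have := (cast_descFactorial hm).symm
      rw [this, Nat.descFactorial_eq_factorial_mul_choose]
      exact_mod_cast Nat.le_mul_of_pos_right _ (Nat.choose_pos hm)
    have h3 : Real.exp (-(2 * M)) = Real.exp (-M) * Real.exp (-M) := by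
      rw [← Real.exp_add]
      congr 1
      ring
    rw [h3]
    have h0 := Real.exp_pos (-(M : ℝ))
    have h4 := h0.le.trans h1
    have h5 := (Nat.cast_nonneg (α := ℝ) _).trans h2
    calc (m.factorial : ℝ) * (c ^ m * (Real.exp (-M) * Real.exp (-M))) =
        c ^ m * (m.factorial * (Real.exp (-M) * Real.exp (-M))) := by ring
      _ ≤ _ := by gcongr
  · intro k hk
    have hkM : (k : ℝ) ≤ M := by
      exact_mod_cast (mem_range.mp hk).le.trans hm
    have : (0 : ℝ) ≤ M - k := by linarith
    positivity

end Product

lemma mem_packings {ι E : Type*} [DecidableEq ι] [DecidableEq E] {𝒯 : Finset ι}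
    {B : ι → Finset E} {good : Finset E → Prop} {j : ℕ} {A : Finset E} {P : Finset ι} :
    P ∈ packings 𝒯 B good j A ↔ (P ⊆ 𝒯 ∧ P.card = j) ∧
      (∀ T ∈ P, ∀ T' ∈ P, T ≠ T' → Disjoint (B T) (B T')) ∧
      (∀ T ∈ P, B T ⊆ A) ∧ good (A \ P.biUnion B) := by
  classical
  rw [packings, mem_filter, mem_powersetCard]

section Triangles

variable {U : Type*} [Fintype U] [DecidableEq U] {G : SimpleGraph U} [DecidableRel G.Adj]

lemma linearSystem_triangles {w : Finset U → ℝ} {ω : ℝ}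
    (hw : ∀ T ∈ G.cliqueFinset 3, 0 ≤ w T ∧ w T ≤ ω) :
    LinearSystem (G.cliqueFinset 3) (fun T => T.powersetCard 2) w ω where
  card_eq T hT := by
    rw [card_powersetCard, (SimpleGraph.mem_cliqueFinset_iff.mp hT).2]
    rfl
  inter_le T hT T' hT' hne := by
    have h1 := (SimpleGraph.mem_cliqueFinset_iff.mp hT).2
    have h2 := (SimpleGraph.mem_cliqueFinset_iff.mp hT').2
    have h3 : T.powersetCard 2 ∩ T'.powersetCard 2 = (T ∩ T').powersetCard 2 := by
      ext e
      simp only [mem_inter, mem_powersetCard, subset_inter_iff]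
      tauto
    have h4 : (T ∩ T').card ≤ 2 := by
      by_contra! h
      have h5 : T ∩ T' = T := eq_of_subset_of_card_le inter_subset_left (by omega)
      have h6 : T ∩ T' = T' := eq_of_subset_of_card_le inter_subset_right (by omega)
      exact hne (h5.symm.trans h6)
    rw [h3, card_powersetCard]
    interval_cases (T ∩ T').card <;> simp
  nonneg T hT := (hw T hT).1
  le T hT := (hw T hT).2

lemma mem_edges {e : Finset U} : e ∈ G.cliqueFinset 2 ↔ ∃ x y, G.Adj x y ∧ e = {x, y} := by
  rw [SimpleGraph.mem_cliqueFinset_iff, SimpleGraph.isNClique_iff, card_eq_two]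
  constructor
  · rintro ⟨h, x, y, hxy, rfl⟩
    exact ⟨x, y, h (by simp) (by simp) hxy, rfl⟩
  · rintro ⟨x, y, h, rfl⟩
    refine ⟨?_, x, y, h.ne, rfl⟩
    intro a ha b hb hab
    simp only [coe_insert, coe_singleton, Set.mem_insert_iff, Set.mem_singleton_iff] at ha hb
    rcases ha with rfl | rfl <;> rcases hb with rfl | rfl
    · exact absurd rfl hab
    · exact h
    · exact h.symm
    · exact absurd rfl hab

lemma card_of_mem_edges {e : Finset U} (he : e ∈ G.cliqueFinset 2) : e.card = 2 :=
  (SimpleGraph.mem_cliqueFinset_iff.mp he).2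

lemma pair_mem_edges {x y : U} (hxy : x ≠ y) : {x, y} ∈ G.cliqueFinset 2 ↔ G.Adj x y := by
  constructor
  · intro h
    exact (SimpleGraph.mem_cliqueFinset_iff.mp h).1 (by simp) (by simp) hxy
  · exact fun h => mem_edges.mpr ⟨x, y, h, rfl⟩

/-- There are many nearly perfect packings of triangles in a nearly complete graph. -/
theorem exists_many_packings {r m : ℕ} {ω δ₀ pm : ℝ}
    (hr : ∀ x, (univ.filter fun y => ¬ G.Adj x y).card ≤ r)
    (hv : 126 * r ≤ Fintype.card U) (hr1 : 1 ≤ r)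
    (hωv : (1 + 126 * r / Fintype.card U) / (Fintype.card U - 2 : ℝ) ≤ ω) (hω : 0 < ω)
    (hω2 : ω * Fintype.card U ≤ 2)
    (hA : 3 ≤ (G.cliqueFinset 2).card)
    (hpm : pm = 1 - 3 * (m : ℝ) / (G.cliqueFinset 2).card) (hpm0 : 0 < pm) (hδ0 : 0 < δ₀)
    (hδpm : δ₀ ≤ pm ^ 14 / 100) (hωδ : ω ≤ δ₀ / 100) (hAδ : 9 ≤ δ₀ * (G.cliqueFinset 2).card)
    (hexp : (2 * (G.cliqueFinset 2).card + Fintype.card U : ℝ) *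
      Real.exp (-(δ₀ ^ 2 / (60 * ω))) ≤ 1 / 2) :
    ∃ 𝒬 : Finset (Finset (Finset U)),
      (∀ P ∈ 𝒬, (∀ T ∈ P, T ∈ G.cliqueFinset 3) ∧ Linear P ∧
        ∀ x, ω * ((univ.filter fun y => G.Adj x y ∧ ∀ T ∈ P, x ∈ T → y ∉ T).card : ℝ) ≤
          3 * √pm) ∧
      1 / 2 * (((1 - δ₀ / pm ^ 14) / ω) ^ m *
        Real.exp (-(2 * ((G.cliqueFinset 2).card / 3 : ℕ)))) ≤ (𝒬.card : ℝ) := by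
  classical
  obtain ⟨w, hw, hw1⟩ := exists_triangle_weights hr hv hr1
  have hsys : LinearSystem (G.cliqueFinset 3) (fun T => T.powersetCard 2) w ω :=
    linearSystem_triangles fun T hT => ⟨(hw T hT).1, (hw T hT).2.trans hωv⟩
  set A₀ := G.cliqueFinset 2 with hA₀
  have h𝒯 : ∀ T ∈ G.cliqueFinset 3, T.powersetCard 2 ⊆ A₀ := by
    intro T hT e he
    rw [mem_powersetCard] at he
    rw [hA₀, SimpleGraph.mem_cliqueFinset_iff, SimpleGraph.isNClique_iff]
    exact ⟨(SimpleGraph.mem_cliqueFinset_iff.mp hT).1.subset (by exact_mod_cast he.1), he.2⟩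
  have hreg : ∀ e ∈ A₀, ∑ T ∈ G.cliqueFinset 3 with e ∈ T.powersetCard 2, w T = 1 := by
    intro e he
    obtain ⟨x, y, h, rfl⟩ := mem_edges.mp he
    rw [← hw1 x y h]
    refine sum_congr (filter_congr fun T _ => ?_) fun _ _ => rfl
    rw [mem_powersetCard, card_pair h.ne]
    simp
  have hdeg : ∀ (A : Finset (Finset U)) (x : U), A ⊆ A₀ →
      ((univ.filter fun e : Finset U => x ∈ e) ∩ A).card =
        (univ.filter fun y => y ≠ x ∧ ({x, y} : Finset U) ∈ A).card := by
    intro A x hA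
    rw [← card_pairs_at (fun e he => card_of_mem_edges (hA he))]
    congr 1
    ext e
    simp [and_comm]
  have hEx : ∀ x ∈ (univ : Finset U),
      ω * (((univ.filter fun e : Finset U => x ∈ e) ∩ A₀).card : ℝ) ≤ 2 := by
    intro x _
    refine le_trans (mul_le_mul_of_nonneg_left ?_ hω.le) hω2
    rw [hdeg A₀ x subset_rfl]
    exact_mod_cast (card_le_univ _)
  have hmain := card_packings_ge hsys hω (m := m) (by omega) h𝒯 hreg hpm hpm0 hδ0 hδpm hωδ hAδ hEx
    (by simpa using hexp)
  refine ⟨packings (G.cliqueFinset 3) (fun T => T.powersetCard 2) (fun A => ∀ x ∈ univ,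
    ω * (((univ.filter fun e : Finset U => x ∈ e) ∩ A).card : ℝ) ≤ 3 * √pm) m A₀, ?_, ?_⟩
  rotate_left
  · have h0 : (0 : ℝ) < m.factorial := by exact_mod_cast Nat.factorial_pos m
    have hcard : (0 : ℝ) < A₀.card := by exact_mod_cast (by omega : 0 < A₀.card)
    have hmM : m ≤ A₀.card / 3 := by
      rw [hpm, sub_pos, div_lt_one hcard] at hpm0
      have : 3 * m < A₀.card := by exact_mod_cast hpm0
      omega
    have hM3 : 3 * ((A₀.card / 3 : ℕ) : ℝ) ≤ A₀.card := by
      exact_mod_cast Nat.mul_div_le _ _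
    have h1 := prod_ge (by omega) hmM hM3 hpm hpm0 hδ0
      (hδpm.trans (by linarith [pow_pos hpm0 14])) hω
    refine le_of_mul_le_mul_left (le_trans ?_ hmain) h0
    rw [mul_left_comm]
    gcongr
  · intro P hP
    rw [mem_packings] at hP
    obtain ⟨⟨p1, _⟩, p2, p3, p4⟩ := hP
    have hlin : Linear P := by
      intro x y hxy e he e' he' a b c d
      by_contra hne
      refine disjoint_left.mp (p2 e he e' he' hne) (?_ : ({x, y} : Finset U) ∈ _) ?_ <;>
      · rw [mem_powersetCard]
        refine ⟨?_, card_pair hxy⟩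
        simp [insert_subset_iff, *]
    refine ⟨fun T hT => p1 hT, hlin, fun x => ?_⟩
    refine le_trans (le_of_eq ?_) (p4 x (mem_univ x))
    rw [hdeg _ x sdiff_subset]
    congr 3
    ext y
    simp only [mem_filter, mem_univ, true_and, mem_sdiff, mem_biUnion, not_exists, not_and,
      mem_powersetCard]
    constructor
    · rintro ⟨a, b⟩
      refine ⟨a.ne.symm, (pair_mem_edges a.ne).mpr a, fun T hT hs => ?_⟩
      exact absurd (hs (by simp : y ∈ _)) (b T hT (hs (by simp)))
    · rintro ⟨a, b, c⟩
      refine ⟨(pair_mem_edges a.symm).mp b, fun T hT hx hy => c T hT ?_ (card_pair a.symm)⟩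
      simp [insert_subset_iff, *]

end Triangles

section DifferenceCover

variable {J : ℕ} [NeZero (J ^ 2)]

/-- A small set of residues whose differences cover everything. -/
def coverSet (J : ℕ) : Finset (ZMod (J ^ 2)) :=
  (range J).image (fun i => ((2 + i : ℕ) : ZMod (J ^ 2))) ∪
    (range J).image fun c => ((c * J + 2 : ℕ) : ZMod (J ^ 2))

/-- All block offsets of reserved cross pairs. -/
def offSet (J : ℕ) : Finset (ZMod (J ^ 2)) :=
  coverSet J ∪ (qOff (J ^ 2) true ∪ qOff (J ^ 2) false)

lemma coverSet_subset : coverSet J ⊆ offSet J := subset_union_left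

lemma qOff_subset (s : Bool) : qOff (J ^ 2) s ⊆ offSet J := by
  cases s
  · exact subset_union_right.trans subset_union_right
  · exact subset_union_left.trans subset_union_right

lemma offSet_nonempty : 0 < (offSet J).card :=
  card_pos.mpr ⟨0, qOff_subset false (by simp [qOff])⟩

lemma card_offSet_le (hJ : 7 ≤ J) : (offSet J).card ≤ 3 * J := by
  have h1 : (coverSet J).card ≤ J + J :=
    (card_union_le _ _).trans (add_le_add (card_image_le.trans (card_range J).le)
      (card_image_le.trans (card_range J).le))
  have h2 : ∀ s, (qOff (J ^ 2) s).card ≤ 3 := by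
    intro s
    cases s
    · simpa [qOff] using card_le_three
    · simpa [qOff] using card_le_three
  have h3 := card_union_le (coverSet J) (qOff (J ^ 2) true ∪ qOff (J ^ 2) false)
  have h4 := card_union_le (qOff (J ^ 2) true) (qOff (J ^ 2) false)
  have h5 := h2 true
  have h6 := h2 false
  rw [offSet]
  omega

lemma coverSet_diff (hJ : 0 < J) (d : ZMod (J ^ 2)) :
    ∃ a ∈ coverSet J, ∃ a' ∈ coverSet J, d = a - a' := by
  have hmod := Nat.mod_lt d.val hJ
  have hdiv := Nat.div_add_mod d.val J
  have hlt : d.val / J < J := by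
    rw [Nat.div_lt_iff_lt_mul hJ, ← sq]
    exact ZMod.val_lt d
  have hc : ∀ c ≤ J, ((c * J + 2 : ℕ) : ZMod (J ^ 2)) ∈ coverSet J := by
    intro c hc
    rcases hc.lt_or_eq with h | rfl
    · exact mem_union_right _ (mem_image_of_mem _ (mem_range.mpr h))
    · refine mem_union_left _ (mem_image.mpr ⟨0, mem_range.mpr hJ, ?_⟩)
      rw [← sq, Nat.cast_add (c ^ 2), ZMod.natCast_self]
      simp
  have hi : ∀ i < J, ((2 + i : ℕ) : ZMod (J ^ 2)) ∈ coverSet J := fun i hi =>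
    mem_union_left _ (mem_image_of_mem _ (mem_range.mpr hi))
  have hd : d = ((d.val : ℕ) : ZMod (J ^ 2)) := (ZMod.natCast_zmod_val d).symm
  by_cases h0 : d.val % J = 0
  · refine ⟨_, hc (d.val / J) hlt.le, _, hi 0 hJ, ?_⟩
    rw [eq_sub_iff_add_eq, hd, ← Nat.cast_add]
    congr 1
    rw [← hd, mul_comm (d.val / J)]
    omega
  · refine ⟨_, hc (d.val / J + 1) hlt, _, hi (J - d.val % J) (by omega), ?_⟩
    rw [eq_sub_iff_add_eq, hd, ← Nat.cast_add]
    congr 1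
    rw [← hd, add_mul, mul_comm (d.val / J)]
    omega

lemma val_of_mem_coverSet (hJ : 7 ≤ J) {x : ZMod (J ^ 2)} (hx : x ∈ coverSet J) :
    2 ≤ x.val ∧ x.val + 5 ≤ J ^ 2 := by
  have hsq : 7 * J ≤ J ^ 2 := by
    rw [sq]
    gcongr
  rcases mem_union.mp hx with h | h
  · obtain ⟨i, hi, rfl⟩ := mem_image.mp h
    rw [mem_range] at hi
    rw [ZMod.val_natCast, Nat.mod_eq_of_lt (by omega)]
    omega
  · obtain ⟨c, hc, rfl⟩ := mem_image.mp h
    rw [mem_range] at hc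
    have : (c + 1) * J ≤ J ^ 2 := by
      rw [sq]
      gcongr
      omega
    rw [add_mul] at this
    rw [ZMod.val_natCast, Nat.mod_eq_of_lt (by omega)]
    omega

lemma eq_natCast_of_mem_qOff (hJ : 7 ≤ J) {s : Bool} {x : ZMod (J ^ 2)} (hx : x ∈ qOff (J ^ 2) s) :
    (s = true → J ^ 2 ≤ x.val + 4 ∧ x.val + 2 ≤ J ^ 2) ∧
      (s = false → x.val ≤ 1 ∨ x.val + 1 = J ^ 2) := by
  have hsq : 7 * J ≤ J ^ 2 := by
    rw [sq]
    gcongr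
  have hneg : ∀ i : ℕ, i ≤ J ^ 2 → -((i : ℕ) : ZMod (J ^ 2)) = ((J ^ 2 - i : ℕ) : ZMod (J ^ 2)) := by
    intro i hi
    rw [Nat.cast_sub hi, ZMod.natCast_self, zero_sub]
  have hval : ∀ i : ℕ, 0 < i → i ≤ J ^ 2 → (-((i : ℕ) : ZMod (J ^ 2))).val = J ^ 2 - i := by
    intro i h0 hi
    rw [hneg i hi, ZMod.val_natCast, Nat.mod_eq_of_lt (by omega)]
  cases s
  · simp only [qOff, Bool.false_eq_true, if_false, mem_insert, mem_singleton] at hx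
    refine ⟨by simp, fun _ => ?_⟩
    rcases hx with rfl | rfl | rfl
    · right
      have := hval 1 (by omega) (by omega)
      rw [Nat.cast_one] at this
      omega
    · left
      rw [ZMod.val_zero]
      omega
    · left
      have : ((1 : ℕ) : ZMod (J ^ 2)).val = 1 := by
        rw [ZMod.val_natCast, Nat.mod_eq_of_lt (by omega)]
      rw [Nat.cast_one] at this
      omega
  · simp only [qOff, if_true, mem_insert, mem_singleton] at hx
    refine ⟨fun _ => ?_, by simp⟩
    rcases hx with rfl | rfl | rfl
    · have := hval 4 (by omega) (by omega)
      rw [Nat.cast_ofNat] at this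
      omega
    · have := hval 3 (by omega) (by omega)
      rw [Nat.cast_ofNat] at this
      omega
    · have := hval 2 (by omega) (by omega)
      rw [Nat.cast_ofNat] at this
      omega

lemma disjoint_coverSet_qOff (hJ : 7 ≤ J) (s : Bool) : Disjoint (coverSet J) (qOff (J ^ 2) s) := by
  rw [disjoint_left]
  intro x hx hx'
  have h1 := val_of_mem_coverSet hJ hx
  have h2 := eq_natCast_of_mem_qOff hJ hx'
  cases s
  · have := h2.2 rfl
    omega
  · have := h2.1 rfl
    omega

lemma disjoint_qOff (hJ : 7 ≤ J) : Disjoint (qOff (J ^ 2) true) (qOff (J ^ 2) false) := by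
  rw [disjoint_left]
  intro x hx hx'
  have h1 := (eq_natCast_of_mem_qOff hJ hx).1 rfl
  have h2 := (eq_natCast_of_mem_qOff hJ hx').2 rfl
  have hsq : 7 * J ≤ J ^ 2 := by
    rw [sq]
    gcongr
  omega

end DifferenceCover

end STSHole

namespace STSHole

section Parameters

lemma exists_mod_three (a : ℕ) {ρ : ℕ} (hρ : ρ < 3) : ∃ k, a ≤ k ∧ k ≤ a + 2 ∧ k % 3 = ρ := by
  rcases (by omega : (a % 3 = ρ ∨ (a + 1) % 3 = ρ ∨ (a + 2) % 3 = ρ)) with h | h | h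
  · exact ⟨a, by omega, by omega, h⟩
  · exact ⟨a + 1, by omega, by omega, h⟩
  · exact ⟨a + 2, by omega, by omega, h⟩

lemma sq_mod_three {J : ℕ} (hJ : J % 3 ≠ 0) : J ^ 2 % 3 = 1 := by
  have : J % 3 = 1 ∨ J % 3 = 2 := by omega
  rcases this with h | h <;> simp [Nat.pow_mod, h]

/-- Divisibility conditions for the sizes of the parts. -/
lemma exists_count_of_mod {k q n w : ℕ} (hq : q % 3 = 1) (hn : 2 * (2 * k * q) + w = n)
    (hw : 3 ≤ w) (hk : (n % 6 = 3 ∧ k % 3 = 0) ∨ (n % 6 = 1 ∧ k % 3 = 1)) :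
    w % 6 = 3 ∧ ∃ T, 6 * T + 2 * (2 * k * q) = 2 * k * q * (2 * k * q + w) := by
  have hkq : k * q % 3 = k % 3 := by rw [Nat.mul_mod, hq, mul_one, Nat.mod_mod]
  rw [mul_assoc 2 k q] at hn ⊢
  generalize k * q = x at *
  have hw3 : w % 6 = 3 := by omega
  refine ⟨hw3, ?_⟩
  have hdvd : 3 ∣ x * (2 * x + w - 2) := by
    rcases hk with ⟨_, h⟩ | ⟨_, h⟩
    · exact Dvd.dvd.mul_right (by omega) _
    · exact Dvd.dvd.mul_left (by omega) _
  obtain ⟨T, hT⟩ := hdvd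
  obtain ⟨u, hu⟩ := Nat.exists_eq_add_of_le (by omega : 2 ≤ 2 * x + w)
  rw [hu, Nat.add_sub_cancel_left] at hT
  refine ⟨T, ?_⟩
  rw [hu]
  linarith

lemma exists_parameters {n J α : ℕ} (hJ : 300 ≤ J) (hJ3 : J % 3 ≠ 0) (hn : J ^ 20 ≤ n)
    (hn6 : n % 6 = 1 ∨ n % 6 = 3) (hα : 0 < α) (hα' : α ≤ 3 * J) :
    ∃ k w w' e0 T d, 0 < k ∧ 2 * (2 * k * J ^ 2) + w = n ∧ w % 6 = 3 ∧
      w + 2 * (n / J ^ 3) + e0 = 2 * k * α ∧ w = 2 * w' + 1 ∧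
      6 * T + 2 * (2 * k * J ^ 2) = 2 * k * J ^ 2 * (2 * k * J ^ 2 + w) ∧ 5 ≤ w ∧ 0 < e0 ∧
      2 * (n / J ^ 9) ≤ e0 ∧ n / J ^ 9 + 18 * e0 ≤ d ∧
      8 * ((J ^ 2) ^ 2 * d) ≤ n / J ^ 3 ∧ 2 * (n / J ^ 3) ≤ k := by
  set g := n / J ^ 3 with hg
  set Δ := n / J ^ 9 with hΔ
  have hJ0 : 0 < J := by omega
  have hJsq : 300 * J ≤ J ^ 2 := by
    rw [sq]
    gcongr
  have hgn : J ^ 3 * g ≤ n := Nat.mul_div_le _ _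
  have hgΔ : J ^ 6 * Δ ≤ g := by
    rw [hg, Nat.le_div_iff_mul_le (by positivity)]
    calc J ^ 6 * Δ * J ^ 3 = J ^ 9 * Δ := by ring
      _ ≤ n := Nat.mul_div_le _ _
  have hgJ : J ^ 9 ≤ g := by
    rw [hg, Nat.le_div_iff_mul_le (by positivity)]
    calc J ^ 9 * J ^ 3 = J ^ 12 := by ring
      _ ≤ J ^ 20 := Nat.pow_le_pow_right hJ0 (by norm_num)
      _ ≤ n := hn
  set c := 4 * J ^ 2 + 2 * α with hc
  have hc0 : 0 < c := by omega
  have hc5 : c ≤ 5 * J ^ 2 := by omega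
  set B := n + 2 * g + 2 * Δ + 1 with hB
  obtain ⟨ρ, hρ, hρn⟩ : ∃ ρ < 3, (n % 6 = 3 ∧ ρ = 0) ∨ (n % 6 = 1 ∧ ρ = 1) := by
    rcases hn6 with h | h
    · exact ⟨1, by norm_num, Or.inr ⟨h, rfl⟩⟩
    · exact ⟨0, by norm_num, Or.inl ⟨h, rfl⟩⟩
  obtain ⟨k, hk1, hk2, hk3⟩ := exists_mod_three (B / c + 1) hρ
  have hkc : B ≤ k * c := by
    have := Nat.lt_mul_div_succ B hc0
    calc B ≤ c * (B / c + 1) := this.le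
      _ ≤ k * c := by rw [mul_comm]; gcongr
  have hkc' : k * c ≤ B + 3 * c := by
    have := Nat.div_mul_le_self B c
    calc k * c ≤ (B / c + 1 + 2) * c := by gcongr
      _ = B / c * c + 3 * c := by ring
      _ ≤ _ := by gcongr
  obtain ⟨e0, he0⟩ := Nat.exists_eq_add_of_le (show n + 2 * g ≤ k * c by omega)
  have h8 : 2 * J ^ 8 ≤ J ^ 9 := by
    calc 2 * J ^ 8 ≤ J * J ^ 8 := by gcongr; omega
      _ = J ^ 9 := by ring
  have hd : 8 * ((J ^ 2) ^ 2 * (Δ + 18 * e0)) ≤ g := by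
    have e1 : Δ + 18 * e0 ≤ 37 * Δ + 288 * J ^ 2 := by omega
    have e2 : 600 * J ^ 4 * Δ ≤ J ^ 6 * Δ := by
      calc 600 * J ^ 4 * Δ ≤ J ^ 2 * J ^ 4 * Δ := by gcongr; omega
        _ = _ := by ring
    have e3 : 2304 * J ^ 6 ≤ J ^ 8 := by
      calc 2304 * J ^ 6 ≤ J ^ 2 * J ^ 6 := by gcongr; omega
        _ = _ := by ring
    calc 8 * ((J ^ 2) ^ 2 * (Δ + 18 * e0)) ≤ 8 * ((J ^ 2) ^ 2 * (37 * Δ + 288 * J ^ 2)) := by gcongr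
      _ = 296 * J ^ 4 * Δ + 2304 * J ^ 6 := by ring
      _ ≤ g := by linarith
  have hJ2 : 1 ≤ (J ^ 2) ^ 2 := Nat.one_le_pow _ _ (by positivity)
  have he0g : Δ + 18 * e0 ≤ g := by
    refine le_trans ?_ hd
    calc Δ + 18 * e0 = 1 * (1 * (Δ + 18 * e0)) := by ring
      _ ≤ _ := by gcongr; norm_num
  have hkg : 60 * g ≤ k := by
    have e1 : J ^ 2 * (300 * g) ≤ J ^ 2 * (5 * k) := by
      calc J ^ 2 * (300 * g) ≤ J ^ 2 * (J * g) := by gcongr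
        _ = J ^ 3 * g := by ring
        _ ≤ k * c := by omega
        _ ≤ k * (5 * J ^ 2) := by gcongr
        _ = _ := by ring
    have := Nat.le_of_mul_le_mul_left e1 (by positivity)
    omega
  have hg5 : 5 ≤ g := by
    have : J ^ 1 ≤ J ^ 9 := Nat.pow_le_pow_right hJ0 (by norm_num)
    omega
  have hkα : k ≤ k * α := Nat.le_mul_of_pos_right k hα
  obtain ⟨w, hw⟩ := Nat.exists_eq_add_of_le (show 2 * g + e0 ≤ 2 * (k * α) by omega)
  have hkc2 : k * c = 2 * (2 * (k * J ^ 2)) + 2 * (k * α) := by rw [hc]; ring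
  have hnw : 2 * (2 * k * J ^ 2) + w = n := by
    rw [mul_assoc]
    omega
  have hw5 : 5 ≤ w := by omega
  obtain ⟨hw3, T, hT⟩ := exists_count_of_mod (sq_mod_three hJ3) hnw (by omega) (by
    rcases hρn with ⟨a, rfl⟩ | ⟨a, rfl⟩
    · exact Or.inl ⟨a, hk3⟩
    · exact Or.inr ⟨a, hk3⟩)
  refine ⟨k, w, w / 2, e0, T, Δ + 18 * e0, by omega, hnw, hw3, ?_, by omega, hT, hw5, by omega,
    by omega, le_rfl, hd, by omega⟩
  rw [mul_assoc 2 k α]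
  omega

end Parameters

end STSHole

namespace STSHole

section Estimates

lemma inv_pow_mul_le {j x : ℝ} (hj : 300 ≤ j) {a b : ℕ} (hab : a < b) (hx : j ^ b ≤ x) :
    300 * j ^ a ≤ x := by
  have hj1 : 1 ≤ j := by linarith
  calc 300 * j ^ a ≤ j * j ^ a := by gcongr
    _ = j ^ (a + 1) := by ring
    _ ≤ j ^ b := pow_le_pow_right₀ hj1 hab
    _ ≤ x := hx

lemma exp_tail_le {j x y : ℝ} (hj : 300 ≤ j) (hx : j ^ 1000 ≤ x) (hy : x / (120 * j ^ 600) ≤ y) :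
    2 * x ^ 2 * Real.exp (-y) ≤ 1 / 2 := by
  have hj0 : 0 < j := by linarith
  have hx0 : 0 < x := lt_of_lt_of_le (by positivity) hx
  have hz : 0 < x / (120 * j ^ 600) := by positivity
  have h1 := Real.pow_div_factorial_le_exp y (hz.le.trans hy) 6
  have h2 : 4 * x ^ 2 ≤ y ^ 6 / (Nat.factorial 6 : ℕ) := by
    have h3 : (x / (120 * j ^ 600)) ^ 6 ≤ y ^ 6 := by gcongr
    have h4 : x ^ 2 * (j ^ 1000) ^ 4 ≤ x ^ 2 * x ^ 4 := by gcongr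
    have h5 : (300 : ℝ) ^ 400 ≤ j ^ 400 := by gcongr
    have h6 : (4 * 720 * 120 ^ 6 : ℝ) ≤ j ^ 400 := by
      refine le_trans ?_ h5
      calc (4 * 720 * 120 ^ 6 : ℝ) ≤ 300 ^ 10 := by norm_num
        _ ≤ 300 ^ 400 := pow_le_pow_right₀ (by norm_num) (by norm_num)
    have h7 : (Nat.factorial 6 : ℕ) = 720 := rfl
    rw [h7, le_div_iff₀ (by norm_num)]
    refine le_trans ?_ h3
    rw [div_pow, le_div_iff₀ (by positivity)]
    calc 4 * x ^ 2 * (720 : ℕ) * (120 * j ^ 600) ^ 6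
        = x ^ 2 * ((4 * 720 * 120 ^ 6) * (j ^ 600) ^ 6) := by push_cast; ring
      _ ≤ x ^ 2 * (j ^ 400 * (j ^ 600) ^ 6) := by gcongr
      _ = x ^ 2 * (j ^ 1000) ^ 4 := by
        rw [← pow_mul, ← pow_mul, ← pow_add]
      _ ≤ x ^ 6 := h4.trans (by rw [← pow_add])
  have h3 : 4 * x ^ 2 ≤ Real.exp y := h2.trans h1
  rw [Real.exp_neg, ← div_eq_mul_inv, div_le_iff₀ (Real.exp_pos y)]
  linarith

lemma weight_bound {j x V R : ℝ} (hj : 300 ≤ j) (hx : 4 * j ≤ x)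
    (hV : x * (1 - 3 / (2 * j)) ≤ V) (hR : R ≤ 2 * V / j) :
    (1 + 126 * R / V) / (V - 2) ≤ (1 + 300 / j) / x := by
  have hj0 : 0 < j := by linarith
  have hx0 : 0 < x := by linarith
  set u := 1 / j with hu
  have hu0 : 0 < u := by positivity
  have hu1 : u ≤ 1 / 300 := by rw [hu]; gcongr
  have e1 : 3 / (2 * j) = 3 / 2 * u := by rw [hu]; field_simp
  have e2 : 300 / j = 300 * u := by rw [hu]; field_simp
  have e3 : 2 * V / j = 2 * u * V := by rw [hu]; field_simp
  rw [e1] at hV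
  rw [e3] at hR
  rw [e2]
  have hux : 4 ≤ u * x := by
    rw [hu, one_div, inv_mul_eq_div, le_div_iff₀ hj0]
    exact hx
  have hV2 : x * (1 - 2 * u) ≤ V - 2 := by linarith
  have h12 : 0 < 1 - 2 * u := by linarith
  have hV0 : 0 < V - 2 := lt_of_lt_of_le (by positivity) hV2
  have hV3 : 0 < V := by linarith
  have h1 : 126 * R / V ≤ 252 * u := by
    rw [div_le_iff₀ hV3]
    linarith
  rw [div_le_div_iff₀ hV0 hx0]
  have h2 : (1 + 126 * R / V) * x ≤ (1 + 252 * u) * x := by gcongr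
  have h3 : (1 + 300 * u) * (x * (1 - 2 * u)) ≤ (1 + 300 * u) * (V - 2) := by gcongr
  have h4 : (1 + 252 * u) * x ≤ (1 + 300 * u) * (x * (1 - 2 * u)) := by
    have : x * (1 + 252 * u) ≤ x * ((1 + 300 * u) * (1 - 2 * u)) := by
      refine mul_le_mul_of_nonneg_left ?_ hx0.le
      nlinarith only [hu0, hu1]
    linarith
  linarith

lemma pair_count_bound {j x V R N : ℝ} (hj : 300 ≤ j) (hx : 0 < x)
    (hV : x * (1 - 3 / (2 * j)) ≤ V) (hR : R ≤ 2 * V / j) (hN : V * (V - R) ≤ 2 * N) :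
    x ^ 2 * (1 - 5 / j) ≤ 2 * N := by
  have hj0 : 0 < j := by linarith
  set u := 1 / j with hu
  have hu0 : 0 < u := by positivity
  have hu1 : u ≤ 1 / 300 := by rw [hu]; gcongr
  have e1 : 3 / (2 * j) = 3 / 2 * u := by rw [hu]; field_simp
  have e2 : 5 / j = 5 * u := by rw [hu]; field_simp
  have e3 : 2 * V / j = 2 * u * V := by rw [hu]; field_simp
  rw [e1] at hV
  rw [e3] at hR
  rw [e2]
  have h0 : 0 ≤ x * (1 - 3 / 2 * u) := mul_nonneg hx.le (by linarith)
  have hV0 : 0 ≤ V := h0.trans hV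
  refine le_trans ?_ hN
  calc x ^ 2 * (1 - 5 * u) ≤ x ^ 2 * ((1 - 3 / 2 * u) ^ 2 * (1 - 2 * u)) := by
        refine mul_le_mul_of_nonneg_left ?_ (by positivity)
        nlinarith only [hu0, hu1, mul_pos hu0 hu0, mul_nonneg (mul_pos hu0 hu0).le (sub_nonneg.mpr hu1)]
    _ = (x * (1 - 3 / 2 * u)) ^ 2 * (1 - 2 * u) := by ring
    _ ≤ V ^ 2 * (1 - 2 * u) := by
        refine mul_le_mul_of_nonneg_right ?_ (by linarith)
        gcongr
    _ = V * (V - 2 * u * V) := by ring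
    _ ≤ V * (V - R) := by gcongr

/-- The logarithm of the number of packings found by the random greedy process. -/
lemma log_count_bound {j x N M m ω z : ℝ} (hj : 300 ≤ j) (hx : j ^ 1000 ≤ x)
    (hN1 : x ^ 2 * (1 - 5 / j) ≤ 2 * N) (hN2 : 2 * N ≤ x ^ 2) (hω : ω = (1 + 300 / j) / x)
    (hM : 3 * M ≤ N) (hm1 : (1 - (j ^ 20)⁻¹) * N - 3 ≤ 3 * m) (hm2 : 3 * m ≤ N) (hm0 : 0 ≤ m)
    (hz0 : 0 ≤ z) (hz : z ≤ (j ^ 20)⁻¹) :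
    x ^ 2 / 6 * (Real.log x - 2) - 57 * (x ^ 2 * Real.log x / j) ≤
      Real.log (1 / 2) + (m * Real.log ((1 - z) / ω) - 2 * M) := by
  have hj0 : 0 < j := by linarith
  have hjx : j ≤ x := by
    have := inv_pow_mul_le hj (by norm_num : 1 < 1000) hx
    linarith
  have hx0 : 0 < x := by linarith
  have hlog : 1 ≤ Real.log x := by
    rw [Real.le_log_iff_exp_le hx0]
    linarith [Real.exp_one_lt_d9]
  set u := 1 / j with hu
  have hu0 : 0 < u := by positivity
  have hu1 : u ≤ 1 / 300 := by rw [hu]; gcongr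
  have hη : (j ^ 20)⁻¹ ≤ u / 300 := by
    rw [hu, div_div, one_div]
    gcongr
    calc j * 300 ≤ j * j ^ 19 := by
          gcongr
          calc (300 : ℝ) ≤ j := hj
            _ = j ^ 1 := (pow_one j).symm
            _ ≤ j ^ 19 := pow_le_pow_right₀ (by linarith) (by norm_num)
      _ = j ^ 20 := by ring
  have e1 : 5 / j = 5 * u := by rw [hu]; field_simp
  have e2 : 300 / j = 300 * u := by rw [hu]; field_simp
  have e3 : x ^ 2 * Real.log x / j = u * (x ^ 2 * Real.log x) := by rw [hu]; field_simp
  rw [e1] at hN1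
  rw [e2] at hω
  rw [e3]
  have hux : 300 ≤ u * x := by
    rw [hu, one_div, inv_mul_eq_div, le_div_iff₀ hj0]
    have := inv_pow_mul_le hj (by norm_num : 1 < 1000) hx
    linarith
  have hux2 : 300 ≤ u * x ^ 2 := by
    have : u * x * 1 ≤ u * x * x := by
      gcongr
      linarith
    nlinarith only [this, hux]
  have hl2 : Real.log (1 / 2) = - Real.log 2 := by
    rw [one_div, Real.log_inv]
  have hl2' : Real.log 2 ≤ 1 := by linarith [Real.log_two_lt_d9]
  have h1z : 0 < 1 - z := by linarith
  have hω0 : 0 < ω := by rw [hω]; positivity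
  have hlogω : Real.log ((1 - z) / ω) = Real.log (1 - z) + Real.log x - Real.log (1 + 300 * u) := by
    rw [Real.log_div h1z.ne' hω0.ne', hω, Real.log_div (by positivity) hx0.ne']
    ring
  have hlz : -u ≤ Real.log (1 - z) := by
    have := Real.one_sub_inv_le_log_of_pos h1z
    refine le_trans ?_ this
    have hz1 : z ≤ u / 300 := hz.trans hη
    rw [le_sub_iff_add_le, ← le_sub_iff_add_le', inv_le_comm₀ h1z (by linarith)]
    rw [sub_neg_eq_add, inv_le_comm₀ (by linarith) h1z]
    rw [inv_le_iff_one_le_mul₀ h1z]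
    nlinarith only [hz1, hz0, hu0, hu1]
  have hlu : Real.log (1 + 300 * u) ≤ 300 * u := by
    have := Real.log_le_sub_one_of_pos (show 0 < 1 + 300 * u by positivity)
    linarith
  have hL : Real.log x - 301 * u ≤ Real.log ((1 - z) / ω) := by
    rw [hlogω]
    linarith
  have hmL : m * (Real.log x - 301 * u) ≤ m * Real.log ((1 - z) / ω) := by gcongr
  set L := Real.log x with hLdef
  have hN0 : 0 ≤ N := by linarith
  have hη2 : (j ^ 20)⁻¹ * N ≤ u / 300 * N := by gcongr
  have a1 : N / 3 - u * x ^ 2 / 100 ≤ m := by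
    have : u * (2 * N) ≤ u * x ^ 2 := by gcongr
    linarith
  have a2 : (N / 3 - u * x ^ 2 / 100) * L ≤ m * L := by gcongr
  have a3 : m * (301 * u) ≤ x ^ 2 / 6 * (301 * u) := by
    gcongr
    linarith
  have a4 : u * x ^ 2 * 1 ≤ u * x ^ 2 * L := by gcongr
  have a5 : x ^ 2 * (1 - 5 * u) * (L - 2) ≤ 2 * N * (L - 2) := by
    rcases le_total 2 L with h | h
    · exact mul_le_mul_of_nonneg_right hN1 (by linarith)
    · exfalso
      have h1 : Real.log 300 ≤ L := Real.log_le_log (by norm_num) (by linarith)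
      have h2 : (2 : ℝ) < Real.log 300 := by
        rw [Real.lt_log_iff_exp_lt (by norm_num)]
        have h3 : Real.exp 2 = Real.exp 1 * Real.exp 1 := by rw [← Real.exp_add]; norm_num
        rw [h3]
        nlinarith only [Real.exp_one_lt_d9, Real.exp_pos 1]
      linarith
  have a6 : 0 ≤ u * x ^ 2 := by positivity
  have a7 : 0 ≤ u * x ^ 2 * L := by positivity
  linarith

end Estimates

end STSHole

namespace STSHole

open Finset


section Edges

variable {U : Type*} [Fintype U] [DecidableEq U] {G : SimpleGraph U} [DecidableRel G.Adj]

lemma card_edges_at (x : U) :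
    ((G.cliqueFinset 2).filter fun e => x ∈ e).card = (univ.filter fun y => G.Adj x y).card := by
  rw [card_pairs_at fun e he => card_of_mem_edges he]
  congr 1
  ext y
  simp only [mem_filter, mem_univ, true_and]
  exact ⟨fun h => (pair_mem_edges h.1.symm).mp h.2, fun h => ⟨h.ne.symm, (pair_mem_edges h.ne).mpr h⟩⟩

lemma two_mul_card_edges_le : 2 * (G.cliqueFinset 2).card ≤ Fintype.card U ^ 2 := by
  rw [two_mul_card_pairs fun e he => card_of_mem_edges he, sq, ← card_univ, ← smul_eq_mul]
  refine sum_le_card_nsmul _ _ _ fun x _ => ?_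
  rw [card_edges_at]
  exact card_filter_le _ _

lemma le_two_mul_card_edges {r : ℕ} (hr : ∀ x, (univ.filter fun y => ¬ G.Adj x y).card ≤ r) :
    Fintype.card U * Fintype.card U ≤ 2 * (G.cliqueFinset 2).card + Fintype.card U * r := by
  rw [two_mul_card_pairs fun e he => card_of_mem_edges he]
  have h1 := sum_le_card_nsmul (univ : Finset U) _ _ fun x _ => hr x
  have h2 : ∑ x : U, ((univ.filter fun y => G.Adj x y).card +
      (univ.filter fun y => ¬ G.Adj x y).card) = Fintype.card U * Fintype.card U := by
    rw [sum_congr rfl fun x _ => card_filter_add_card_filter_not (s := univ) (fun y => G.Adj x y)]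
    simp
  rw [sum_add_distrib] at h2
  rw [sum_congr rfl fun x _ => card_edges_at (G := G) x, ← h2, ← card_univ, ← smul_eq_mul]
  exact Nat.add_le_add_left h1 _

lemma card_nonadj_le {I k g : ℕ} [NeZero I] [NeZero k] (A : Finset (ZMod I)) (hg : g ≤ k)
    (x : Vtx I k) :
    (univ.filter fun y => ¬ (baseGraph A g).Adj x y).card ≤ 2 * k * A.card + g + 1 := by
  have h1 := card_off A x
  have h2 := card_QAdj hg x
  have h3 := card_singleton x
  rw [← h1, ← h3]
  refine le_trans ?_ (Nat.add_le_add_right (Nat.add_le_add_left h2.le _) _)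
  refine (card_le_card (t := (univ.filter fun y => x.1 ≠ y.1 ∧ off x y ∈ A) ∪
    (univ.filter fun y => QAdj g x y) ∪ {x}) ?_).trans ((card_union_le _ _).trans ?_)
  · intro y hy
    rw [mem_filter] at hy
    simp only [mem_union, mem_filter, mem_univ, true_and, mem_singleton]
    by_cases h : x.1 = y.1
    · have := hy.2
      rw [base_inner h] at this
      tauto
    · have := hy.2
      rw [base_cross h] at this
      tauto
  · exact Nat.add_le_add_right (card_union_le _ _) _

end Edges

section Greedy

variable {U : Type*} [Fintype U] [DecidableEq U] {G : SimpleGraph U} [DecidableRel G.Adj]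

/-- Many packings of triangles with a sparse leave, in terms of a single error parameter. -/
theorem exists_packings_sparse_leave {n J r : ℕ} (hJ : 300 ≤ J) (hn : J ^ 1000 ≤ n)
    (hvn : Fintype.card U ≤ n) (hv : (n : ℝ) * (1 - 3 / (2 * J)) ≤ Fintype.card U)
    (hr : ∀ x, (univ.filter fun y => ¬ G.Adj x y).card ≤ r) (hr1 : 1 ≤ r)
    (hrv : r * J ≤ 2 * Fintype.card U) :
    ∃ 𝒬 : Finset (Finset (Finset U)),
      (∀ P ∈ 𝒬, (∀ T ∈ P, T ∈ G.cliqueFinset 3) ∧ Linear P ∧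
        ∀ x, (univ.filter fun y => G.Adj x y ∧ ∀ T ∈ P, x ∈ T → y ∉ T).card ≤ n / J ^ 9) ∧
      0 < 𝒬.card ∧
      (n : ℝ) ^ 2 / 6 * (Real.log n - 2) - 57 * ((n : ℝ) ^ 2 * Real.log n / J) ≤
        Real.log 𝒬.card := by
  set v := Fintype.card U with hvdef
  set N := (G.cliqueFinset 2).card with hNdef
  set x := (n : ℝ) with hxdef
  set j := (J : ℝ) with hjdef
  have hj : 300 ≤ j := by
    rw [hjdef]
    exact_mod_cast hJ
  have hx : j ^ 1000 ≤ x := by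
    rw [hjdef, hxdef]
    exact_mod_cast hn
  have hj0 : 0 < j := by linarith
  have hjx : 300 * j ≤ x := by
    simpa using inv_pow_mul_le hj (by norm_num : 1 < 1000) hx
  have hx0 : 0 < x := by linarith
  have hR : (r : ℝ) ≤ 2 * v / j := by
    rw [le_div_iff₀ hj0, hjdef]
    exact_mod_cast hrv
  have hvx : (v : ℝ) ≤ x := by
    rw [hxdef]
    exact_mod_cast hvn
  have hv0 : (0 : ℝ) < v := by
    refine lt_of_lt_of_le (mul_pos hx0 ?_) hv
    rw [sub_pos, div_lt_one (by positivity)]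
    linarith
  have hNlow : x ^ 2 * (1 - 5 / j) ≤ 2 * N := by
    refine pair_count_bound hj hx0 hv hR ?_
    have : ((v * v : ℕ) : ℝ) ≤ ((2 * N + v * r : ℕ) : ℝ) := by
      exact_mod_cast le_two_mul_card_edges hr
    push_cast at this
    linarith
  have hNup : 2 * (N : ℝ) ≤ x ^ 2 := by
    have : ((2 * N : ℕ) : ℝ) ≤ ((v ^ 2 : ℕ) : ℝ) := by exact_mod_cast two_mul_card_edges_le
    push_cast at this
    exact this.trans (by gcongr)
  have h5j : 5 / j ≤ 1 / 2 := by
    rw [div_le_div_iff₀ hj0 (by norm_num)]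
    linarith
  have hN4 : x ^ 2 ≤ 4 * N := by
    have : x ^ 2 * (1 / 2) ≤ x ^ 2 * (1 - 5 / j) := by
      gcongr
      linarith
    linarith
  have hxx : 300 * x ≤ x ^ 2 := by
    rw [sq]
    gcongr
    linarith
  have hN0 : (0 : ℝ) < N := by linarith
  set η := (j ^ 20)⁻¹ with hη
  have hη0 : 0 < η := by positivity
  have hη1 : η ≤ 1 / 300 := by
    rw [hη, one_div]
    gcongr
    calc (300 : ℝ) ≤ j := hj
      _ = j ^ 1 := (pow_one j).symm
      _ ≤ j ^ 20 := pow_le_pow_right₀ (by linarith) (by norm_num)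
  set m := ⌊(1 - η) * N / 3⌋₊ with hm
  have hm2 : 3 * (m : ℝ) ≤ (1 - η) * N := by
    have := Nat.floor_le (show 0 ≤ (1 - η) * N / 3 by
      have : 0 ≤ 1 - η := by linarith
      positivity)
    linarith
  have hm1 : (1 - η) * N - 3 ≤ 3 * m := by
    have := Nat.lt_floor_add_one ((1 - η) * N / 3)
    linarith
  set pm := 1 - 3 * (m : ℝ) / N with hpm
  have hpm1 : η ≤ pm := by
    have : 3 * (m : ℝ) / N ≤ 1 - η := by
      rw [div_le_iff₀ hN0]
      exact hm2
    linarith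
  have hpm2 : pm ≤ 2 * η := by
    have h1 : 3 ≤ η * N := by
      rw [hη, inv_mul_eq_div, le_div_iff₀ (by positivity)]
      have := inv_pow_mul_le hj (by norm_num : 20 < 1000) hx
      nlinarith only [this, hN4, hxx, hx0]
    have h2 : 1 - 2 * η ≤ 3 * (m : ℝ) / N := by
      rw [le_div_iff₀ hN0]
      linarith
    linarith
  have hpm0 : 0 < pm := hη0.trans_le hpm1
  set ω := (1 + 300 / j) / x with hω
  have hω0 : 0 < ω := by positivity
  have h300 : 300 / j ≤ 1 := by
    rw [div_le_one hj0]
    exact hj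
  have hω2 : ω ≤ 2 / x := by
    rw [hω]
    gcongr
    linarith
  set δ₀ := (j ^ 300)⁻¹ with hδ
  have hδ0 : 0 < δ₀ := by positivity
  have hxδ : 300 * j ^ 300 ≤ x := inv_pow_mul_le hj (by norm_num) hx
  have hδη : δ₀ = η ^ 14 * η := by
    rw [hδ, hη, ← pow_succ, inv_pow, ← pow_mul]
  have hδpm : δ₀ ≤ pm ^ 14 / 100 := by
    have : η ^ 14 * η ≤ pm ^ 14 * (1 / 300) := by gcongr
    rw [hδη]
    linarith [pow_pos hpm0 14]
  have hωδ : ω ≤ δ₀ / 100 := by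
    refine hω2.trans ?_
    rw [hδ, div_le_div_iff₀ hx0 (by norm_num), inv_mul_eq_div, le_div_iff₀ (by positivity)]
    linarith
  have hNδ : 9 ≤ δ₀ * N := by
    rw [hδ, inv_mul_eq_div, le_div_iff₀ (by positivity)]
    linarith
  have hexp : (2 * (N : ℝ) + v) * Real.exp (-(δ₀ ^ 2 / (60 * ω))) ≤ 1 / 2 := by
    refine le_trans ?_ (exp_tail_le (y := δ₀ ^ 2 / (60 * ω)) hj hx ?_)
    · gcongr
      linarith
    · rw [div_le_div_iff₀ (by positivity) (by positivity)]
      have h1 : δ₀ ^ 2 * j ^ 600 = 1 := by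
        rw [hδ, inv_pow, ← pow_mul, inv_mul_cancel₀ (by positivity)]
      have h2 : x * ω ≤ 2 := by
        rw [mul_comm, ← le_div_iff₀ hx0]
        exact hω2
      calc x * (60 * ω) = 60 * (x * ω) := by ring
        _ ≤ 60 * 2 := by gcongr
        _ = 120 * (δ₀ ^ 2 * j ^ 600) := by rw [h1]; norm_num
        _ = δ₀ ^ 2 * (120 * j ^ 600) := by ring
  have hv126 : 126 * r ≤ v := by
    have : 300 * r ≤ 2 * v := le_trans (by rw [mul_comm]; gcongr) hrv
    omega
  have hωv : (1 + 126 * (r : ℝ) / v) / (v - 2) ≤ ω :=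
    weight_bound hj (by linarith) hv hR
  have hωv2 : ω * v ≤ 2 := by
    calc ω * v ≤ 2 / x * x := by gcongr
      _ = 2 := by field_simp
  have hN3 : 3 ≤ N := by
    have : (3 : ℝ) ≤ N := by linarith
    exact_mod_cast this
  obtain ⟨𝒬, h1, h2⟩ := exists_many_packings hr hv126 hr1 hωv hω0 hωv2 hN3 hpm hpm0 hδ0 hδpm hωδ
    hNδ hexp
  have hz : δ₀ / pm ^ 14 ≤ η := by
    rw [div_le_iff₀ (by positivity), hδη, mul_comm]
    gcongr
  have hz1 : 0 < 1 - δ₀ / pm ^ 14 := by linarith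
  have hpos : 0 < 1 / 2 * (((1 - δ₀ / pm ^ 14) / ω) ^ m * Real.exp (-(2 * ((N / 3 : ℕ) : ℝ)))) := by
    positivity
  refine ⟨𝒬, fun P hP => ⟨(h1 P hP).1, (h1 P hP).2.1, fun y => ?_⟩, ?_, ?_⟩
  · have h3 := (h1 P hP).2.2 y
    rw [Nat.le_div_iff_mul_le (by positivity)]
    generalize (univ.filter fun z => G.Adj y z ∧ ∀ T ∈ P, y ∈ T → z ∉ T).card = L at *
    have h4 : √pm ≤ 2 * (j ^ 10)⁻¹ := by
      rw [Real.sqrt_le_left (by positivity), mul_pow, inv_pow, ← pow_mul]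
      linarith
    have h5 : 1 / x ≤ ω := by
      rw [hω]
      gcongr
      linarith [show 0 ≤ 300 / j by positivity]
    have h6 : 1 / x * L ≤ 6 * (j ^ 10)⁻¹ := by
      refine le_trans (mul_le_mul_of_nonneg_right h5 L.cast_nonneg) ?_
      linarith
    rw [one_div, inv_mul_eq_div, ← div_eq_mul_inv, div_le_div_iff₀ hx0 (by positivity)] at h6
    have h7 : (L : ℝ) * j ^ 9 * j ≤ x * j := by
      calc (L : ℝ) * j ^ 9 * j = L * j ^ 10 := by ring
        _ ≤ 6 * x := h6
        _ ≤ x * j := by rw [mul_comm]; gcongr; linarith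
    have h8 := le_of_mul_le_mul_right h7 hj0
    rw [hjdef, hxdef] at h8
    exact_mod_cast h8
  · have := hpos.trans_le h2
    exact_mod_cast this
  · refine le_trans ?_ (Real.log_le_log hpos h2)
    rw [Real.log_mul (by norm_num) (by positivity), Real.log_mul (by positivity) (by positivity),
      Real.log_pow, Real.log_exp]
    refine log_count_bound hj hx hNlow hNup hω ?_ hm1 (hm2.trans ?_) m.cast_nonneg (by positivity)
      hz
    · exact_mod_cast Nat.mul_div_le N 3
    · nlinarith only [hη0, hN0]

end Greedy

/-- A lower bound for the number of Steiner triple systems. -/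
theorem log_card_allSTS_ge {n J : ℕ} (hJ : 300 ≤ J) (hJ3 : J % 3 ≠ 0) (hn : J ^ 1000 ≤ n)
    (hn6 : n % 6 = 1 ∨ n % 6 = 3) :
    0 < (allSTS n).card ∧
    (n : ℝ) ^ 2 / 6 * (Real.log n - 2) - 58 * ((n : ℝ) ^ 2 * Real.log n / J) ≤
      Real.log (allSTS n).card := by
  have hJ0 : 0 < J := by omega
  have : NeZero (J ^ 2) := ⟨by positivity⟩
  have hn20 : J ^ 20 ≤ n := (Nat.pow_le_pow_right hJ0 (by norm_num)).trans hn
  have hJn : J ≤ n := (Nat.le_self_pow (by norm_num) J).trans hn20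
  have hα := card_offSet_le (by omega : 7 ≤ J)
  obtain ⟨k, w, w', e0, Ts, d, hk, hnw, hw3, hw, hw', hTs, hw5, he0, hΔ, hd, hdg, hgk⟩ :=
    exists_parameters hJ hJ3 hn20 hn6 (offSet_nonempty (J := J)) hα
  have : NeZero k := ⟨hk.ne'⟩
  set g := n / J ^ 3 with hg
  set α := (offSet J).card with hαdef
  have hv : Fintype.card (Vtx (J ^ 2) k) = 2 * (2 * k * J ^ 2) := card_vtx
  have hkα : k * α ≤ k * (3 * J) := by gcongr
  have hkJ : k * 300 ≤ k * J := by gcongr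
  have hwJ : w * (2 * J) ≤ 3 * n := by
    calc w * (2 * J) ≤ 6 * (k * J) * (2 * J) := by
          gcongr
          linarith
      _ = 3 * (2 * (2 * k * J ^ 2)) := by ring
      _ ≤ 3 * n := by omega
  obtain ⟨𝒬, h1, h2, h3⟩ := exists_packings_sparse_leave (U := Vtx (J ^ 2) k)
    (G := baseGraph (offSet J) g) (r := 2 * k * α + g + 1) hJ hn (by omega) (by
      rw [hv]
      have e1 : ((w * (2 * J) : ℕ) : ℝ) ≤ ((3 * n : ℕ) : ℝ) := by exact_mod_cast hwJ
      have e2 : (n : ℝ) = ((2 * (2 * k * J ^ 2) : ℕ) : ℝ) + w := by exact_mod_cast hnw.symm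
      have e3 : (0 : ℝ) < 2 * J := by positivity
      have e4 : (w : ℝ) ≤ 3 * n / (2 * J) := by
        rw [le_div_iff₀ e3]
        push_cast at e1
        linarith
      have e5 : (n : ℝ) * (1 - 3 / (2 * J)) = n - 3 * n / (2 * J) := by
        field_simp
      rw [e5]
      linarith) (card_nonadj_le _ (by omega)) (by omega) (by
      rw [hv]
      calc (2 * k * α + g + 1) * J ≤ 8 * (k * J) * J := by
            gcongr
            linarith
        _ = 2 * (2 * (2 * k * J ^ 2)) := by ring)
  obtain ⟨f, hf⟩ := exists_isSTS_extension (U := Vtx (J ^ 2) k) (n := n) (w := w) (by omega) hw3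
  have hbase : ∀ P ∈ 𝒬, InBase (offSet J) g P := by
    intro P hP T hT
    have := SimpleGraph.mem_cliqueFinset_iff.mp ((h1 P hP).1 T hT)
    exact ⟨this.2, fun x hx y hy hxy => this.1 hx hy hxy⟩
  have hlv : ∀ P ∈ 𝒬, ∀ x, (leave (offSet J) g P x).card ≤ n / J ^ 9 := by
    intro P hP x
    refine le_trans (card_le_card fun y hy => ?_) ((h1 P hP).2.2 x)
    simp only [leave, mem_filter] at hy ⊢
    exact hy
  have hlin : ∀ P ∈ 𝒬, Linear P := fun P hP => (h1 P hP).2.1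
  clear h1
  have hle := card_le_of_completions (n := n) (t := 2 * (2 * k * J ^ 2 * g)) (𝒬 := 𝒬)
    (fun P hP T hT => (hbase P hP T hT).1) f (fun P₀ hP₀ => by
      obtain ⟨P, c1, c2, c3, c4, c5, c6⟩ := exists_completion (coverSet_diff hJ0) coverSet_subset
        qOff_subset (disjoint_coverSet_qOff (by omega)) (disjoint_qOff (by omega)) hw hw' hTs hw5
        he0 hΔ hd hdg hgk (hbase P₀ hP₀) (hlin P₀ hP₀) (hlv P₀ hP₀)
      obtain ⟨E, d1, d2⟩ := hf Prod.fst P c1 c2 c3 (by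
        intro x
        rw [hv]
        exact c4 x)
      exact ⟨P, E, c1, d1, d2, c5, c6⟩)
  have hpos : 0 < (allSTS n).card := by
    by_contra h
    rw [Nat.eq_zero_of_not_pos h, zero_mul] at hle
    omega
  refine ⟨hpos, ?_⟩
  rw [hv, ← pow_add, ← two_mul] at hle
  set v := 2 * (2 * k * J ^ 2) with hvdef
  have hx0 : (1 : ℝ) ≤ n := by exact_mod_cast (by omega : 1 ≤ n)
  have hle2 : (𝒬.card : ℝ) ≤ (allSTS n).card * ((n : ℝ) ^ 4) ^ (2 * (v * g)) := by
    have e1 : v ^ 3 + 1 ≤ n ^ 4 := by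
      calc v ^ 3 + 1 ≤ n ^ 3 + n ^ 3 := by
            gcongr
            · omega
            · exact Nat.one_le_pow _ _ (by omega)
        _ = 2 * n ^ 3 := by ring
        _ ≤ n * n ^ 3 := by gcongr; omega
        _ = n ^ 4 := by ring
    have e2 : 2 * (2 * k * J ^ 2 * g) = v * g := by rw [hvdef]; ring
    rw [e2] at hle
    have e3 := hle.trans (Nat.mul_le_mul_left _ (Nat.pow_le_pow_left e1 _))
    exact_mod_cast e3
  have hQ : (0 : ℝ) < 𝒬.card := by exact_mod_cast h2
  have hA : (0 : ℝ) < (allSTS n).card := by exact_mod_cast hpos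
  have h4 := Real.log_le_log hQ hle2
  rw [Real.log_mul hA.ne' (by positivity), Real.log_pow, Real.log_pow] at h4
  have h5 : 8 * ((v : ℝ) * g) ≤ (n : ℝ) ^ 2 / J := by
    have hJ' : (0 : ℝ) < J := by exact_mod_cast hJ0
    rw [le_div_iff₀ hJ']
    have e1 : g * J ^ 3 ≤ n := Nat.div_mul_le_self n _
    have e2 : 8 * (v * g) * J ≤ n ^ 2 := by
      calc 8 * (v * g) * J ≤ J ^ 2 * (n * g) * J := by
            gcongr
            · calc 8 ≤ J := by omega
                _ ≤ J ^ 2 := Nat.le_self_pow (by norm_num) J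
            · omega
        _ = n * (g * J ^ 3) := by ring
        _ ≤ n * n := by gcongr
        _ = n ^ 2 := by ring
    exact_mod_cast e2
  have h6 : 8 * ((v : ℝ) * g) * Real.log n ≤ (n : ℝ) ^ 2 / J * Real.log n := by
    gcongr
  push_cast at h4
  have h7 : (n : ℝ) ^ 2 / J * Real.log n = (n : ℝ) ^ 2 * Real.log n / J := by ring
  linarith

section Peeling

variable {α ι β : Type*} [DecidableEq β]

/-- Revealing the values of a jointly injective family of functions one after the other. -/
lemma sum_prod_inv_le_one (f : ι → α → β) (B : ι → α → ℝ) (l : List ι) (F : Finset α)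
    (hinj : ∀ S ∈ F, ∀ S' ∈ F, (∀ e ∈ l, f e S = f e S') → S = S')
    (hB : ∀ l₁ e l₂, l = l₁ ++ e :: l₂ → ∀ S ∈ F,
      (((F.filter fun S' => ∀ e' ∈ l₁, f e' S' = f e' S).image (f e)).card : ℝ) ≤ B e S) :
    ∑ S ∈ F, (l.map fun e => (B e S)⁻¹).prod ≤ 1 := by
  induction l generalizing F with
  | nil =>
    simp only [List.map_nil, List.prod_nil, sum_const, nsmul_eq_mul, mul_one]
    exact_mod_cast card_le_one.mpr fun S hS S' hS' => hinj S hS S' hS' (by simp)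
  | cons e l ih =>
    rcases F.eq_empty_or_nonempty with rfl | hF
    · simp
    have hpos : (0 : ℝ) < (F.image (f e)).card := by
      exact_mod_cast card_pos.mpr (hF.image _)
    have hBe : ∀ S ∈ F, ((F.image (f e)).card : ℝ) ≤ B e S := by
      intro S hS
      have := hB [] e l rfl S hS
      simpa using this
    have hfib : ∀ b ∈ F.image (f e),
        ∑ S ∈ F with f e S = b, (l.map fun e => (B e S)⁻¹).prod ≤ 1 := by
      intro b _
      refine ih _ ?_ ?_
      · intro S hS S' hS' h
        rw [mem_filter] at hS hS'
        refine hinj S hS.1 S' hS'.1 fun e' he' => ?_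
        rcases List.mem_cons.mp he' with rfl | he'
        · rw [hS.2, hS'.2]
        · exact h e' he'
      · intro l₁ e' l₂ hl S hS
        rw [mem_filter] at hS
        have := hB (e :: l₁) e' l₂ (by rw [hl]; rfl) S hS.1
        refine le_trans ?_ this
        refine Nat.cast_le.mpr (card_le_card (image_subset_image ?_))
        intro S' hS'
        simp only [mem_filter, List.mem_cons, forall_eq_or_imp] at hS' ⊢
        exact ⟨hS'.1.1, hS'.1.2.trans hS.2.symm, hS'.2⟩
    have hnn : ∀ S ∈ F, 0 ≤ (l.map fun e => (B e S)⁻¹).prod := by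
      intro S hS
      refine List.prod_nonneg fun r hr => ?_
      obtain ⟨e', he', rfl⟩ := List.mem_map.mp hr
      obtain ⟨l₁, l₂, hl⟩ := List.append_of_mem he'
      have := hB (e :: l₁) e' l₂ (by rw [hl]; rfl) S hS
      exact inv_nonneg.mpr (le_trans (Nat.cast_nonneg _) this)
    calc ∑ S ∈ F, ((e :: l).map fun e => (B e S)⁻¹).prod
        ≤ ∑ S ∈ F, ((F.image (f e)).card : ℝ)⁻¹ * (l.map fun e => (B e S)⁻¹).prod := by
          refine sum_le_sum fun S hS => ?_
          rw [List.map_cons, List.prod_cons]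
          exact mul_le_mul_of_nonneg_right (inv_anti₀ hpos (hBe S hS)) (hnn S hS)
      _ = ((F.image (f e)).card : ℝ)⁻¹ * ∑ b ∈ F.image (f e),
            ∑ S ∈ F with f e S = b, (l.map fun e => (B e S)⁻¹).prod := by
          rw [← mul_sum, sum_fiberwise_of_maps_to fun S hS => mem_image_of_mem _ hS]
      _ ≤ ((F.image (f e)).card : ℝ)⁻¹ * ∑ _b ∈ F.image (f e), 1 := by
          gcongr with b hb
          exact hfib b hb
      _ = 1 := by
          rw [sum_const, nsmul_eq_mul, mul_one, inv_mul_cancel₀ hpos.ne']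

/-- Averaging the peeling inequality over random orders. -/
lemma card_le_exp_of_average {Ω : Type*} [Fintype Ω] [Nonempty Ω] {F : Finset α}
    {L : α → Ω → ℝ} {m : ℝ} (h1 : ∀ τ, ∑ S ∈ F, Real.exp (-L S τ) ≤ 1)
    (h2 : ∀ S ∈ F, ∑ τ, L S τ ≤ Fintype.card Ω * m) : (F.card : ℝ) ≤ Real.exp m := by
  have hΩ : (0 : ℝ) < Fintype.card Ω := by exact_mod_cast Fintype.card_pos
  have h3 : ∀ S ∈ F, Fintype.card Ω * Real.exp (-m) ≤ ∑ τ, Real.exp (-L S τ) := by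
    intro S hS
    have h4 : ∀ τ, Real.exp (-m) * (1 + m - L S τ) ≤ Real.exp (-L S τ) := by
      intro τ
      have h5 := Real.add_one_le_exp (m - L S τ)
      have h6 : Real.exp (-L S τ) = Real.exp (-m) * Real.exp (m - L S τ) := by
        rw [← Real.exp_add]
        congr 1
        ring
      rw [h6]
      gcongr
      linarith
    refine le_trans ?_ (sum_le_sum fun τ _ => h4 τ)
    rw [← mul_sum, mul_comm]
    gcongr
    rw [sum_sub_distrib, sum_const, card_univ, nsmul_eq_mul]
    linarith [h2 S hS]
  have h4 : ∑ S ∈ F, ∑ τ, Real.exp (-L S τ) ≤ Fintype.card Ω := by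
    rw [sum_comm]
    refine (sum_le_sum fun τ _ => h1 τ).trans ?_
    simp
  have h5 := (sum_le_sum h3).trans h4
  rw [sum_const, nsmul_eq_mul, Real.exp_neg] at h5
  have h6 : (F.card : ℝ) * (Real.exp m)⁻¹ ≤ 1 := by
    refine le_of_mul_le_mul_left ?_ hΩ
    linarith
  rwa [← div_eq_mul_inv, div_le_one (Real.exp_pos m)] at h6

end Peeling

section RandomOrder

variable {ι : Type*} [Fintype ι] [DecidableEq ι] {K : ℕ}

/-- The probability that a random label is `j` and the labels in `A` are at least `j`. -/
lemma card_labels (e : ι) {A : Finset ι} (he : e ∉ A) (j : Fin K) :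
    ((univ.filter fun τ : ι → Fin K => τ e = j ∧ ∀ p ∈ A, j ≤ τ p).card : ℝ) =
      Fintype.card (ι → Fin K) * ((K : ℝ)⁻¹ * (((K - j : ℕ) : ℝ) / K) ^ A.card) := by
  have hK : (K : ℝ) ≠ 0 := by
    have : 0 < K := j.pos
    positivity
  have h1 : (univ.filter fun τ : ι → Fin K => τ e = j ∧ ∀ p ∈ A, j ≤ τ p) =
      Fintype.piFinset fun p => if p = e then {j} else if p ∈ A then Ici j else univ := by
    ext τ
    simp only [mem_filter, mem_univ, true_and, Fintype.mem_piFinset]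
    constructor
    · rintro ⟨a, b⟩ p
      split_ifs with h h'
      · rw [h, mem_singleton, a]
      · exact mem_Ici.mpr (b p h')
      · exact mem_univ _
    · intro h
      refine ⟨by simpa using h e, fun p hp => ?_⟩
      have := h p
      rw [if_neg fun h' : p = e => he (by rw [← h']; exact hp), if_pos hp] at this
      exact mem_Ici.mp this
  have h2 : ∀ p : ι, (((if p = e then {j} else if p ∈ A then Ici j else univ : Finset (Fin K)).card
      : ℕ) : ℝ) = K * ((if p = e then (K : ℝ)⁻¹ else 1) *
        (if p ∈ A then ((K - j : ℕ) : ℝ) / K else 1)) := by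
    intro p
    by_cases h : p = e
    · have h' : p ∉ A := by rwa [h]
      simp [h, he, hK]
    · by_cases h' : p ∈ A
      · rw [if_neg h, if_pos h', if_neg h, if_pos h', Fin.card_Ici]
        field_simp
      · simp [h, h']
  rw [h1, Fintype.card_piFinset, Nat.cast_prod, prod_congr rfl fun p _ => h2 p, prod_mul_distrib,
    prod_mul_distrib, prod_const, prod_ite_eq' univ e, if_pos (mem_univ _), prod_ite_mem,
    univ_inter, prod_const, card_univ, Fintype.card_fun, Fintype.card_fin, Nat.cast_pow]

/-- The averaged logarithm of the number of choices for a fresh pair. -/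
lemma sum_log_choices_le {κ : Type*} (e : ι) {A₀ : Finset ι} (he₀ : e ∉ A₀) (hA₀ : A₀.card = 2)
    (Z : Finset κ) (A : κ → Finset ι) (hA : ∀ z ∈ Z, (A z).card = 6) (he : ∀ z ∈ Z, e ∉ A z)
    (hd : ∀ z ∈ Z, Disjoint A₀ (A z)) {ν : ℝ} (hZ : (Z.card : ℝ) ≤ ν) :
    ∑ τ : ι → Fin K, (if ∀ p ∈ A₀, τ e ≤ τ p then
        Real.log (1 + (Z.filter fun z => ∀ p ∈ A z, τ e ≤ τ p).card) else 0) ≤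
      Fintype.card (ι → Fin K) * ((K : ℝ)⁻¹ * ∑ j : Fin K, (((K - j : ℕ) : ℝ) / K) ^ 2 *
        Real.log (1 + ν * (((K - j : ℕ) : ℝ) / K) ^ 6)) := by
  have hν : 0 ≤ ν := (Nat.cast_nonneg _).trans hZ
  rw [← sum_fiberwise univ fun τ : ι → Fin K => τ e, mul_sum, mul_sum]
  refine sum_le_sum fun j _ => ?_
  set q := ((K - j : ℕ) : ℝ) / K with hq
  have hq0 : 0 ≤ q := by positivity
  set c := ν * q ^ 6 with hc
  have hc0 : 0 ≤ c := by positivity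
  set N := (Fintype.card (ι → Fin K) : ℝ) with hN
  have hN0 : 0 ≤ N := Nat.cast_nonneg _
  have htan : ∀ y : ℝ, 0 ≤ y → Real.log (1 + y) ≤ Real.log (1 + c) + (y - c) / (1 + c) := by
    intro y hy
    have h1 := Real.log_le_sub_one_of_pos (show 0 < (1 + y) / (1 + c) by positivity)
    rw [Real.log_div (by positivity) (by positivity)] at h1
    have h2 : (1 + y) / (1 + c) - 1 = (y - c) / (1 + c) := by field_simp; ring
    linarith
  have h8 : ∀ z ∈ Z, ((univ.filter fun τ : ι → Fin K =>
      (τ e = j ∧ ∀ p ∈ A₀, j ≤ τ p) ∧ ∀ p ∈ A z, j ≤ τ p).card : ℝ) = N * ((K : ℝ)⁻¹ * q ^ 8) := by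
    intro z hz
    have h1 := card_labels (K := K) e (A := A₀ ∪ A z)
      (by rw [mem_union, not_or]; exact ⟨he₀, he z hz⟩) j
    rw [card_union_of_disjoint (hd z hz), hA₀, hA z hz] at h1
    rw [← h1]
    congr 2
    ext τ
    simp only [mem_filter, mem_univ, true_and, mem_union, or_imp, forall_and, and_assoc]
  have h2 := card_labels (K := K) e he₀ j
  rw [hA₀] at h2
  set G := univ.filter fun τ : ι → Fin K => τ e = j ∧ ∀ p ∈ A₀, j ≤ τ p with hG
  have hsum : ∑ τ : ι → Fin K with τ e = j, (if ∀ p ∈ A₀, τ e ≤ τ p then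
        Real.log (1 + (Z.filter fun z => ∀ p ∈ A z, τ e ≤ τ p).card) else 0) =
      ∑ τ ∈ G, Real.log (1 + (Z.filter fun z => ∀ p ∈ A z, j ≤ τ p).card) := by
    rw [← sum_filter, filter_filter]
    refine sum_congr ?_ ?_
    · ext τ
      simp only [hG, mem_filter, mem_univ, true_and]
      constructor <;> rintro ⟨rfl, h⟩ <;> exact ⟨rfl, h⟩
    · intro τ hτ
      simp only [hG, mem_filter, mem_univ, true_and] at hτ
      rw [hτ.1]
  rw [hsum]
  have hcount : ∑ τ ∈ G, ((Z.filter fun z => ∀ p ∈ A z, j ≤ τ p).card : ℝ) =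
      Z.card * (N * ((K : ℝ)⁻¹ * q ^ 8)) := by
    simp_rw [← sum_boole]
    rw [sum_comm, ← nsmul_eq_mul, ← sum_const]
    refine sum_congr rfl fun z hz => ?_
    rw [sum_boole, ← h8 z hz, hG, filter_filter]
  calc ∑ τ ∈ G, Real.log (1 + (Z.filter fun z => ∀ p ∈ A z, j ≤ τ p).card)
      ≤ ∑ τ ∈ G, (Real.log (1 + c) +
          (((Z.filter fun z => ∀ p ∈ A z, j ≤ τ p).card : ℝ) - c) / (1 + c)) :=
        sum_le_sum fun τ _ => htan _ (Nat.cast_nonneg _)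
    _ = N * ((K : ℝ)⁻¹ * (q ^ 2 * Real.log (1 + c))) +
          N * (K : ℝ)⁻¹ * q ^ 2 * (Z.card * q ^ 6 - c) / (1 + c) := by
        rw [sum_add_distrib, ← sum_div, sum_sub_distrib, hcount, sum_const, sum_const, nsmul_eq_mul,
          nsmul_eq_mul, h2]
        ring
    _ ≤ N * ((K : ℝ)⁻¹ * (q ^ 2 * Real.log (1 + c))) := by
        have h3 : (Z.card : ℝ) * q ^ 6 - c ≤ 0 := by
          rw [hc, sub_nonpos]
          gcongr
        have h4 : N * (K : ℝ)⁻¹ * q ^ 2 * (Z.card * q ^ 6 - c) / (1 + c) ≤ 0 :=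
          div_nonpos_of_nonpos_of_nonneg
            (mul_nonpos_of_nonneg_of_nonpos (by positivity) h3) (by positivity)
        linarith

end RandomOrder

section EntropySum

/-- An antiderivative of `u ↦ u ^ 2 * log (ν * u ^ 6)`, where `L = log ν`. -/
noncomputable def entropyPrim (L u : ℝ) : ℝ :=
  u ^ 3 / 3 * L + 2 * u ^ 3 * Real.log u - 2 / 3 * u ^ 3

lemma hasDerivAt_entropyPrim (L : ℝ) {u : ℝ} (hu : 0 < u) :
    HasDerivAt (entropyPrim L) (u ^ 2 * (L + 6 * Real.log u)) u := by
  have h3 : HasDerivAt (fun u : ℝ => u ^ 3) (3 * u ^ 2) u := by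
    simpa using hasDerivAt_pow 3 u
  have h := (((h3.div_const 3).mul_const L).add
    ((h3.const_mul 2).mul (Real.hasDerivAt_log hu.ne'))).sub (h3.const_mul (2 / 3))
  refine h.congr_deriv ?_
  field_simp
  ring

lemma mul_le_entropyPrim_sub {L a b : ℝ} (ha : 0 < a) (hab : a < b)
    (h0 : 0 ≤ L + 6 * Real.log a) :
    (b - a) * (a ^ 2 * (L + 6 * Real.log a)) ≤ entropyPrim L b - entropyPrim L a := by
  obtain ⟨c, hc, hc'⟩ := exists_hasDerivAt_eq_slope (entropyPrim L)
    (fun u => u ^ 2 * (L + 6 * Real.log u)) hab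
    (fun u hu => (hasDerivAt_entropyPrim L (ha.trans_le hu.1)).continuousAt.continuousWithinAt)
    (fun u hu => hasDerivAt_entropyPrim L (ha.trans hu.1))
  have hlog : Real.log a ≤ Real.log c := Real.log_le_log ha hc.1.le
  have h1 : a ^ 2 * (L + 6 * Real.log a) ≤ c ^ 2 * (L + 6 * Real.log c) := by
    have := hc.1.le
    gcongr
  have hba : 0 < b - a := sub_pos.mpr hab
  rw [hc', le_div_iff₀ hba] at h1
  linarith

/-- The average over random orders of the log-number of choices, per pair. -/
noncomputable def avgLog (K : ℕ) (ν : ℝ) : ℝ :=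
  (K : ℝ)⁻¹ * ∑ j : Fin K, (((K - j : ℕ) : ℝ) / K) ^ 2 *
    Real.log (1 + ν * (((K - j : ℕ) : ℝ) / K) ^ 6)

lemma avgLog_le {K : ℕ} (hK : 2 ≤ K) {ν : ℝ} (hν : (K : ℝ) ^ 6 ≤ ν) (hL : 1 ≤ Real.log ν) :
    avgLog K ν ≤ (Real.log ν - 2) / 3 + 40 * Real.log ν / K := by
  have hK0 : (0 : ℝ) < K := by positivity
  have hν0 : 0 < ν := lt_of_lt_of_le (by positivity) hν
  set L := Real.log ν with hLdef
  set s := (K : ℝ)⁻¹ with hs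
  have hs0 : 0 < s := inv_pos.mpr hK0
  have hsK : (K : ℝ) * s = 1 := mul_inv_cancel₀ hK0.ne'
  have hνs : 1 ≤ ν * s ^ 6 := by
    calc (1 : ℝ) = (K : ℝ) ^ 6 * s ^ 6 := by rw [← mul_pow, hsK, one_pow]
      _ ≤ ν * s ^ 6 := by gcongr
  have hlogs : ∀ u, s ≤ u → 0 ≤ L + 6 * Real.log u := by
    intro u hu
    have hu0 : 0 < u := hs0.trans_le hu
    have h1 : 1 ≤ ν * u ^ 6 := hνs.trans (by gcongr)
    have h2 := Real.log_nonneg h1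
    rw [Real.log_mul hν0.ne' (by positivity), Real.log_pow] at h2
    exact_mod_cast h2
  have hterm : ∀ i : ℕ, s * ((((i + 1 : ℕ) : ℝ) / K) ^ 2 *
      Real.log (1 + ν * (((i + 1 : ℕ) : ℝ) / K) ^ 6)) ≤
        entropyPrim L (((i + 1 : ℕ) : ℝ) * s + 2 * s) - entropyPrim L ((i : ℝ) * s + 2 * s) := by
    intro i
    set q := ((i + 1 : ℕ) : ℝ) / K with hq
    have hqs : q = ((i : ℝ) + 1) * s := by rw [hq, div_eq_mul_inv]; push_cast; rfl
    have hq0 : 0 < q := by positivity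
    have hl : Real.log (1 + ν * q ^ 6) ≤ L + 6 * Real.log (q + s) := by
      have h1 : 1 + ν * q ^ 6 ≤ ν * (q + s) ^ 6 := by
        have h2 : q ^ 6 + s ^ 6 ≤ (q + s) ^ 6 := by
          have : (q + s) ^ 6 = q ^ 6 + s ^ 6 + (6 * q ^ 5 * s + 15 * q ^ 4 * s ^ 2 +
            20 * q ^ 3 * s ^ 3 + 15 * q ^ 2 * s ^ 4 + 6 * q * s ^ 5) := by ring
          rw [this]
          have : 0 ≤ 6 * q ^ 5 * s + 15 * q ^ 4 * s ^ 2 +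
            20 * q ^ 3 * s ^ 3 + 15 * q ^ 2 * s ^ 4 + 6 * q * s ^ 5 := by positivity
          linarith
        have h3 := mul_le_mul_of_nonneg_left h2 hν0.le
        linarith
      have h4 := Real.log_le_log (by positivity) h1
      rw [Real.log_mul hν0.ne' (by positivity), Real.log_pow] at h4
      exact_mod_cast h4
    have h0 := hlogs (q + s) (by linarith)
    have h5 := mul_le_entropyPrim_sub (L := L) (a := q + s) (b := q + 2 * s) (by positivity)
      (by linarith) h0
    have h6 : (i : ℝ) * s + 2 * s = q + s := by rw [hqs]; ring
    have h7 : ((i + 1 : ℕ) : ℝ) * s + 2 * s = q + 2 * s := by rw [hqs]; push_cast; ring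
    rw [h6, h7]
    refine le_trans ?_ h5
    have h8 : q + 2 * s - (q + s) = s := by ring
    rw [h8]
    have h9 : q ^ 2 * Real.log (1 + ν * q ^ 6) ≤ (q + s) ^ 2 * (L + 6 * Real.log (q + s)) := by
      refine mul_le_mul ?_ hl (Real.log_nonneg ?_) (by positivity)
      · gcongr
        linarith
      · have : 0 ≤ ν * q ^ 6 := by positivity
        linarith
    gcongr
  have hsum : avgLog K ν ≤ entropyPrim L (1 + 2 * s) - entropyPrim L (2 * s) := by
    have e1 : avgLog K ν = ∑ i ∈ range K, s * ((((i + 1 : ℕ) : ℝ) / K) ^ 2 *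
      Real.log (1 + ν * (((i + 1 : ℕ) : ℝ) / K) ^ 6)) := by
      rw [avgLog, ← mul_sum, Fin.sum_univ_eq_sum_range (fun j => (((K - j : ℕ) : ℝ) / K) ^ 2 *
        Real.log (1 + ν * (((K - j : ℕ) : ℝ) / K) ^ 6)), ← sum_range_reflect]
      congr 1
      refine sum_congr rfl fun i hi => ?_
      rw [mem_range] at hi
      have : K - (K - 1 - i) = i + 1 := by omega
      rw [this]
    rw [e1]
    refine (sum_le_sum fun i _ => hterm i).trans ?_
    rw [sum_range_sub (fun i : ℕ => entropyPrim L ((i : ℝ) * s + 2 * s)) K, hsK]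
    simp
  refine hsum.trans ?_
  set t := 2 * s with ht
  have ht0 : 0 < t := by positivity
  have ht1 : t ≤ 1 := by
    have : (2 : ℝ) ≤ K := by exact_mod_cast hK
    calc t ≤ (K : ℝ) * s := by rw [ht]; gcongr
      _ = 1 := hsK
  have hp3 : (1 + t) ^ 3 ≤ 1 + 7 * t := by nlinarith only [ht0, ht1, mul_pos ht0 ht0]
  have hlt : Real.log (1 + t) ≤ t := by
    have := Real.log_le_sub_one_of_pos (show 0 < 1 + t by positivity)
    linarith
  have hlt0 : 0 ≤ Real.log (1 + t) := Real.log_nonneg (by linarith)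
  have hb : entropyPrim L (1 + t) ≤ (1 + 7 * t) / 3 * L + 16 * t - 2 / 3 := by
    rw [entropyPrim]
    have a1 : (1 + t) ^ 3 / 3 * L ≤ (1 + 7 * t) / 3 * L := by gcongr
    have a2 : 2 * (1 + t) ^ 3 * Real.log (1 + t) ≤ 2 * 8 * t := by
      gcongr
      linarith
    have a3 : 1 ≤ (1 + t) ^ 3 := one_le_pow₀ (by linarith)
    linarith
  have ha : -entropyPrim L t ≤ 2 / 3 * t := by
    have h0 := hlogs t (by rw [ht]; linarith)
    have a1 : 0 ≤ t ^ 3 / 3 * (L + 6 * Real.log t) := by positivity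
    have a2 : t ^ 3 ≤ t := pow_le_of_le_one ht0.le ht1 (by norm_num)
    rw [entropyPrim]
    linarith
  have hLt : t ≤ t * L := by nlinarith only [ht0, hL]
  have e : 40 * L / K = 20 * (t * L) := by rw [ht, hs]; ring
  rw [e]
  linarith

end EntropySum

section Upper

variable {V : Type*} [DecidableEq V]

lemma _root_.IsSTS.eq_of_mem {S : Finset (Finset V)} (hS : IsSTS S) {T T' : Finset V} (hT : T ∈ S)
    (hT' : T' ∈ S) {x y : V} (hxy : x ≠ y) (hx : x ∈ T) (hy : y ∈ T) (hx' : x ∈ T')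
    (hy' : y ∈ T') : T = T' :=
  (hS.2 x y hxy).unique ⟨hT, hx, hy⟩ ⟨hT', hx', hy'⟩

lemma _root_.IsSTS.eq_of_subset {S : Finset (Finset V)} (hS : IsSTS S) {T T' p : Finset V} (hT : T ∈ S)
    (hT' : T' ∈ S) (hp : p.card = 2) (h : p ⊆ T) (h' : p ⊆ T') : T = T' := by
  obtain ⟨x, y, hxy, rfl⟩ := card_eq_two.mp hp
  exact hS.eq_of_mem hT hT' hxy (h (by simp)) (h (by simp)) (h' (by simp)) (h' (by simp))

/-- The block of `S` through the pair `e`. -/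
def blockThrough (S : Finset (Finset V)) (e : Finset V) : Finset V :=
  (S.filter (e ⊆ ·)).biUnion id

lemma _root_.IsSTS.filter_eq {S : Finset (Finset V)} (hS : IsSTS S) {e : Finset V} (he : e.card = 2) :
    S.filter (e ⊆ ·) = {blockThrough S e} := by
  obtain ⟨x, y, hxy, h⟩ := card_eq_two.mp he
  obtain ⟨T, ⟨hT, hx, hy⟩, -⟩ := hS.2 x y hxy
  have heT : e ⊆ T := by
    rw [h, insert_subset_iff, singleton_subset_iff]
    exact ⟨hx, hy⟩
  have h1 : S.filter (e ⊆ ·) = {T} := by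
    ext T'
    rw [mem_filter, mem_singleton]
    constructor
    · rintro ⟨a, b⟩
      exact hS.eq_of_subset a hT he b heT
    · rintro rfl
      exact ⟨hT, heT⟩
  rw [blockThrough, h1, singleton_biUnion, id]

lemma _root_.IsSTS.blockThrough_mem {S : Finset (Finset V)} (hS : IsSTS S) {e : Finset V}
    (he : e.card = 2) : blockThrough S e ∈ S ∧ e ⊆ blockThrough S e := by
  have : blockThrough S e ∈ S.filter (e ⊆ ·) := by
    rw [hS.filter_eq he]
    exact mem_singleton_self _
  exact mem_filter.mp this

lemma _root_.IsSTS.eq_blockThrough {S : Finset (Finset V)} (hS : IsSTS S) {e T : Finset V}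
    (he : e.card = 2) (hT : T ∈ S) (h : e ⊆ T) : T = blockThrough S e :=
  hS.eq_of_subset hT (hS.blockThrough_mem he).1 he h (hS.blockThrough_mem he).2

lemma _root_.IsSTS.disjoint_pairs {S : Finset (Finset V)} (hS : IsSTS S) {T T' : Finset V} (hT : T ∈ S)
    (hT' : T' ∈ S) (h : T ≠ T') : Disjoint (T.powersetCard 2) (T'.powersetCard 2) := by
  rw [disjoint_left]
  intro p hp hp'
  rw [mem_powersetCard] at hp hp'
  exact h (hS.eq_of_subset hT hT' hp.2 hp.1 hp'.1)

/-- The pairs blocking `z` as the third vertex of the block through `e`. -/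
def blockingPairs (S : Finset (Finset V)) (e : Finset V) (z : V) : Finset (Finset V) :=
  e.biUnion fun x => (blockThrough S {x, z}).powersetCard 2

/-- The other two pairs of the block through `e`. -/
def siblings (S : Finset (Finset V)) (e : Finset V) : Finset (Finset V) :=
  ((blockThrough S e).powersetCard 2).erase e

lemma _root_.IsSTS.card_siblings {S : Finset (Finset V)} (hS : IsSTS S) {e : Finset V} (he : e.card = 2) :
    (siblings S e).card = 2 := by
  obtain ⟨h1, h2⟩ := hS.blockThrough_mem he
  rw [siblings, card_erase_of_mem (mem_powersetCard.mpr ⟨h2, he⟩), card_powersetCard,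
    hS.1 _ h1]
  rfl

lemma _root_.IsSTS.blockThrough_ne {S : Finset (Finset V)} (hS : IsSTS S) {e : Finset V}
    (he : e.card = 2) {z : V} (hz : z ∉ blockThrough S e) {x : V} (hx : x ∈ e) :
    (({x, z} : Finset V).card = 2) ∧ blockThrough S {x, z} ∈ S ∧ x ∈ blockThrough S {x, z} ∧
      z ∈ blockThrough S {x, z} ∧ blockThrough S e ≠ blockThrough S {x, z} := by
  obtain ⟨h1, h2⟩ := hS.blockThrough_mem he
  have hxz : x ≠ z := fun h => hz (h ▸ h2 hx)
  have hc : ({x, z} : Finset V).card = 2 := card_pair hxz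
  obtain ⟨h3, h4⟩ := hS.blockThrough_mem hc
  refine ⟨hc, h3, h4 (by simp), h4 (by simp), fun h => hz ?_⟩
  rw [h]
  exact h4 (by simp)

lemma _root_.IsSTS.disjoint_blockingPairs {S : Finset (Finset V)} (hS : IsSTS S) {e : Finset V}
    (he : e.card = 2) {z : V} (hz : z ∉ blockThrough S e) :
    Disjoint ((blockThrough S e).powersetCard 2) (blockingPairs S e z) := by
  rw [blockingPairs, disjoint_biUnion_right]
  intro x hx
  obtain ⟨-, h3, -, -, h⟩ := hS.blockThrough_ne he hz hx
  exact hS.disjoint_pairs (hS.blockThrough_mem he).1 h3 h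

lemma _root_.IsSTS.card_blockingPairs {S : Finset (Finset V)} (hS : IsSTS S) {e : Finset V}
    (he : e.card = 2) {z : V} (hz : z ∉ blockThrough S e) : (blockingPairs S e z).card = 6 := by
  have hb := hS.blockThrough_mem he
  rw [blockingPairs, card_biUnion]
  · have : ∀ x ∈ e, ((blockThrough S {x, z}).powersetCard 2).card = 3 := by
      intro x hx
      rw [card_powersetCard, hS.1 _ (hS.blockThrough_ne he hz hx).2.1]
      rfl
    rw [sum_congr rfl this, sum_const, he]
    rfl
  · intro x hx y hy hxy
    obtain ⟨-, h1, h2, h3, h4⟩ := hS.blockThrough_ne he hz hx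
    obtain ⟨-, h1', h2', h3', h4'⟩ := hS.blockThrough_ne he hz hy
    refine hS.disjoint_pairs h1 h1' fun h => h4 ?_
    exact hS.eq_of_mem hb.1 h1 hxy (hb.2 hx) (hb.2 hy) h2 (by rw [h]; exact h2')

lemma exists_sorted_list {ι κ : Type*} [LinearOrder κ] (s : Finset ι) (τ : ι → κ) :
    ∃ l : List ι, l.Perm s.toList ∧ l.Pairwise fun a b => τ a ≤ τ b := by
  refine ⟨s.toList.mergeSort fun a b => decide (τ a ≤ τ b), List.mergeSort_perm _ _, ?_⟩
  have := List.pairwise_mergeSort (le := fun a b => decide (τ a ≤ τ b))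
    (fun a b c h h' => by
      rw [decide_eq_true_eq] at h h' ⊢
      exact h.trans h')
    (fun a b => by
      rw [Bool.or_eq_true, decide_eq_true_eq, decide_eq_true_eq]
      exact le_total _ _) s.toList
  exact this.imp fun h => by simpa using h

variable {K : ℕ}

/-- The possible third vertices of the block through `e` not yet excluded at time `τ e`. -/
def freeThirds (S : Finset (Finset V)) (Y : Finset V → Finset V) (τ : Finset V → Fin K)
    (e : Finset V) : Finset V :=
  ((Y e).filter (· ∉ blockThrough S e)).filter fun z => ∀ p ∈ blockingPairs S e z, τ e ≤ τ p

/-- An upper bound for the number of choices for the block through `e`. -/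
def choiceBound (S : Finset (Finset V)) (Y : Finset V → Finset V) (τ : Finset V → Fin K)
    (e : Finset V) : ℝ :=
  if ∀ p ∈ siblings S e, τ e ≤ τ p then 1 + (freeThirds S Y τ e).card else 1

lemma card_image_filter_le {F : Finset (Finset (Finset V))} (hF : ∀ S ∈ F, IsSTS S)
    {Y : Finset V → Finset V}
    (hY : ∀ S ∈ F, ∀ T ∈ S, ∀ e ⊆ T, e.card = 2 → ∀ z ∈ T, z ∉ e → z ∈ Y e)
    {τ : Finset V → Fin K} {e : Finset V} (he : e.card = 2) {l : List (Finset V)}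
    (hl : ∀ p, p.card = 2 → τ p < τ e → p ∈ l) {S} (hS : S ∈ F) :
    (((F.filter fun S' => ∀ e' ∈ l, S'.filter (e' ⊆ ·) = S.filter (e' ⊆ ·)).image
      fun S' => S'.filter (e ⊆ ·)).card : ℝ) ≤ choiceBound S Y τ e := by
  have hSs := hF S hS
  obtain ⟨hb1, hb2⟩ := hSs.blockThrough_mem he
  have hrev : ∀ S' : Finset (Finset V), (∀ e' ∈ l, S'.filter (e' ⊆ ·) = S.filter (e' ⊆ ·)) →
      ∀ T ∈ S, ∀ p ∈ T.powersetCard 2, τ p < τ e → T ∈ S' := by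
    intro S' h T hT p hp hlt
    rw [mem_powersetCard] at hp
    have h1 := h p (hl p hp.2 hlt)
    have h2 : T ∈ S.filter (p ⊆ ·) := mem_filter.mpr ⟨hT, hp.1⟩
    rw [← h1] at h2
    exact (mem_filter.mp h2).1
  rw [choiceBound]
  split_ifs with hfresh
  · have hsub : ((F.filter fun S' => ∀ e' ∈ l, S'.filter (e' ⊆ ·) = S.filter (e' ⊆ ·)).image
        fun S' => S'.filter (e ⊆ ·)) ⊆
        (insert (blockThrough S e) ((freeThirds S Y τ e).image fun z => insert z e)).image
          fun T => {T} := by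
      intro b hb
      obtain ⟨S', hS', rfl⟩ := mem_image.mp hb
      obtain ⟨hS'F, hS'⟩ := mem_filter.mp hS'
      have hSs' := hF S' hS'F
      obtain ⟨hb1', hb2'⟩ := hSs'.blockThrough_mem he
      rw [hSs'.filter_eq he]
      refine mem_image_of_mem _ ?_
      rw [mem_insert]
      by_cases heq : blockThrough S' e = blockThrough S e
      · exact Or.inl heq
      right
      have hc : (blockThrough S' e \ e).card = 1 := by
        rw [card_sdiff_of_subset hb2', hSs'.1 _ hb1', he]
      obtain ⟨z, hz⟩ := card_eq_one.mp hc
      have hz' : z ∈ blockThrough S' e ∧ z ∉ e := by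
        rw [← mem_sdiff, hz]
        exact mem_singleton_self z
      have hins : insert z e = blockThrough S' e := by
        rw [insert_eq, ← hz, sdiff_union_of_subset hb2']
      have hzb : z ∉ blockThrough S e := by
        intro h
        refine heq (eq_of_subset_of_card_le ?_ ?_)
        · rw [← hins, insert_subset_iff]
          exact ⟨h, hb2⟩
        · rw [hSs.1 _ hb1, hSs'.1 _ hb1']
      rw [mem_image]
      refine ⟨z, ?_, hins⟩
      rw [freeThirds, mem_filter, mem_filter]
      refine ⟨⟨hY S' hS'F _ hb1' e hb2' he z hz'.1 hz'.2, hzb⟩, fun p hp => ?_⟩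
      by_contra hlt
      obtain ⟨x, hx, hp⟩ := mem_biUnion.mp hp
      obtain ⟨-, h1, h2, h3, h4⟩ := hSs.blockThrough_ne he hzb hx
      have h5 := hrev S' hS' _ h1 p hp (not_le.mp hlt)
      have hxz : x ≠ z := fun h => hz'.2 (h ▸ hx)
      have h6 := hSs'.eq_of_mem hb1' h5 hxz (hb2' hx) hz'.1 h2 h3
      refine h4 (hSs.eq_blockThrough he h1 ?_).symm
      rw [← h6]
      exact hb2'
    refine (Nat.cast_le.mpr (card_le_card hsub)).trans ?_
    have h1 := (card_image_le (s := insert (blockThrough S e)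
      ((freeThirds S Y τ e).image fun z => insert z e)) (f := fun T => ({T} : Finset _))).trans
      ((card_insert_le _ _).trans (Nat.add_le_add_right card_image_le 1))
    rw [add_comm] at h1
    exact_mod_cast h1
  · push Not at hfresh
    obtain ⟨p, hp, hlt⟩ := hfresh
    have : ((F.filter fun S' => ∀ e' ∈ l, S'.filter (e' ⊆ ·) = S.filter (e' ⊆ ·)).image
        fun S' => S'.filter (e ⊆ ·)) ⊆ {{blockThrough S e}} := by
      intro b hb
      obtain ⟨S', hS', rfl⟩ := mem_image.mp hb
      obtain ⟨hS'F, hS'⟩ := mem_filter.mp hS'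
      have hSs' := hF S' hS'F
      rw [mem_singleton, hSs'.filter_eq he,
        hSs'.eq_blockThrough he (hrev S' hS' _ hb1 p (mem_of_mem_erase hp) hlt) hb2]
    have h1 := card_le_card this
    rw [card_singleton] at h1
    exact_mod_cast h1

/-- The entropy bound for families of Steiner triple systems with prescribed possible third
vertices. -/
lemma card_le_exp_sum_avgLog [Fintype V] (hK : 0 < K) {F : Finset (Finset (Finset V))}
    (hF : ∀ S ∈ F, IsSTS S) {Y : Finset V → Finset V}
    (hY : ∀ S ∈ F, ∀ T ∈ S, ∀ e ⊆ T, e.card = 2 → ∀ z ∈ T, z ∉ e → z ∈ Y e) :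
    (F.card : ℝ) ≤ Real.exp (∑ e ∈ univ.powersetCard 2, avgLog K (Y e).card) := by
  have : Nonempty (Fin K) := ⟨⟨0, hK⟩⟩
  refine card_le_exp_of_average (Ω := Finset V → Fin K)
    (L := fun S τ => ∑ e ∈ univ.powersetCard 2, Real.log (choiceBound S Y τ e)) ?_ ?_
  · intro τ
    obtain ⟨l, hperm, hsort⟩ := exists_sorted_list ((univ : Finset V).powersetCard 2) τ
    have hmem : ∀ p, p ∈ l ↔ p.card = 2 := by
      intro p
      rw [hperm.mem_iff, mem_toList, mem_powersetCard_univ]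
    have h1 := sum_prod_inv_le_one (fun e (S : Finset (Finset V)) => S.filter (e ⊆ ·))
      (fun e S => choiceBound S Y τ e) l F ?_ ?_
    · refine le_of_eq_of_le (sum_congr rfl fun S _ => ?_) h1
      rw [(hperm.map _).prod_eq, prod_map_toList, ← sum_neg_distrib, Real.exp_sum]
      refine prod_congr rfl fun e _ => ?_
      have hpos : 0 < choiceBound S Y τ e := by
        rw [choiceBound]
        split_ifs <;> positivity
      rw [Real.exp_neg, Real.exp_log hpos]
    · intro S hS S' hS' h
      have key : ∀ S₁ ∈ F, ∀ S₂, (∀ e ∈ l, S₁.filter (e ⊆ ·) = S₂.filter (e ⊆ ·)) → S₁ ⊆ S₂ := by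
        intro S₁ h₁ S₂ h₂ T hT
        obtain ⟨e, heT, hec⟩ := exists_subset_card_eq (s := T) (n := 2)
          (by rw [(hF S₁ h₁).1 T hT]; norm_num)
        have h3 : T ∈ S₁.filter (e ⊆ ·) := mem_filter.mpr ⟨hT, heT⟩
        rw [h₂ e ((hmem e).mpr hec)] at h3
        exact (mem_filter.mp h3).1
      exact (key S hS S' h).antisymm (key S' hS' S fun e he => (h e he).symm)
    · intro l₁ e l₂ hl S hS
      have he : e.card = 2 := (hmem e).mp (by rw [hl]; simp)
      refine card_image_filter_le hF hY he ?_ hS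
      intro p hp hlt
      have hpl := (hmem p).mpr hp
      rw [hl, List.mem_append, List.mem_cons] at hpl
      rw [hl, List.pairwise_append, List.pairwise_cons] at hsort
      rcases hpl with h | rfl | h
      · exact h
      · exact absurd hlt (lt_irrefl _)
      · exact absurd hlt (hsort.2.1.1 p h).not_gt
  · intro S hS
    have hSs := hF S hS
    rw [sum_comm, mul_sum]
    refine sum_le_sum fun e he => ?_
    rw [mem_powersetCard_univ] at he
    have hself : e ∈ (blockThrough S e).powersetCard 2 :=
      mem_powersetCard.mpr ⟨(hSs.blockThrough_mem he).2, he⟩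
    have h := sum_log_choices_le (K := K) e (A₀ := siblings S e) (notMem_erase _ _)
      (hSs.card_siblings he) ((Y e).filter (· ∉ blockThrough S e)) (blockingPairs S e)
      (fun z hz => hSs.card_blockingPairs he (mem_filter.mp hz).2)
      (fun z hz => disjoint_left.mp (hSs.disjoint_blockingPairs he (mem_filter.mp hz).2) hself)
      (fun z hz => (hSs.disjoint_blockingPairs he (mem_filter.mp hz).2).mono_left
        (erase_subset _ _))
      (Nat.cast_le.mpr (card_filter_le (Y e) _))
    refine le_of_eq_of_le (sum_congr rfl fun τ _ => ?_) h
    rw [choiceBound]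
    split_ifs
    · rw [freeThirds]
      congr
    · exact Real.log_one

end Upper

section HoleCount

lemma card_crossing_pairs_ge {V : Type*} [Fintype V] [DecidableEq V] {A B : Finset V}
    (h : Disjoint A B) :
    A.card * B.card ≤ (((univ : Finset V).powersetCard 2).filter fun e =>
      (∃ x ∈ e, x ∈ A) ∧ ∃ y ∈ e, y ∈ B).card := by
  rw [← card_product]
  refine card_le_card_of_injOn (fun p => {p.1, p.2}) ?_ ?_
  · rintro ⟨x, y⟩ hxy
    rw [mem_coe, mem_product] at hxy
    have hne : x ≠ y := fun h' => disjoint_left.mp h hxy.1 (by rw [h']; exact hxy.2)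
    simp only [coe_filter, Set.mem_ofPred_eq, mem_powersetCard_univ, card_pair hne, true_and]
    exact ⟨⟨x, by simp, hxy.1⟩, ⟨y, by simp, hxy.2⟩⟩
  · rintro ⟨x, y⟩ hxy ⟨x', y'⟩ hxy' heq
    simp only [coe_product, Set.mem_prod, mem_coe] at hxy hxy'
    dsimp only at heq
    have hx : x = x' := by
      have : x ∈ ({x', y'} : Finset V) := by rw [← heq]; simp
      rw [mem_insert, mem_singleton] at this
      rcases this with h' | h'
      · exact h'
      · exact absurd hxy'.2 (by rw [← h']; exact disjoint_left.mp h hxy.1)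
    have hy : y = y' := by
      have : y ∈ ({x', y'} : Finset V) := by rw [← heq]; simp
      rw [mem_insert, mem_singleton] at this
      rcases this with h' | h'
      · exact absurd hxy.2 (by rw [h']; exact disjoint_left.mp h hxy'.1)
      · exact h'
    rw [hx, hy]

/-- Few Steiner triple systems have a prescribed hole. -/
lemma card_hole_le {n a K : ℕ} (hK : 2 ≤ K) (hn : 2 * K ^ 6 ≤ n) {X : Fin 3 → Finset (Fin n)}
    (hX : ∀ i, (X i).card = a) (hd : ∀ i j, i ≠ j → Disjoint (X i) (X j))
    {F : Finset (Finset (Finset (Fin n)))} (hF : ∀ S ∈ F, IsSTS S)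
    (hole : ∀ S ∈ F, ∀ T ∈ S, ∃ i, ∀ v ∈ T, v ∉ X i) :
    (F.card : ℝ) ≤ Real.exp ((n : ℝ) ^ 2 / 6 * (Real.log n - 2) +
      20 * ((n : ℝ) ^ 2 * Real.log n / K) - (a : ℝ) ^ 3 / (3 * n)) := by
  have h3a : 2 * a ≤ n := by
    have h1 := card_le_univ (X 0 ∪ X 1)
    rw [card_union_of_disjoint (hd 0 1 (by decide)), hX, hX, Fintype.card_fin] at h1
    omega
  have hK6 : 64 ≤ K ^ 6 := by
    calc 64 = 2 ^ 6 := by norm_num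
      _ ≤ K ^ 6 := Nat.pow_le_pow_left hK 6
  have hn0 : (0 : ℝ) < n := by exact_mod_cast (by omega : 0 < n)
  have hK0 : (0 : ℝ) < K := by exact_mod_cast (by omega : 0 < K)
  have hlog : ∀ m : ℕ, K ^ 6 ≤ m → 2 ≤ Real.log m := by
    intro m hm
    have h1 : (64 : ℝ) ≤ m := by exact_mod_cast hK6.trans hm
    have h2 := Real.log_le_log (by norm_num) h1
    have h3 : Real.log (64 : ℝ) = 6 * Real.log 2 := by
      rw [show (64 : ℝ) = 2 ^ 6 by norm_num, Real.log_pow]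
      norm_num
    have := Real.log_two_gt_d9
    linarith
  set U : ℝ → ℝ := fun L => (L - 2) / 3 + 40 * L / K with hU
  have hUm : ∀ m : ℕ, K ^ 6 ≤ m → avgLog K m ≤ U (Real.log m) := by
    intro m hm
    refine avgLog_le hK (by exact_mod_cast hm) ?_
    linarith [hlog m hm]
  set Y : Finset (Fin n) → Finset (Fin n) := fun e =>
    if (∃ x ∈ e, x ∈ X 0) ∧ ∃ y ∈ e, y ∈ X 1 then (X 2)ᶜ else univ with hY
  have hY' : ∀ S ∈ F, ∀ T ∈ S, ∀ e ⊆ T, e.card = 2 → ∀ z ∈ T, z ∉ e → z ∈ Y e := by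
    intro S hS T hT e heT _ z hz _
    rw [hY]
    dsimp only
    split_ifs with hc
    · obtain ⟨⟨x, hx, hx'⟩, ⟨y, hy, hy'⟩⟩ := hc
      obtain ⟨i, hi⟩ := hole S hS T hT
      fin_cases i
      · exact absurd hx' (hi x (heT hx))
      · exact absurd hy' (hi y (heT hy))
      · exact mem_compl.mpr (hi z hz)
    · exact mem_univ z
  refine (card_le_exp_sum_avgLog (K := K) (by omega) hF hY').trans (Real.exp_le_exp.mpr ?_)
  have hterm : ∀ e : Finset (Fin n), avgLog K (Y e).card ≤ U (Real.log n) -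
      if (∃ x ∈ e, x ∈ X 0) ∧ ∃ y ∈ e, y ∈ X 1 then (a : ℝ) / n / 3 else 0 := by
    intro e
    rw [hY]
    dsimp only
    split_ifs with hc
    · rw [card_compl, Fintype.card_fin, hX]
      refine (hUm (n - a) (by omega)).trans ?_
      have hna : (0 : ℝ) < (n - a : ℕ) := by exact_mod_cast (by omega : 0 < n - a)
      have h1 : Real.log (n - a : ℕ) ≤ Real.log n - a / n := by
        have h2 := Real.log_le_sub_one_of_pos (div_pos hna hn0)
        rw [Real.log_div hna.ne' hn0.ne', Nat.cast_sub (by omega), sub_div, div_self hn0.ne'] at h2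
        rw [Nat.cast_sub (by omega)]
        linarith
      have h0 : (0 : ℝ) ≤ a / n := by positivity
      have h2 : 40 * Real.log (n - a : ℕ) / K ≤ 40 * Real.log n / K := by
        gcongr
        omega
      rw [hU]
      dsimp only
      linarith
    · rw [card_univ, Fintype.card_fin, sub_zero]
      exact hUm n (by omega)
  refine (sum_le_sum fun e _ => hterm e).trans ?_
  rw [sum_sub_distrib, sum_const, card_powersetCard, card_univ, Fintype.card_fin, nsmul_eq_mul,
    ← sum_filter, sum_const, nsmul_eq_mul]
  have hc := card_crossing_pairs_ge (hd 0 1 (by decide))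
  rw [hX, hX] at hc
  have hc' : (a : ℝ) * a ≤ (((univ : Finset (Fin n)).powersetCard 2).filter fun e =>
      (∃ x ∈ e, x ∈ X 0) ∧ ∃ y ∈ e, y ∈ X 1).card := by
    refine le_trans (by exact_mod_cast hc) (Nat.cast_le.mpr (le_of_eq ?_))
    congr
  have h1 : (a : ℝ) ^ 3 / (3 * n) ≤ (((univ : Finset (Fin n)).powersetCard 2).filter fun e =>
      (∃ x ∈ e, x ∈ X 0) ∧ ∃ y ∈ e, y ∈ X 1).card * ((a : ℝ) / n / 3) := by
    calc (a : ℝ) ^ 3 / (3 * n) = a * a * ((a : ℝ) / n / 3) := by field_simp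
      _ ≤ _ := by gcongr
  have hU0 : 0 ≤ U (Real.log n) := by
    have h2 := hlog n (by omega)
    have h3 : 0 ≤ 40 * Real.log n / K := by positivity
    rw [hU]
    dsimp only
    linarith
  have h2 : (n.choose 2 : ℝ) ≤ (n : ℝ) ^ 2 / 2 := by
    rw [Nat.cast_choose_two]
    nlinarith only [hn0]
  have h3 := mul_le_mul_of_nonneg_right h2 hU0
  have h4 : (n : ℝ) ^ 2 / 2 * U (Real.log n) = (n : ℝ) ^ 2 / 6 * (Real.log n - 2) +
      20 * ((n : ℝ) ^ 2 * Real.log n / K) := by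
    rw [hU]
    ring
  linarith

end HoleCount

section Final

lemma exists_hasHole_of_lt_holeNumber {n : ℕ} {S : Finset (Finset (Fin n))} {b : ℝ} (hb : 0 ≤ b)
    (h : b < holeNumber 3 S) : ∃ a : ℕ, b < a ∧ HasHole 3 S a := by
  have hbdd : BddAbove {a | HasHole 3 S a} := by
    refine ⟨n, ?_⟩
    rintro a ⟨X, hX, -, -⟩
    rw [← hX 0]
    exact (card_le_univ _).trans (Fintype.card_fin n).le
  have hne : {a | HasHole 3 S a}.Nonempty := by
    rw [Set.nonempty_iff_ne_empty]
    intro h0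
    rw [holeNumber, h0, csSup_empty] at h
    simp only [bot_eq_zero', Nat.cast_zero] at h
    linarith
  exact ⟨holeNumber 3 S, h, Nat.sSup_mem hne hbdd⟩

open Classical in
lemma card_large_hole_le {n J : ℕ} (hJ : 2 ≤ J) (hn : J ^ 1000 ≤ n) {b : ℝ} (hb : 0 ≤ b) :
    (((allSTS n).filter fun S => b < holeNumber 3 S).card : ℝ) ≤
      Real.exp (3 * n + (n : ℝ) ^ 2 / 6 * (Real.log n - 2) +
        20 * ((n : ℝ) ^ 2 * Real.log n / J) - b ^ 3 / (3 * n)) := by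
  have hn1 : 1 ≤ n := le_trans (Nat.one_le_pow _ _ (by omega)) hn
  have hn0 : (1 : ℝ) ≤ n := by exact_mod_cast hn1
  set M := (n : ℝ) ^ 2 / 6 * (Real.log n - 2) +
        20 * ((n : ℝ) ^ 2 * Real.log n / J) - b ^ 3 / (3 * n) with hM
  set G : (Fin 3 → Finset (Fin n)) → Finset (Finset (Finset (Fin n))) := fun X =>
    (allSTS n).filter fun S => ∃ a : ℕ, b < a ∧ (∀ i, (X i).card = a) ∧
      (∀ i j, i ≠ j → Disjoint (X i) (X j)) ∧ ∀ e ∈ S, ∃ i, ∀ v ∈ e, v ∉ X i with hG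
  have hsub : ((allSTS n).filter fun S => b < holeNumber 3 S) ⊆ univ.biUnion G := by
    intro S hS
    rw [mem_filter] at hS
    obtain ⟨a, ha, X, h1, h2, h3⟩ := exists_hasHole_of_lt_holeNumber hb hS.2
    rw [mem_biUnion]
    exact ⟨X, mem_univ _, mem_filter.mpr ⟨hS.1, a, ha, h1, h2, h3⟩⟩
  have hGle : ∀ X, ((G X).card : ℝ) ≤ Real.exp M := by
    intro X
    rcases (G X).eq_empty_or_nonempty with h0 | ⟨S₀, hS₀⟩
    · rw [h0, card_empty, Nat.cast_zero]
      exact (Real.exp_pos _).le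
    obtain ⟨-, a, ha, h1, h2, -⟩ := mem_filter.mp hS₀
    have hK : 2 ≤ J ^ 100 := hJ.trans (Nat.le_self_pow (by norm_num) J)
    have hnK : 2 * (J ^ 100) ^ 6 ≤ n := by
      calc 2 * (J ^ 100) ^ 6 ≤ J * (J ^ 100) ^ 6 := by gcongr
        _ ≤ J ^ 100 * (J ^ 100) ^ 6 := by
          gcongr
          exact Nat.le_self_pow (by norm_num) J
        _ = (J ^ 100) ^ 7 := (pow_succ' _ _).symm
        _ ≤ (J ^ 100) ^ 10 := Nat.pow_le_pow_right (by omega) (by norm_num)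
        _ = J ^ 1000 := (pow_mul J 100 10).symm
        _ ≤ n := hn
    refine (card_hole_le hK hnK h1 h2 (F := G X) (fun S hS => mem_allSTS.mp (mem_filter.mp hS).1)
      ?_).trans (Real.exp_le_exp.mpr ?_)
    · intro S hS
      obtain ⟨-, a', -, -, -, h3⟩ := mem_filter.mp hS
      exact h3
    · have e1 : b ^ 3 / (3 * n) ≤ (a : ℝ) ^ 3 / (3 * n) := by gcongr
      have hl : 0 ≤ Real.log n := Real.log_nonneg hn0
      have hJ0 : (0 : ℝ) < J := by positivity
      have e2 : (n : ℝ) ^ 2 * Real.log n / (J ^ 100 : ℕ) ≤ (n : ℝ) ^ 2 * Real.log n / J := by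
        gcongr
        exact Nat.le_self_pow (by norm_num) J
      rw [hM]
      linarith
  have h8 : ((8 : ℝ)) ^ n ≤ Real.exp (3 * n) := by
    have h1 : (8 : ℝ) ≤ Real.exp 3 := by
      have := Real.add_one_le_exp (1 : ℝ)
      have h2 : Real.exp 3 = Real.exp 1 ^ 3 := by rw [← Real.exp_nat_mul]; norm_num
      rw [h2]
      calc (8 : ℝ) = (1 + 1) ^ 3 := by norm_num
        _ ≤ Real.exp 1 ^ 3 := by gcongr
    rw [mul_comm, Real.exp_nat_mul]
    gcongr
  have h9 : (((allSTS n).filter fun S => b < holeNumber 3 S).card : ℝ) ≤ 8 ^ n * Real.exp M := by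
    calc (((allSTS n).filter fun S => b < holeNumber 3 S).card : ℝ)
        ≤ ∑ X, ((G X).card : ℝ) := by
          exact_mod_cast (card_le_card hsub).trans card_biUnion_le
      _ ≤ ∑ _X : Fin 3 → Finset (Fin n), Real.exp M := sum_le_sum fun X _ => hGle X
      _ = 8 ^ n * Real.exp M := by
          rw [sum_const, card_univ, Fintype.card_fun, Fintype.card_finset, Fintype.card_fin,
            Fintype.card_fin, nsmul_eq_mul, ← pow_mul, mul_comm n 3, pow_mul]
          norm_num
  refine h9.trans ?_
  have e : 3 * (n : ℝ) + (n : ℝ) ^ 2 / 6 * (Real.log n - 2) +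
      20 * ((n : ℝ) ^ 2 * Real.log n / J) - b ^ 3 / (3 * n) = 3 * n + M := by rw [hM]; ring
  rw [e, Real.exp_add]
  gcongr

lemma exists_scale {y : ℝ} {n : ℕ} (hy : 20 ≤ y) (hn : y ^ 2000 = n) :
    ∃ J : ℕ, 300 ≤ J ∧ J % 3 ≠ 0 ∧ J ^ 1000 ≤ n ∧ y ^ 2 / 2 ≤ J := by
  obtain ⟨J, h1, h2, h3⟩ : ∃ J : ℕ, J % 3 ≠ 0 ∧ J ≤ ⌊y ^ 2⌋₊ ∧ ⌊y ^ 2⌋₊ ≤ J + 1 := by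
    by_cases h : ⌊y ^ 2⌋₊ % 3 = 0
    · have h0 : 1 ≤ ⌊y ^ 2⌋₊ := Nat.le_floor (by push_cast; nlinarith only [hy])
      exact ⟨⌊y ^ 2⌋₊ - 1, by omega, by omega, by omega⟩
    · exact ⟨_, h, le_rfl, by omega⟩
  have h4 := Nat.lt_floor_add_one (y ^ 2)
  have h5 : (⌊y ^ 2⌋₊ : ℝ) ≤ J + 1 := by exact_mod_cast h3
  have hy2 : 400 ≤ y ^ 2 := by nlinarith only [hy]
  have h6 : (J : ℝ) ≤ y ^ 2 := (Nat.cast_le.mpr h2).trans (Nat.floor_le (by positivity))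
  refine ⟨J, ?_, h1, ?_, by linarith⟩
  · have : (300 : ℝ) ≤ J := by linarith
    exact_mod_cast this
  · have : (J : ℝ) ^ 1000 ≤ n := by
      calc (J : ℝ) ^ 1000 ≤ (y ^ 2) ^ 1000 := by gcongr
        _ = (n : ℝ) := by rw [← pow_mul, ← hn]
    exact_mod_cast this

open Classical in
lemma card_large_hole_le_mul {ε y : ℝ} (hε : 0 < ε) {n : ℕ} (hn : y ^ 2000 = n) (hy : 40 ≤ y)
    (hlog : 6000000 * Real.log y ≤ y) (hlogε : -Real.log ε ≤ y)
    (hn6 : n % 6 = 1 ∨ n % 6 = 3) :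
    (((allSTS n).filter fun S => (n : ℝ) ^ (1 - 1 / 6000 : ℝ) < holeNumber 3 S).card : ℝ) ≤
      ε * (allSTS n).card := by
  obtain ⟨J, hJ, hJ3, hJn, hyJ⟩ := exists_scale (by linarith) hn
  have hy0 : 0 < y := by linarith
  obtain ⟨hpos, hlow⟩ := log_card_allSTS_ge hJ hJ3 hJn hn6
  have hA : (0 : ℝ) < (allSTS n).card := by exact_mod_cast hpos
  refine (card_large_hole_le (by omega) hJn (by positivity)).trans ?_
  rw [← Real.exp_log hε, ← Real.exp_log hA, ← Real.exp_add, Real.exp_le_exp]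
  have hnpos : (0 : ℝ) < n := by rw [← hn]; positivity
  have hb : ((n : ℝ) ^ (1 - 1 / 6000 : ℝ)) ^ 3 / (3 * n) = (n : ℝ) ^ 2 / (3 * y) := by
    have e1 : y = (n : ℝ) ^ (1 / 2000 : ℝ) := by
      rw [← hn, ← Real.rpow_natCast, ← Real.rpow_mul hy0.le]
      norm_num
    have e2 : ((n : ℝ) ^ (1 - 1 / 6000 : ℝ)) ^ 3 * y = (n : ℝ) ^ 3 := by
      rw [e1, ← Real.rpow_natCast, ← Real.rpow_mul hnpos.le, ← Real.rpow_add hnpos,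
        ← Real.rpow_natCast]
      norm_num
    rw [div_eq_div_iff (by positivity) (by positivity)]
    linear_combination 3 * e2
  rw [hb]
  have hlogn : Real.log n = 2000 * Real.log y := by
    rw [← hn, Real.log_pow]
    norm_num
  have hly : 0 ≤ Real.log y := Real.log_nonneg (by linarith)
  have h1 : (n : ℝ) ^ 2 * Real.log n / J ≤ (n : ℝ) ^ 2 / y * (1 / 1000) := by
    have hJ0 : (0 : ℝ) < J := lt_of_lt_of_le (by positivity) hyJ
    calc (n : ℝ) ^ 2 * Real.log n / J ≤ (n : ℝ) ^ 2 * Real.log n / (y ^ 2 / 2) := by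
          have : 0 ≤ Real.log n := by rw [hlogn]; positivity
          gcongr
      _ = (n : ℝ) ^ 2 / y * (4000 * Real.log y / y) := by
          rw [hlogn]
          field_simp
          ring
      _ ≤ (n : ℝ) ^ 2 / y * (1 / 1000) := by
          refine mul_le_mul_of_nonneg_left ?_ (by positivity)
          rw [div_le_iff₀ hy0]
          linarith
  have hny : y ^ 3 ≤ n := by
    rw [← hn]
    exact pow_le_pow_right₀ (by linarith) (by norm_num)
  set R := (n : ℝ) ^ 2 / y with hR
  have hR1 : (n : ℝ) * y ^ 2 ≤ R := by
    rw [hR, le_div_iff₀ hy0]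
    calc (n : ℝ) * y ^ 2 * y = n * y ^ 3 := by ring
      _ ≤ (n : ℝ) * n := by gcongr
      _ = (n : ℝ) ^ 2 := by ring
  have hR2 : 1600 * (n : ℝ) ≤ R := by
    refine le_trans ?_ hR1
    nlinarith only [hy, hnpos, mul_le_mul hy hy (by norm_num) hy0.le]
  have hyn : y ≤ n := by
    refine le_trans ?_ hny
    exact le_self_pow₀ (by linarith) (by norm_num)
  have e3 : (n : ℝ) ^ 2 / (3 * y) = R / 3 := by rw [hR]; field_simp
  rw [e3]
  linarith

end Final

end STSHole

/-- There is a `δ > 0` such that a uniformly random Steiner triple system `S` on `{1,…,n}`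
a.a.s. satisfies `α*_3(S) ≤ n^{1−δ}`: for every `ε > 0` there is `N` such that for all
`n ≥ N` with `n ≡ 1, 3 (mod 6)`, the number of Steiner triple systems on `Fin n` with
`α*_3(S) ≤ n^{1−δ}` is at least `(1−ε)` times the total number of Steiner triple systems
on `Fin n`. -/
theorem stmt9 :
    ∃ δ : ℝ, 0 < δ ∧ ∀ ε : ℝ, 0 < ε → ∃ N : ℕ, ∀ n : ℕ, N ≤ n →
      (n % 6 = 1 ∨ n % 6 = 3) →
      (1 - ε) * (Nat.card {E : Finset (Finset (Fin n)) // IsSTS E} : ℝ) ≤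
        (Nat.card {E : Finset (Finset (Fin n)) //
            IsSTS E ∧ (holeNumber 3 E : ℝ) ≤ (n : ℝ) ^ ((1 : ℝ) - δ)} : ℝ) := by
  refine ⟨1 / 6000, by norm_num, fun ε hε => ?_⟩
  have hlim : Filter.Tendsto (fun n : ℕ => (n : ℝ) ^ (1 / 2000 : ℝ)) Filter.atTop Filter.atTop :=
    (tendsto_rpow_atTop (by norm_num)).comp tendsto_natCast_atTop_atTop
  have hev : ∀ᶠ y : ℝ in Filter.atTop,
      40 ≤ y ∧ 6000000 * Real.log y ≤ y ∧ -Real.log ε ≤ y := by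
    have h1 := Real.isLittleO_log_id_atTop.bound (show (0 : ℝ) < 1 / 6000000 by norm_num)
    filter_upwards [h1, Filter.eventually_ge_atTop 40,
      Filter.eventually_ge_atTop (-Real.log ε)] with y h2 h3 h4
    refine ⟨h3, ?_, h4⟩
    rw [id, Real.norm_of_nonneg (by linarith : (0 : ℝ) ≤ y)] at h2
    have := (le_abs_self _).trans h2
    linarith
  obtain ⟨N, hN⟩ := Filter.eventually_atTop.mp (hlim.eventually hev)
  refine ⟨N, fun n hn hn6 => ?_⟩
  obtain ⟨h1, h2, h3⟩ := hN n hn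
  classical
  have hpow : ((n : ℝ) ^ (1 / 2000 : ℝ)) ^ 2000 = n := by
    rw [← Real.rpow_natCast, ← Real.rpow_mul (Nat.cast_nonneg n)]
    norm_num
  have hbad := STSHole.card_large_hole_le_mul hε hpow h1 h2 h3 hn6
  rw [Nat.subtype_card (STSHole.allSTS n) (fun E => STSHole.mem_allSTS),
    Nat.subtype_card ((STSHole.allSTS n).filter fun E =>
      (holeNumber 3 E : ℝ) ≤ (n : ℝ) ^ ((1 : ℝ) - 1 / 6000))
      (fun E => by rw [Finset.mem_filter, STSHole.mem_allSTS])]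
  have hsplit := Finset.card_filter_add_card_filter_not (s := STSHole.allSTS n)
    (fun E => (holeNumber 3 E : ℝ) ≤ (n : ℝ) ^ ((1 : ℝ) - 1 / 6000))
  simp only [not_le] at hsplit
  have hsplit' := congrArg (Nat.cast : ℕ → ℝ) hsplit
  rw [Nat.cast_add] at hsplit'
  linarith
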